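/- For every matroid M with finite ground set E and rank r+1, the h-vector of the broken circuit complex of M is nonnegative and log-concave: h_k ≥ 0 for all 0 ≤ k ≤ r+1, and h_{k-1}·h_{k+1} ≤ h_k² for all 0 < k < r+1. -/

import Mathlib

open Polynomial

/-- The rank of a set `X` in a matroid `M`: the supremum of the cardinalities of the
independent subsets of `X`. -/
noncomputable def matroidRank {α : Type*} (M : Matroid α) (X : Set α) : ℕ :=
  sSup {m | ∃ I ⊆ X, M.Indep I ∧ I.ncard = m}

/-- The characteristic polynomial of a matroid `M` of rank `r + 1` whose ground set is a
finite type `α` :  `χ_M(q) = Σ_{S ⊆ E} (−1)^{|S|} q^{(r+1) − rk(S)}`. -/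
noncomputable def matroidCharPoly {α : Type*} [Fintype α] (M : Matroid α) (r : ℕ) :
    Polynomial ℤ :=
  ∑ S : Finset α, (-1 : Polynomial ℤ) ^ S.card * X ^ (r + 1 - matroidRank M ↑S)

set_option linter.unusedSectionVars false

open Finset in
/-- A symmetric matrix identity. -/
theorem sum_quadratic_sub {ι : Type*} [Fintype ι] (Q : ι → ι → ℝ) (hQ : ∀ v w, Q v w = Q w v)
    (c : ι → ℝ) (y : ι → ℝ) :
    ∑ v, ∑ w, Q v w * (c v * y v) * (c w * y w) - ∑ v, (c v * (∑ w, Q v w * c w)) * y v ^ 2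
      = - (1 / 2) * ∑ v, ∑ w, Q v w * c v * c w * (y v - y w) ^ 2 := by
  have h1 : ∑ v, ∑ w, Q v w * c v * c w * (y v - y w) ^ 2
      = ∑ v, ∑ w, Q v w * c v * c w * y v ^ 2 + ∑ v, ∑ w, Q v w * c v * c w * y w ^ 2
        - 2 * ∑ v, ∑ w, Q v w * (c v * y v) * (c w * y w) := by
    rw [mul_sum, ← sum_add_distrib, ← sum_sub_distrib]
    refine sum_congr rfl fun v _ => ?_
    rw [mul_sum, ← sum_add_distrib, ← sum_sub_distrib]
    exact sum_congr rfl fun w _ => by ring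
  have h2 : ∑ v, ∑ w, Q v w * c v * c w * y w ^ 2 = ∑ v, ∑ w, Q v w * c v * c w * y v ^ 2 := by
    rw [sum_comm]
    exact sum_congr rfl fun v _ => sum_congr rfl fun w _ => by rw [hQ]; ring
  have h3 : ∑ v, (c v * (∑ w, Q v w * c w)) * y v ^ 2
      = ∑ v, ∑ w, Q v w * c v * c w * y v ^ 2 := by
    refine sum_congr rfl fun v _ => ?_
    rw [mul_sum, sum_mul]
    exact sum_congr rfl fun w _ => by ring
  rw [h1, h2, h3]; ring

open Finset in
/-- Perron-Frobenius-Bochner criterion -/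
theorem quadratic_nonpos_of_bochner {ι : Type*} [Fintype ι] (Q : ι → ι → ℝ)
    (hQ : ∀ v w, Q v w = Q w v) (c : ι → ℝ) (hc : ∀ v, 0 < c v)
    (hoff : ∀ v w, v ≠ w → 0 ≤ Q v w) (hpos : ∀ v, 0 < ∑ w, Q v w * c w)
    (hconn : ∀ v w, Relation.ReflTransGen (fun a b => 0 < Q a b) v w)
    (hboch : ∀ ξ : ι → ℝ, ∑ v, ∑ w, Q v w * ξ v * ξ w ≤
      ∑ v, c v * (∑ w, Q v w * ξ w) ^ 2 / (∑ w, Q v w * c w))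
    (ξ : ι → ℝ) (hξ : ∑ v, ξ v * ∑ w, Q v w * c w = 0) :
    ∑ v, ∑ w, Q v w * ξ v * ξ w ≤ 0 := by
  classical
  set q : ι → ℝ := fun v => ∑ w, Q v w * c w with hq
  set s : ι → ℝ := fun v => √(q v / c v) with hs
  have hqc : ∀ v, 0 < q v / c v := fun v => div_pos (hpos v) (hc v)
  have hs0 : ∀ v, 0 < s v := fun v => Real.sqrt_pos.2 (hqc v)
  have hs2 : ∀ v, s v ^ 2 = q v / c v := fun v => Real.sq_sqrt (hqc v).le
  have hq2 : ∀ v, q v = c v * s v ^ 2 := fun v => by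
    rw [hs2]; field_simp [(hc v).ne']
  let M : Matrix ι ι ℝ := Matrix.of fun v w => Q v w / (s v * s w)
  have hM : M.IsHermitian := by
    ext v w
    simp [M, hQ v w, mul_comm]
  let T := Matrix.toEuclideanLin M
  have hT : T.IsSymmetric := Matrix.isSymmetric_toEuclideanLin_iff.2 hM
  have hTapp : ∀ (x : EuclideanSpace ℝ ι) v, T x v = ∑ w, Q v w / (s v * s w) * x w := by
    intro x v
    simp [T, M, Matrix.toEuclideanLin, Matrix.toLin'_apply, Matrix.mulVec, dotProduct]
  have hinner : ∀ x y : EuclideanSpace ℝ ι, inner ℝ x y = ∑ v, x v * y v := by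
    intro x y
    simp [PiLp.inner_apply, mul_comm]
  -- the quadratic form in rescaled coordinates
  have hTq : ∀ x : EuclideanSpace ℝ ι, inner ℝ x (T x)
      = ∑ v, ∑ w, Q v w * (x v / s v) * (x w / s w) := by
    intro x
    rw [hinner]
    refine sum_congr rfl fun v _ => ?_
    rw [hTapp, mul_sum]
    refine sum_congr rfl fun w _ => ?_
    have := (hs0 v).ne'; have := (hs0 w).ne'
    field_simp
  let n := Module.finrank ℝ (EuclideanSpace ℝ ι)
  let b := hT.eigenvectorBasis (n := n) rfl
  let μ := hT.eigenvalues (n := n) rfl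
  have hb : ∀ i, T (b i) = μ i • b i := fun i => by
    exact hT.apply_eigenvectorBasis rfl i
  have hbn : ∀ i, ∑ v, b i v ^ 2 = 1 := by
    intro i
    have := b.orthonormal.1 i
    have h2 : inner ℝ (b i) (b i) = (1:ℝ) := by
      rw [real_inner_self_eq_norm_sq, this]; norm_num
    rw [hinner] at h2
    rw [← h2]; exact sum_congr rfl fun v _ => by ring
  have hbq : ∀ i, ∑ v, ∑ w, Q v w * (b i v / s v) * (b i w / s w) = μ i := by
    intro i
    rw [← hTq, hb, inner_smul_right, hinner]
    have := hbn i
    simp only [← pow_two]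
    rw [this, mul_one]
  have hrow : ∀ i v, ∑ w, Q v w * (b i w / s w) = μ i * (s v * b i v) := by
    intro i v
    have h1 : T (b i) v = μ i * b i v := by rw [hb]; simp
    rw [hTapp] at h1
    have : ∑ w, Q v w * (b i w / s w) = s v * ∑ w, Q v w / (s v * s w) * (b i) w := by
      rw [mul_sum]
      refine sum_congr rfl fun w _ => ?_
      have := (hs0 v).ne'; have := (hs0 w).ne'
      field_simp
    rw [this, h1]; ring
  have hμ1 : ∀ i, μ i ≤ μ i ^ 2 := by
    intro i
    have h := hboch fun v => b i v / s v
    rw [hbq] at h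
    refine h.trans (le_of_eq ?_)
    calc ∑ v, c v * (∑ w, Q v w * (b i w / s w)) ^ 2 / q v
        = ∑ v, μ i ^ 2 * b i v ^ 2 := by
          refine sum_congr rfl fun v _ => ?_
          rw [hrow, hq2]
          have := (hs0 v).ne'; have := (hc v).ne'
          field_simp
      _ = μ i ^ 2 := by rw [← mul_sum, hbn, mul_one]
  -- deficiency identity
  have hdef : ∀ i, μ i - 1 = -(1/2) * ∑ v, ∑ w, Q v w * c v * c w *
      (b i v / (s v * c v) - b i w / (s w * c w)) ^ 2 := by
    intro i
    rw [← sum_quadratic_sub Q hQ c fun v => b i v / (s v * c v)]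
    congr 1
    · rw [← hbq]
      refine sum_congr rfl fun v _ => sum_congr rfl fun w _ => ?_
      have := (hs0 v).ne'; have := (hs0 w).ne'; have := (hc v).ne'; have := (hc w).ne'
      field_simp
    · rw [← hbn i]
      refine sum_congr rfl fun v _ => ?_
      change _ = c v * q v * _
      rw [hq2]
      have := (hs0 v).ne'; have := (hc v).ne'
      field_simp
  have hterm : ∀ i v w, 0 ≤ Q v w * c v * c w *
      (b i v / (s v * c v) - b i w / (s w * c w)) ^ 2 := by
    intro i v w
    by_cases hvw : v = w
    · subst hvw; simp
    · have := hoff v w hvw; have := hc v; have := hc w; positivity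
  have hμle : ∀ i, μ i ≤ 1 := by
    intro i
    have := hdef i
    have h2 : 0 ≤ ∑ v, ∑ w, Q v w * c v * c w *
      (b i v / (s v * c v) - b i w / (s w * c w)) ^ 2 :=
      sum_nonneg fun v _ => sum_nonneg fun w _ => hterm i v w
    linarith
  have hμ : ∀ i, 0 < μ i → ∀ v w, b i v / (s v * c v) = b i w / (s w * c w) := by
    intro i hi v w
    have h1 : μ i = 1 := le_antisymm (hμle i) (by
      have := hμ1 i
      nlinarith)
    have h2 := hdef i
    have h3 : ∑ v, ∑ w, Q v w * c v * c w *
      (b i v / (s v * c v) - b i w / (s w * c w)) ^ 2 = 0 := by linarith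
    have h4 : ∀ a b', 0 < Q a b' → b i a / (s a * c a) = b i b' / (s b' * c b') := by
      intro a b' hab
      have h5 := (sum_eq_zero_iff_of_nonneg
        (fun v _ => sum_nonneg fun w _ => hterm i v w)).1 h3 a (mem_univ _)
      have h6 := (sum_eq_zero_iff_of_nonneg (fun w _ => hterm i a w)).1 h5 b' (mem_univ _)
      have : 0 < Q a b' * c a * c b' := by have := hc a; have := hc b'; positivity
      have h7 := (mul_eq_zero.1 h6).resolve_left this.ne'
      exact sub_eq_zero.1 (pow_eq_zero_iff two_ne_zero |>.1 h7)
    induction hconn v w with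
    | refl => rfl
    | tail _ hab ih => exact ih.trans (h4 _ _ hab)
  -- expand in the eigenbasis
  let x : EuclideanSpace ℝ ι := WithLp.toLp 2 fun v => s v * ξ v
  have hx : ∀ v, x v = s v * ξ v := fun v => rfl
  have hfin : ∑ v, ∑ w, Q v w * ξ v * ξ w = inner ℝ x (T x) := by
    rw [hTq]
    refine sum_congr rfl fun v _ => sum_congr rfl fun w _ => ?_
    rw [hx, hx]
    have := (hs0 v).ne'; have := (hs0 w).ne'
    field_simp
  rw [hfin, ← b.sum_inner_mul_inner]
  refine sum_nonpos fun i _ => ?_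
  have h1 : inner ℝ (b i) (T x) = μ i * inner ℝ (b i) x := by
    rw [← hT (b i) x, hb, real_inner_smul_left]
  rw [h1, real_inner_comm (b i) x]
  rcases le_or_gt (μ i) 0 with h | h
  · nlinarith [mul_self_nonneg (inner ℝ (b i) x : ℝ)]
  · have h2 : inner ℝ (b i) x = (0:ℝ) := by
      rw [hinner]
      rcases isEmpty_or_nonempty ι with he | ⟨⟨v0⟩⟩
      · simp
      · set k := b i v0 / (s v0 * c v0)
        have hk : ∀ v, b i v = k * (s v * c v) := by
          intro v
          have := hμ i h v v0
          rw [div_eq_iff (by have := hs0 v; have := hc v; positivity)] at this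
          exact this
        calc ∑ v, b i v * x v = k * ∑ v, ξ v * q v := by
              rw [mul_sum]
              refine sum_congr rfl fun v _ => ?_
              rw [hk, hx, hq2]; ring
          _ = 0 := by rw [hξ, mul_zero]
    rw [h2]; simp

/-- Hodge–Riemann type inequality -/
def HodgeRiemann {A : Type*} [CommRing A] [Algebra ℝ A] (lam : A →ₗ[ℝ] ℝ) (W : Submodule ℝ A)
    (g : A) : Prop :=
  ∀ x ∈ W, ∀ y ∈ W, 0 < lam (g * (y * y)) →
    lam (g * (x * x)) * lam (g * (y * y)) ≤ lam (g * (x * y)) ^ 2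

/-- Local data -/
structure LocalExpansion {A : Type*} [CommRing A] [Algebra ℝ A] (lam : A →ₗ[ℝ] ℝ)
    (W : Submodule ℝ A) (Amp : Set A) (St : ℕ → A → Prop) (d : ℕ) (s : A) {ι : Type*} [Fintype ι]
    (e : ι → A) : Prop where
  mem : ∀ v, e v ∈ W
  state : ∀ v, St d (s * e v)
  ample : ∀ l ∈ Amp, ∃ c : ι → ℝ, (∀ v, 0 < c v) ∧
    ∀ g, lam (s * (l * g)) = ∑ v, c v * lam (s * (e v * g))
  span : ∀ u ∈ W, ∃ c : ι → ℝ, ∀ g, lam (s * (u * g)) = ∑ v, c v * lam (s * (e v * g))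
  link : ∀ d', d = d' + 1 → ∀ v w, v ≠ w →
    (∀ g, lam (s * (e v * (e w * g))) = 0) ∨ St d' (s * (e v * e w))
  conn : ∀ d', d = d' + 2 → ∀ v w,
    Relation.ReflTransGen (fun a b => St (d' + 1) (s * (e a * e b))) v w

/-- A system of states -/
structure LorentzSystem.{u, v} {A : Type u} [CommRing A] [Algebra ℝ A] (lam : A →ₗ[ℝ] ℝ)
    (W : Submodule ℝ A) (Amp : Set A) (St : ℕ → A → Prop) : Prop where
  amp_mem : Amp ⊆ W
  pos : ∀ s, St 0 s → 0 < lam s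
  step : ∀ d s, St (d + 1) s → ∃ (ι : Type v) (_ : Fintype ι) (_ : Nonempty ι) (e : ι → A),
    LocalExpansion lam W Amp St d s e
  base : ∀ s, St 2 s → HodgeRiemann lam W s

theorem LorentzSystem.prod_pos {A : Type*} [CommRing A] [Algebra ℝ A] {lam : A →ₗ[ℝ] ℝ}
    {W : Submodule ℝ A} {Amp : Set A} {St : ℕ → A → Prop} (H : LorentzSystem lam W Amp St)
    (ls : List A) (hls : ∀ l ∈ ls, l ∈ Amp) (s : A) (hs : St ls.length s) :
    0 < lam (s * ls.prod) := by
  induction ls generalizing s with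
  | nil => simpa using H.pos s hs
  | cons l ls ih =>
    obtain ⟨ι, _, _, e, h⟩ := H.step _ s hs
    obtain ⟨c, hc, hl⟩ := h.ample l (hls l (by simp))
    rw [List.prod_cons, hl]
    refine Finset.sum_pos (fun v _ => mul_pos (hc v) ?_) Finset.univ_nonempty
    rw [← mul_assoc]
    exact ih (fun l' h' => hls l' (by simp [h'])) _ (h.state v)

theorem hodgeRiemann_of_nonpos_orthogonal {A : Type*} [CommRing A] [Algebra ℝ A]
    {lam : A →ₗ[ℝ] ℝ} {W : Submodule ℝ A} {g l : A}
    (h : ∀ u ∈ W, lam (g * (l * u)) = 0 → lam (g * (u * u)) ≤ 0) : HodgeRiemann lam W g := by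
  intro x hx y hy hyy
  set a := lam (g * (l * x)) with ha
  set b := lam (g * (l * y)) with hb
  have hb0 : b ≠ 0 := fun h0 => absurd (h y hy h0) (not_le.2 hyy)
  have h1 := h (b • x - a • y) (W.sub_mem (W.smul_mem _ hx) (W.smul_mem _ hy)) (by
    have : g * (l * (b • x - a • y)) = b • (g * (l * x)) - a • (g * (l * y)) := by
      simp only [Algebra.smul_def]; ring
    rw [this, map_sub, map_smul, map_smul, ← ha, ← hb, smul_eq_mul, smul_eq_mul]; ring)
  have h2 : g * ((b • x - a • y) * (b • x - a • y)) = (b ^ 2) • (g * (x * x))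
      - (2 * a * b) • (g * (x * y)) + (a ^ 2) • (g * (y * y)) := by
    simp only [Algebra.smul_def, map_mul, map_pow, map_ofNat]; ring
  rw [h2, map_add, map_sub, map_smul, map_smul, map_smul, smul_eq_mul, smul_eq_mul,
    smul_eq_mul] at h1
  have h3 : 0 < b ^ 2 := by positivity
  refine le_of_mul_le_mul_left ?_ h3
  nlinarith [sq_nonneg (b * lam (g * (x * y)) - a * lam (g * (y * y))),
    mul_le_mul_of_nonneg_right h1 hyy.le]

theorem LorentzSystem.hodgeRiemann {A : Type*} [CommRing A] [Algebra ℝ A] {lam : A →ₗ[ℝ] ℝ}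
    {W : Submodule ℝ A} {Amp : Set A} {St : ℕ → A → Prop} (H : LorentzSystem lam W Amp St)
    (ls : List A) (hls : ∀ l ∈ ls, l ∈ Amp) (s : A) (hs : St (ls.length + 2) s) :
    HodgeRiemann lam W (s * ls.prod) := by
  induction ls generalizing s with
  | nil => simpa using H.base s hs
  | cons l ls ih =>
    have hls' : ∀ l' ∈ ls, l' ∈ Amp := fun l' h' => hls l' (by simp [h'])
    have hlA : l ∈ Amp := hls l (by simp)
    have hlW := H.amp_mem hlA
    obtain ⟨ι, _, _, e, h⟩ := H.step _ s hs
    obtain ⟨c, hc, hl⟩ := h.ample l hlA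
    set P := ls.prod with hP
    let Q : ι → ι → ℝ := fun v w => lam (s * (e v * (e w * (l * P))))
    have hQs : ∀ v w, Q v w = Q w v := fun v w => by
      simp only [Q]; congr 1; ring
    have hlen : (l :: ls).length = ls.length + 1 := rfl
    have hQpos : ∀ v w, St (ls.length + 1) (s * (e v * e w)) → 0 < Q v w := by
      intro v w hvw
      have := H.prod_pos (l :: ls) hls _ hvw
      rw [List.prod_cons] at this
      convert this using 2
      ring
    -- expansions against rows
    have hrowc : ∀ v, ∑ w, Q v w * c w = lam (s * e v * P * (l * l)) := by
      intro v
      have := hl (e v * (l * P))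
      rw [show s * e v * P * (l * l) = s * (l * (e v * (l * P))) by ring, this]
      refine Finset.sum_congr rfl fun w _ => ?_
      rw [hQs v w, mul_comm]
    have hrow : ∀ (ξ : ι → ℝ) v, ∑ w, Q v w * ξ w
        = lam (s * e v * P * ((∑ w, ξ w • e w) * l)) := by
      intro ξ v
      rw [Finset.sum_mul, Finset.mul_sum, map_sum]
      refine Finset.sum_congr rfl fun w _ => ?_
      rw [smul_mul_assoc, mul_smul_comm, map_smul, smul_eq_mul, mul_comm]
      simp only [Q]; congr 2; ring
    have hquad : ∀ ξ : ι → ℝ, ∑ v, ∑ w, Q v w * ξ v * ξ w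
        = lam (s * (l * (P * ((∑ w, ξ w • e w) * (∑ w, ξ w • e w))))) := by
      intro ξ
      rw [Finset.sum_mul_sum, Finset.mul_sum, Finset.mul_sum, Finset.mul_sum, map_sum]
      refine Finset.sum_congr rfl fun v _ => ?_
      rw [Finset.mul_sum, Finset.mul_sum, Finset.mul_sum, map_sum]
      refine Finset.sum_congr rfl fun w _ => ?_
      have : s * (l * (P * (ξ v • e v * ξ w • e w)))
          = (ξ v * ξ w) • (s * (e v * (e w * (l * P)))) := by
        simp only [Algebra.smul_def, map_mul]; ring
      rw [this, map_smul, smul_eq_mul]; ring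
    have hmem : ∀ ξ : ι → ℝ, ∑ w, ξ w • e w ∈ W := fun ξ =>
      W.sum_mem fun w _ => W.smul_mem _ (h.mem w)
    have hrowpos : ∀ v, 0 < ∑ w, Q v w * c w := by
      intro v
      rw [hrowc]
      have := H.prod_pos (l :: l :: ls) (by simpa [hlA] using hls') _ (h.state v)
      rw [List.prod_cons, List.prod_cons] at this
      convert this using 2
      ring
    have key := quadratic_nonpos_of_bochner Q hQs c hc ?_ hrowpos ?_ ?_
    · refine hodgeRiemann_of_nonpos_orthogonal (l := l) fun u hu hlu => ?_
      obtain ⟨ξ, hξ⟩ := h.span u hu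
      have h1 := key ξ ?_
      · refine le_of_eq_of_le ?_ h1
        rw [List.prod_cons, ← hP]
        rw [show s * (l * P) * (u * u) = s * (u * (u * (l * P))) by ring, hξ]
        refine Finset.sum_congr rfl fun v _ => ?_
        rw [show s * (e v * (u * (l * P))) = s * (u * (e v * (l * P))) by ring, hξ, Finset.mul_sum]
        refine Finset.sum_congr rfl fun w _ => ?_
        rw [hQs v w]; simp only [Q]; ring
      · rw [← hlu, List.prod_cons, ← hP,
          show s * (l * P) * (l * u) = s * (u * (l * (l * P))) by ring, hξ]
        refine Finset.sum_congr rfl fun v _ => ?_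
        rw [hrowc]; congr 2; ring
    · intro v w hvw
      rcases h.link (ls.length + 1) (by simp) v w hvw with h0 | h1
      · exact (h0 _).ge
      · exact (hQpos v w h1).le
    · intro v w
      exact Relation.ReflTransGen.mono hQpos _ _ (h.conn ls.length (by simp) v w)
    · intro ξ
      rw [hquad, hl]
      refine Finset.sum_le_sum fun v _ => ?_
      have hHR := ih hls' (s * e v) (h.state v) _ (hmem ξ) l hlW
        (by have := hrowpos v; rw [hrowc] at this; exact this)
      rw [mul_div_assoc]
      refine mul_le_mul_of_nonneg_left ?_ (hc v).le
      rw [le_div_iff₀ (hrowpos v), hrowc, hrow]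
      rw [show s * (e v * (P * ((∑ w, ξ w • e w) * ∑ w, ξ w • e w)))
        = s * e v * P * ((∑ w, ξ w • e w) * ∑ w, ξ w • e w) by ring]
      exact hHR

/-- A loopless rank function on the finite subsets of `α`. -/
structure RankFn (α : Type*) [DecidableEq α] where
  /-- the rank function -/
  r : Finset α → ℕ
  empty : r ∅ = 0
  mono : ∀ {A B : Finset α}, A ⊆ B → r A ≤ r B
  single : ∀ i, r {i} = 1
  submod : ∀ A B, r (A ∪ B) + r (A ∩ B) ≤ r A + r B

namespace RankFn

variable {α : Type*} [DecidableEq α] (M : RankFn α)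

theorem insert_le (i : α) (A : Finset α) : M.r (insert i A) ≤ M.r A + 1 := by
  have := M.submod {i} A
  rw [M.single, ← Finset.insert_eq] at this
  lia

theorem le_card (A : Finset α) : M.r A ≤ A.card := by
  induction A using Finset.induction_on with
  | empty => simp [M.empty]
  | insert i A hi ih =>
    rw [Finset.card_insert_of_notMem hi]
    exact (M.insert_le i A).trans (by lia)

theorem insert_eq_of_subset {i : α} {A B : Finset α} (hAB : A ⊆ B)
    (h : M.r (insert i A) = M.r A) : M.r (insert i B) = M.r B := by
  refine le_antisymm ?_ (M.mono (Finset.subset_insert _ _))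
  have h1 := M.submod (insert i A) B
  have h2 : insert i A ∪ B = insert i B := by
    rw [Finset.insert_union, Finset.union_eq_right.2 hAB]
  have h3 : M.r A ≤ M.r (insert i A ∩ B) :=
    M.mono (Finset.subset_inter (Finset.subset_insert _ _) hAB)
  rw [h2] at h1
  lia

/-- A flat is a set whose rank increases when any element is added. -/
def IsFlat (F : Finset α) : Prop := ∀ i ∉ F, M.r F < M.r (insert i F)

theorem isFlat_empty : M.IsFlat ∅ := fun i _ => by
  rw [insert_empty_eq, M.single, M.empty]; exact one_pos

variable {M}

theorem IsFlat.rank_insert {F : Finset α} (hF : M.IsFlat F) {i : α} (hi : i ∉ F) :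
    M.r (insert i F) = M.r F + 1 :=
  le_antisymm (M.insert_le i F) (hF i hi)

theorem IsFlat.subset_of_rank_le {F G : Finset α} (hF : M.IsFlat F) (hFG : F ⊆ G)
    (h : M.r G ≤ M.r F) : G ⊆ F := by
  intro i hi
  by_contra hiF
  have := hF i hiF
  have := M.mono (Finset.insert_subset hi hFG)
  lia

theorem IsFlat.rank_lt {F G : Finset α} (hF : M.IsFlat F) (hFG : F ⊂ G) : M.r F < M.r G := by
  by_contra h
  exact hFG.2 (hF.subset_of_rank_le hFG.1 (not_lt.1 h))

theorem IsFlat.eq_of_rank_le {F G : Finset α} (hF : M.IsFlat F) (hFG : F ⊆ G)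
    (h : M.r G ≤ M.r F) : F = G :=
  hFG.antisymm (hF.subset_of_rank_le hFG h)

variable [Fintype α]

theorem isFlat_univ : M.IsFlat Finset.univ := fun i hi => absurd (Finset.mem_univ i) hi

variable (M) in
/-- The closure of a set. -/
def cl (A : Finset α) : Finset α := Finset.univ.filter fun i => M.r (insert i A) = M.r A

theorem mem_cl {A : Finset α} {i : α} : i ∈ M.cl A ↔ M.r (insert i A) = M.r A := by
  simp [cl]

theorem subset_cl (A : Finset α) : A ⊆ M.cl A := fun i hi => by
  rw [mem_cl, Finset.insert_eq_of_mem hi]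

theorem rank_union_cl (A T : Finset α) (hT : T ⊆ M.cl A) : M.r (A ∪ T) = M.r A := by
  induction T using Finset.induction_on with
  | empty => simp
  | insert i T hi ih =>
    rw [Finset.insert_subset_iff] at hT
    rw [Finset.union_insert, M.insert_eq_of_subset Finset.subset_union_left (mem_cl.1 hT.1),
      ih hT.2]

theorem rank_cl (A : Finset α) : M.r (M.cl A) = M.r A := by
  have := rank_union_cl A (M.cl A) subset_rfl
  rwa [Finset.union_eq_right.2 (subset_cl A)] at this

theorem isFlat_cl (A : Finset α) : M.IsFlat (M.cl A) := by
  intro i hi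
  rw [rank_cl]
  by_contra h
  refine hi (mem_cl.2 (le_antisymm ?_ (M.mono (Finset.subset_insert _ _))))
  exact (M.mono (Finset.insert_subset_insert i (subset_cl A))).trans (not_lt.1 h)

theorem IsFlat.cl_subset {A F : Finset α} (hF : M.IsFlat F) (h : A ⊆ F) : M.cl A ⊆ F := by
  intro i hi
  by_contra hiF
  exact (hF i hiF).ne' (M.insert_eq_of_subset h (mem_cl.1 hi))

theorem IsFlat.cl_eq {F : Finset α} (hF : M.IsFlat F) : M.cl F = F :=
  (hF.cl_subset subset_rfl).antisymm (subset_cl F)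

theorem rank_cl_insert {F : Finset α} (hF : M.IsFlat F) {i : α} (hi : i ∉ F) :
    M.r (M.cl (insert i F)) = M.r F + 1 := by
  rw [rank_cl, hF.rank_insert hi]

theorem ssubset_cl_insert {F : Finset α} {i : α} (hi : i ∉ F) : F ⊂ M.cl (insert i F) :=
  (Finset.ssubset_insert hi).trans_subset (subset_cl _)

theorem mem_cl_insert (F : Finset α) (i : α) : i ∈ M.cl (insert i F) :=
  subset_cl _ (Finset.mem_insert_self i F)

/-- The flats covering `F` partition the complement of `F`. -/
theorem IsFlat.eq_cl_insert {F G : Finset α} (hF : M.IsFlat F) (hG : M.IsFlat G) (hFG : F ⊆ G)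
    (hr : M.r G = M.r F + 1) {i : α} (hiF : i ∉ F) (hiG : i ∈ G) : G = M.cl (insert i F) := by
  refine ((isFlat_cl _).eq_of_rank_le (hG.cl_subset (Finset.insert_subset hiG hFG)) ?_).symm
  rw [rank_cl_insert hF hiF, hr]

end RankFn

/-- A function on finite sets of the form `F ↦ c + ∑ i ∈ F, w i`. -/
def IsAff {α : Type*} (a : Finset α → ℝ) : Prop :=
  ∃ (c : ℝ) (w : α → ℝ), ∀ F, a F = c + ∑ i ∈ F, w i

namespace IsAff

variable {α : Type*}

theorem const (c : ℝ) : IsAff (fun _ : Finset α => c) := ⟨c, fun _ => 0, fun F => by simp⟩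

theorem sub {a b : Finset α → ℝ} (ha : IsAff a) (hb : IsAff b) : IsAff (fun F => a F - b F) := by
  obtain ⟨c, w, h⟩ := ha
  obtain ⟨c', w', h'⟩ := hb
  exact ⟨c - c', fun i => w i - w' i, fun F => by dsimp only; rw [h, h', Finset.sum_sub_distrib]; ring⟩

theorem add {a b : Finset α → ℝ} (ha : IsAff a) (hb : IsAff b) : IsAff (fun F => a F + b F) := by
  obtain ⟨c, w, h⟩ := ha
  obtain ⟨c', w', h'⟩ := hb
  exact ⟨c + c', fun i => w i + w' i, fun F => by dsimp only; rw [h, h', Finset.sum_add_distrib]; ring⟩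

theorem mul_const {a : Finset α → ℝ} (ha : IsAff a) (k : ℝ) : IsAff (fun F => k * a F) := by
  obtain ⟨c, w, h⟩ := ha
  exact ⟨k * c, fun i => k * w i, fun F => by dsimp only; rw [h, mul_add, Finset.mul_sum]⟩

theorem sum {ι : Type*} (s : Finset ι) {a : ι → Finset α → ℝ} (h : ∀ i ∈ s, IsAff (a i)) :
    IsAff (fun F => ∑ i ∈ s, a i F) := by
  classical
  induction s using Finset.induction_on with
  | empty => simpa using const 0
  | insert i s hi ih =>
    simp only [Finset.sum_insert hi]
    exact (h i (by simp)).add (ih fun j hj => h j (by simp [hj]))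

theorem mem [DecidableEq α] (j : α) : IsAff (fun F : Finset α => if j ∈ F then (1 : ℝ) else 0) :=
  ⟨0, fun i => if j = i then 1 else 0, fun F => by simp⟩

end IsAff

/-- Dual affine functions on a chain. -/
theorem exists_affDual {α : Type*} [DecidableEq α] (K : Finset (Finset α))
    (hK : ∀ F ∈ K, ∀ G ∈ K, F ⊆ G ∨ G ⊆ F) (B : Finset α) :
    ∃ a : Finset α → ℝ, IsAff a ∧ (B ∈ K → ∀ C ∈ K, a C = if C = B then 1 else 0) := by
  by_cases hB : B ∈ K
  swap
  · exact ⟨fun _ => 0, .const 0, fun h => absurd h hB⟩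
  have h1 : ∃ u : Finset α → ℝ, IsAff u ∧ ∀ C ∈ K, u C = if B ⊆ C then 1 else 0 := by
    by_cases hne : (K.filter (· ⊂ B)).Nonempty
    · obtain ⟨P, hP, hmax⟩ := Finset.exists_max_image _ Finset.card hne
      rw [Finset.mem_filter] at hP
      obtain ⟨p, hpB, hpP⟩ := Finset.exists_of_ssubset hP.2
      refine ⟨_, IsAff.mem p, fun C hC => ?_⟩
      by_cases hBC : B ⊆ C
      · rw [if_pos hBC, if_pos (hBC hpB)]
      · rw [if_neg hBC, if_neg]
        intro hpC
        have hCB : C ⊂ B := ⟨(hK _ hB _ hC).resolve_left hBC, hBC⟩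
        have hle := hmax C (Finset.mem_filter.2 ⟨hC, hCB⟩)
        rcases hK _ hP.1 _ hC with h | h
        · exact hpP (Finset.eq_of_subset_of_card_le h hle ▸ hpC)
        · exact hpP (h hpC)
    · refine ⟨_, IsAff.const 1, fun C hC => ?_⟩
      rw [if_pos]
      rcases hK _ hB _ hC with h | h
      · exact h
      · by_contra hBC
        exact hne ⟨C, Finset.mem_filter.2 ⟨hC, h, hBC⟩⟩
  have h2 : ∃ u : Finset α → ℝ, IsAff u ∧ ∀ C ∈ K, u C = if C ⊆ B then 0 else 1 := by
    by_cases hne : (K.filter (B ⊂ ·)).Nonempty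
    · obtain ⟨P, hP, hmin⟩ := Finset.exists_min_image _ Finset.card hne
      rw [Finset.mem_filter] at hP
      obtain ⟨p, hpP, hpB⟩ := Finset.exists_of_ssubset hP.2
      refine ⟨_, IsAff.mem p, fun C hC => ?_⟩
      by_cases hCB : C ⊆ B
      · rw [if_pos hCB, if_neg fun h => hpB (hCB h)]
      · rw [if_neg hCB, if_pos]
        have hBC : B ⊂ C := ⟨(hK _ hB _ hC).resolve_right hCB, hCB⟩
        have hle := hmin C (Finset.mem_filter.2 ⟨hC, hBC⟩)
        rcases hK _ hP.1 _ hC with h | h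
        · exact h hpP
        · exact (Finset.eq_of_subset_of_card_le h hle).symm ▸ hpP
    · refine ⟨_, IsAff.const 0, fun C hC => ?_⟩
      rw [if_pos]
      rcases hK _ hB _ hC with h | h
      · by_contra hBC
        exact hne ⟨C, Finset.mem_filter.2 ⟨hC, h, hBC⟩⟩
      · exact h
  obtain ⟨u, hu, hu'⟩ := h1
  obtain ⟨v, hv, hv'⟩ := h2
  refine ⟨_, hu.sub hv, fun _ C hC => ?_⟩
  rw [hu' C hC, hv' C hC]
  rcases hK _ hB _ hC with h | h
  · by_cases hCB : C ⊆ B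
    · simp [h.antisymm hCB]
    · have : C ≠ B := fun h => hCB h.le
      simp [h, hCB, this]
  · by_cases hBC : B ⊆ C
    · simp [h.antisymm hBC]
    · have : C ≠ B := fun h => hBC h.ge
      simp [h, hBC, this]

namespace RankFn

variable {α : Type*} [DecidableEq α] [Fintype α] (M : RankFn α)

/-- Chains of flats containing the least and the greatest flat. -/
structure Flag (K : Finset (Finset α)) : Prop where
  bot : ∅ ∈ K
  top : Finset.univ ∈ K
  flat : ∀ F ∈ K, M.IsFlat F
  chain : ∀ F ∈ K, ∀ G ∈ K, F ⊆ G ∨ G ⊆ F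

variable {M} in
theorem Flag.of_insert {K : Finset (Finset α)} {G : Finset α} (h0 : ∅ ∈ K)
    (h1 : Finset.univ ∈ K) (h : M.Flag (insert G K)) : M.Flag K :=
  ⟨h0, h1, fun F hF => h.flat F (Finset.mem_insert_of_mem hF), fun F hF G' hG =>
    h.chain F (Finset.mem_insert_of_mem hF) G' (Finset.mem_insert_of_mem hG)⟩

theorem flag_bot_top : M.Flag {∅, Finset.univ} := by
  refine ⟨by simp, by simp, fun F hF => ?_, fun F hF G hG => ?_⟩
  · simp only [Finset.mem_insert, Finset.mem_singleton] at hF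
    rcases hF with rfl | rfl
    · exact M.isFlat_empty
    · exact isFlat_univ
  · simp only [Finset.mem_insert, Finset.mem_singleton] at hF hG
    rcases hF with rfl | rfl
    · simp
    · simp

variable {M} in
theorem Flag.insert_flat {K : Finset (Finset α)} (hK : M.Flag K) {G : Finset α} (hG : M.IsFlat G)
    (h : ∀ F ∈ K, F ⊆ G ∨ G ⊆ F) : M.Flag (insert G K) := by
  refine ⟨Finset.mem_insert_of_mem hK.bot, Finset.mem_insert_of_mem hK.top, ?_, ?_⟩
  · intro F hF
    rcases Finset.mem_insert.1 hF with rfl | hF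
    · exact hG
    · exact hK.flat F hF
  · intro F hF F' hF'
    rcases Finset.mem_insert.1 hF with hF1 | hF1 <;>
      rcases Finset.mem_insert.1 hF' with hF2 | hF2
    · exact Or.inl (hF1.trans hF2.symm).le
    · exact hF1 ▸ (h F' hF2).symm
    · exact hF2 ▸ h F hF1
    · exact hK.chain F hF1 F' hF2

open Classical in
/-- The dual affine functions of a chain. -/
noncomputable def affDual (K : Finset (Finset α)) (B : Finset α) : Finset α → ℝ :=
  if h : M.Flag K then (exists_affDual K h.chain B).choose else fun _ => 0

theorem isAff_affDual (K : Finset (Finset α)) (B : Finset α) : IsAff (M.affDual K B) := by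
  unfold affDual
  split_ifs with h
  · exact (exists_affDual K h.chain B).choose_spec.1
  · exact .const 0

variable {M} in
theorem Flag.affDual_apply {K : Finset (Finset α)} (h : M.Flag K) {B C : Finset α} (hB : B ∈ K)
    (hC : C ∈ K) : M.affDual K B C = if C = B then 1 else 0 := by
  unfold affDual
  rw [dif_pos h]
  exact (exists_affDual K h.chain B).choose_spec.2 hB C hC

/-- Normalisation of a function so that it vanishes on a chain. -/
noncomputable def normal (K : Finset (Finset α)) (a : Finset α → ℝ) (G : Finset α) : ℝ :=
  a G - ∑ B ∈ K, a B * M.affDual K B G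

variable {M} in
theorem Flag.normal_eq_zero {K : Finset (Finset α)} (h : M.Flag K) (a : Finset α → ℝ)
    {G : Finset α} (hG : G ∈ K) : M.normal K a G = 0 := by
  unfold normal
  rw [Finset.sum_congr rfl fun B hB => by rw [h.affDual_apply hB hG], sub_eq_zero]
  simp [hG]

theorem isAff_sub_normal (K : Finset (Finset α)) (a : Finset α → ℝ) :
    IsAff (fun G => a G - M.normal K a G) := by
  simp only [normal, sub_sub_cancel]
  exact IsAff.sum _ fun B _ => (M.isAff_affDual K B).mul_const _

open Classical in
/-- Iterated degree. -/
noncomputable def chainDeg : List (Finset α → ℝ) → Finset (Finset α) → ℝ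
  | [], K => if M.Flag K ∧ K.card = M.r Finset.univ + 1 then 1 else 0
  | a :: L, K => ∑ G, M.normal K a G * chainDeg L (insert G K)

theorem chainDeg_eq_zero (L : List (Finset α → ℝ)) {K : Finset (Finset α)} (h0 : ∅ ∈ K)
    (h1 : Finset.univ ∈ K) (h : ¬ M.Flag K) : M.chainDeg L K = 0 := by
  induction L generalizing K with
  | nil => simp [chainDeg, h]
  | cons a L ih =>
    refine Finset.sum_eq_zero fun G _ => ?_
    rw [ih (by simp [h0]) (by simp [h1]) fun hf => h (hf.of_insert h0 h1), mul_zero]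

theorem chainDeg_sub (a b : Finset α → ℝ) (L : List (Finset α → ℝ)) (K : Finset (Finset α)) :
    M.chainDeg ((fun F => a F - b F) :: L) K = M.chainDeg (a :: L) K - M.chainDeg (b :: L) K := by
  simp only [chainDeg]
  rw [← Finset.sum_sub_distrib]
  refine Finset.sum_congr rfl fun G _ => ?_
  rw [← sub_mul]
  congr 1
  simp only [normal, sub_mul, Finset.sum_sub_distrib]
  ring

theorem chainDeg_sum {ι : Type*} (s : Finset ι) (k : ι → ℝ) (a : ι → Finset α → ℝ)
    (L : List (Finset α → ℝ)) (K : Finset (Finset α)) :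
    M.chainDeg ((fun F => ∑ i ∈ s, k i * a i F) :: L) K
      = ∑ i ∈ s, k i * M.chainDeg (a i :: L) K := by
  simp only [chainDeg, normal, Finset.mul_sum]
  rw [Finset.sum_comm]
  refine Finset.sum_congr rfl fun G _ => ?_
  simp only [Finset.sum_mul, ← mul_assoc]
  rw [← Finset.sum_mul]
  congr 1
  rw [Finset.sum_comm, ← Finset.sum_sub_distrib]
  refine Finset.sum_congr rfl fun i _ => ?_
  rw [mul_sub, Finset.mul_sum]
  simp only [mul_assoc]

variable {M}

theorem Flag.rank_injOn {K : Finset (Finset α)} (hK : M.Flag K) :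
    Set.InjOn M.r (K : Set (Finset α)) := by
  intro F hF G hG h
  rcases hK.chain F hF G hG with h1 | h1
  · exact (hK.flat F hF).eq_of_rank_le h1 h.ge
  · exact ((hK.flat G hG).eq_of_rank_le h1 h.le).symm

theorem Flag.image_rank_subset {K : Finset (Finset α)} :
    K.image M.r ⊆ Finset.range (M.r Finset.univ + 1) := by
  intro p hp
  obtain ⟨F, _, rfl⟩ := Finset.mem_image.1 hp
  exact Finset.mem_range.2 (Nat.lt_succ_of_le (M.mono (Finset.subset_univ F)))

theorem Flag.card_image {K : Finset (Finset α)} (hK : M.Flag K) :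
    (K.image M.r).card = K.card := Finset.card_image_of_injOn hK.rank_injOn

theorem Flag.card_le {K : Finset (Finset α)} (hK : M.Flag K) :
    K.card ≤ M.r Finset.univ + 1 := by
  rw [← hK.card_image]
  simpa using Finset.card_le_card (Flag.image_rank_subset (M := M) (K := K))

theorem Flag.subset_of_rank_le {K : Finset (Finset α)} (hK : M.Flag K) {F G : Finset α}
    (hF : F ∈ K) (hG : G ∈ K) (h : M.r F ≤ M.r G) : F ⊆ G := by
  rcases hK.chain F hF G hG with h1 | h1
  · exact h1
  · exact ((hK.flat G hG).eq_of_rank_le h1 h).ge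

theorem Flag.exists_rank {K : Finset (Finset α)} (hK : M.Flag K)
    (hc : K.card = M.r Finset.univ + 1) {p : ℕ} (hp : p ≤ M.r Finset.univ) :
    ∃ F ∈ K, M.r F = p := by
  have h : K.image M.r = Finset.range (M.r Finset.univ + 1) :=
    Finset.eq_of_subset_of_card_le Flag.image_rank_subset (by rw [hK.card_image, hc]; simp)
  have : p ∈ K.image M.r := by rw [h]; simpa using Nat.lt_succ_of_le hp
  simpa using this

end RankFn

namespace RankFn

variable {α : Type*} [DecidableEq α] [Fintype α] {M : RankFn α}

/-- Sums of an affine function over the flats in a rank two interval. -/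
theorem sum_aff_interval {A B : Finset α} (hA : M.IsFlat A) (hB : M.IsFlat B)
    (hAB : A ⊆ B) (s : Finset (Finset α))
    (hs : ∀ G, G ∈ s ↔ M.IsFlat G ∧ A ⊆ G ∧ G ⊆ B ∧ M.r G = M.r A + 1) {a : Finset α → ℝ}
    (ha : IsAff a) (haA : a A = 0) : ∑ G ∈ s, a G = a B := by
  obtain ⟨c, w, h⟩ := ha
  have h1 : ∀ G, A ⊆ G → a G = ∑ i ∈ G \ A, w i := by
    intro G hG
    rw [h] at haA ⊢
    rw [← Finset.sum_sdiff hG]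
    linarith
  rw [h1 B hAB, Finset.sum_congr rfl fun G hG => h1 G ((hs G).1 hG).2.1, ← Finset.sum_biUnion]
  · refine Finset.sum_congr ?_ fun _ _ => rfl
    ext i
    simp only [Finset.mem_biUnion, Finset.mem_sdiff]
    constructor
    · rintro ⟨G, hG, hi, hiA⟩
      exact ⟨((hs G).1 hG).2.2.1 hi, hiA⟩
    · rintro ⟨hiB, hiA⟩
      exact ⟨M.cl (insert i A), (hs _).2 ⟨isFlat_cl _, (ssubset_cl_insert hiA).1,
        hB.cl_subset (Finset.insert_subset hiB hAB), rank_cl_insert hA hiA⟩,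
        mem_cl_insert A i, hiA⟩
  · intro G hG G' hG' hne
    rw [Function.onFun, Finset.disjoint_left]
    intro i hi hi'
    rw [Finset.mem_sdiff] at hi hi'
    have h2 := (hs G).1 hG
    have h3 := (hs G').1 hG'
    exact hne ((hA.eq_cl_insert h2.1 h2.2.1 h2.2.2.2 hi.2 hi.1).trans
      (hA.eq_cl_insert h3.1 h3.2.1 h3.2.2.2 hi'.2 hi'.1).symm)

theorem balancing {K : Finset (Finset α)} (hK : M.Flag K) {a : Finset α → ℝ} (ha : IsAff a)
    (haK : ∀ F ∈ K, a F = 0) : ∑ G, a G * M.chainDeg [] (insert G K) = 0 := by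
  classical
  by_cases hcard : K.card = M.r Finset.univ
  swap
  · refine Finset.sum_eq_zero fun G _ => ?_
    by_cases hG : G ∈ K
    · rw [haK G hG, zero_mul]
    · rw [chainDeg, if_neg, mul_zero]
      rw [Finset.card_insert_of_notMem hG]
      rintro ⟨_, h⟩
      lia
  set R := M.r Finset.univ with hR
  have hsub := Flag.image_rank_subset (M := M) (K := K)
  have hc1 : (Finset.range (R + 1) \ K.image M.r).card = 1 := by
    rw [Finset.card_sdiff_of_subset hsub, hK.card_image, hcard, Finset.card_range]; lia
  obtain ⟨p, hp⟩ := Finset.card_eq_one.1 hc1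
  have hmem : ∀ q ≤ R, q ≠ p → ∃ F ∈ K, M.r F = q := by
    intro q hq hqp
    have : q ∉ Finset.range (R + 1) \ K.image M.r := by rw [hp]; simpa using hqp
    simp only [Finset.mem_sdiff, Finset.mem_range, not_and, not_not, Finset.mem_image] at this
    exact this (by lia)
  have hpmem : p ∈ Finset.range (R + 1) \ K.image M.r := by rw [hp]; simp
  simp only [Finset.mem_sdiff, Finset.mem_range, Finset.mem_image, not_exists, not_and] at hpmem
  obtain ⟨hpR, hpK⟩ := hpmem
  have hp0 : p ≠ 0 := fun h => hpK ∅ hK.bot (by rw [M.empty, h])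
  have hpR' : p ≠ R := fun h => hpK _ hK.top (by rw [h])
  obtain ⟨q, rfl⟩ := Nat.exists_eq_succ_of_ne_zero hp0
  obtain ⟨A, hA, hAr⟩ := hmem q (by lia) (by lia)
  obtain ⟨B, hB, hBr⟩ := hmem (q + 2) (by lia) (by lia)
  have hAB : A ⊆ B := hK.subset_of_rank_le hA hB (by lia)
  have hiff : ∀ G, G ∉ K → (M.Flag (insert G K) ↔
      M.IsFlat G ∧ A ⊆ G ∧ G ⊆ B ∧ M.r G = M.r A + 1) := by
    intro G hG
    constructor
    · intro hf
      have hcard' : (insert G K).card = R + 1 := by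
        rw [Finset.card_insert_of_notMem hG, hcard]
      obtain ⟨F, hF, hFr⟩ := hf.exists_rank hcard' (p := q.succ) (by lia)
      have hFG : F = G := (Finset.mem_insert.1 hF).resolve_right fun h => hpK F h hFr
      subst hFG
      exact ⟨hf.flat F hF, hf.subset_of_rank_le (Finset.mem_insert_of_mem hA) hF (by lia),
        hf.subset_of_rank_le hF (Finset.mem_insert_of_mem hB) (by lia), by lia⟩
    · rintro ⟨hGf, hAG, hGB, hGr⟩
      refine hK.insert_flat hGf fun F hF => ?_
      rcases lt_trichotomy (M.r F) q.succ with h | h | h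
      · exact Or.inl ((hK.subset_of_rank_le hF hA (by lia)).trans hAG)
      · exact absurd h (hpK F hF)
      · exact Or.inr (hGB.trans (hK.subset_of_rank_le hB hF (by lia)))
  have hterm : ∀ G, a G * M.chainDeg [] (insert G K) =
      if M.IsFlat G ∧ A ⊆ G ∧ G ⊆ B ∧ M.r G = M.r A + 1 then a G else 0 := by
    intro G
    by_cases hG : G ∈ K
    · rw [haK G hG]; simp
    · rw [chainDeg, hiff G hG, Finset.card_insert_of_notMem hG, hcard]
      simp [← hR]
  rw [Finset.sum_congr rfl fun G _ => hterm G, ← Finset.sum_filter,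
    sum_aff_interval (hK.flat A hA) (hK.flat B hB) hAB _ (fun G => by simp) ha (haK A hA),
    haK B hB]

theorem isAff_normal {K : Finset (Finset α)} {a : Finset α → ℝ} (ha : IsAff a) :
    IsAff (M.normal K a) := by
  have := ha.sub (M.isAff_sub_normal K a)
  simpa only [sub_sub_cancel] using this

variable (M) in
/-- Affine functions have degree zero. -/
def AffZero (L : List (Finset α → ℝ)) : Prop :=
  ∀ a K, IsAff a → M.Flag K → M.chainDeg (a :: L) K = 0

theorem chainDeg_cons_cons {L : List (Finset α → ℝ)} (hL : M.AffZero L) (a b : Finset α → ℝ)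
    {K : Finset (Finset α)} (hK : M.Flag K) :
    M.chainDeg (a :: b :: L) K = ∑ G, ∑ H, M.normal K a G * (M.normal K b H -
      M.normal K b G * M.affDual (insert G K) G H) * M.chainDeg L (insert H (insert G K)) := by
  rw [chainDeg]
  refine Finset.sum_congr rfl fun G _ => ?_
  by_cases hG : G ∈ K
  · simp [hK.normal_eq_zero a hG]
  simp only [mul_assoc]
  rw [← Finset.mul_sum]
  congr 1
  by_cases hf : M.Flag (insert G K)
  swap
  · rw [chainDeg_eq_zero _ _ (Finset.mem_insert_of_mem hK.bot)
      (Finset.mem_insert_of_mem hK.top) hf, eq_comm]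
    refine Finset.sum_eq_zero fun H _ => ?_
    rw [chainDeg_eq_zero, mul_zero]
    · simp [hK.bot]
    · simp [hK.top]
    · exact fun h => hf (h.of_insert (by simp [hK.bot]) (by simp [hK.top]))
  have h1 : M.chainDeg (b :: L) (insert G K) = M.chainDeg (M.normal K b :: L) (insert G K) := by
    have := hL _ _ (M.isAff_sub_normal K b) hf
    rw [chainDeg_sub] at this
    linarith
  rw [h1, chainDeg]
  refine Finset.sum_congr rfl fun H _ => ?_
  congr 1
  rw [normal, Finset.sum_insert hG, Finset.sum_eq_zero fun B hB => by
    rw [hK.normal_eq_zero b hB, zero_mul], add_zero]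

theorem chainDeg_swap {L : List (Finset α → ℝ)} (hL : M.AffZero L) (a b : Finset α → ℝ)
    {K : Finset (Finset α)} (hK : M.Flag K) :
    M.chainDeg (a :: b :: L) K = M.chainDeg (b :: a :: L) K := by
  rw [chainDeg_cons_cons hL a b hK, chainDeg_cons_cons hL b a hK]
  have h : ∀ a b : Finset α → ℝ, ∑ G, ∑ H, M.normal K a G * (M.normal K b H -
      M.normal K b G * M.affDual (insert G K) G H) * M.chainDeg L (insert H (insert G K))
    = ∑ G, ∑ H, M.normal K a G * M.normal K b H * M.chainDeg L (insert H (insert G K))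
      - ∑ G, ∑ H, M.normal K a G * M.normal K b G * (M.affDual (insert G K) G H
        * M.chainDeg L (insert H (insert G K))) := by
    intro a b
    rw [← Finset.sum_sub_distrib]
    refine Finset.sum_congr rfl fun G _ => ?_
    rw [← Finset.sum_sub_distrib]
    exact Finset.sum_congr rfl fun H _ => by ring
  rw [h, h]
  congr 1
  · rw [Finset.sum_comm]
    refine Finset.sum_congr rfl fun G _ => Finset.sum_congr rfl fun H _ => ?_
    rw [Finset.insert_comm]; ring
  · exact Finset.sum_congr rfl fun G _ => Finset.sum_congr rfl fun H _ => by ring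

theorem affZero (L : List (Finset α → ℝ)) : M.AffZero L := by
  induction L with
  | nil =>
    intro a K ha hK
    exact balancing hK (isAff_normal ha) fun F hF => hK.normal_eq_zero a hF
  | cons b L ih =>
    intro a K ha hK
    rw [chainDeg_swap ih a b hK, chainDeg]
    refine Finset.sum_eq_zero fun G _ => ?_
    by_cases hf : M.Flag (insert G K)
    · rw [ih a _ ha hf, mul_zero]
    · rw [chainDeg_eq_zero _ _ (by simp [hK.bot]) (by simp [hK.top]) hf, mul_zero]

theorem chainDeg_perm {L L' : List (Finset α → ℝ)} (h : L.Perm L') {K : Finset (Finset α)}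
    (h0 : ∅ ∈ K) (h1 : Finset.univ ∈ K) : M.chainDeg L K = M.chainDeg L' K := by
  induction h generalizing K with
  | nil => rfl
  | cons a _ ih =>
    simp only [chainDeg]
    exact Finset.sum_congr rfl fun G _ => by rw [ih (by simp [h0]) (by simp [h1])]
  | swap a b L =>
    by_cases hK : M.Flag K
    · exact chainDeg_swap (affZero L) b a hK
    · rw [chainDeg_eq_zero _ _ h0 h1 hK, chainDeg_eq_zero _ _ h0 h1 hK]
  | trans _ _ ih1 ih2 => exact (ih1 h0 h1).trans (ih2 h0 h1)

/-- The indicator function of a finite set. -/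
def ind (F : Finset α) : Finset α → ℝ := fun G => if G = F then 1 else 0

theorem chainDeg_ind {F : Finset α} {K : Finset (Finset α)} (hF : F ∉ K)
    (L : List (Finset α → ℝ)) : M.chainDeg (ind F :: L) K = M.chainDeg L (insert F K) := by
  have h : ∀ G, M.normal K (ind F) G = ind F G := by
    intro G
    rw [normal, Finset.sum_eq_zero, sub_zero]
    intro B hB
    rw [ind, if_neg, zero_mul]
    rintro rfl
    exact hF hB
  simp only [chainDeg, h]
  simp [ind]

theorem sum_chainDeg_ind {a : Finset α → ℝ} (ha : IsAff a) {K : Finset (Finset α)}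
    (hK : M.Flag K) (L : List (Finset α → ℝ)) : ∑ F, a F * M.chainDeg (ind F :: L) K = 0 := by
  rw [← chainDeg_sum]
  convert affZero L a K ha hK with G
  simp [ind]

end RankFn

/-- Chow ring data -/
structure ChowData {α : Type*} [DecidableEq α] [Fintype α] (M : RankFn α) (A : Type*)
    [CommRing A] [Algebra ℝ A] where
  /-- the generators -/
  x : Finset α → A
  /-- the degree map -/
  deg : A →ₗ[ℝ] ℝ
  mul_eq_zero : ∀ F G, ¬ F ⊆ G → ¬ G ⊆ F → x F * x G = 0
  eq_zero : ∀ F, ¬ M.IsFlat F → x F = 0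
  sum_aff : ∀ a, IsAff a → ∑ F, a F • x F = 0
  deg_flag : ∀ K, M.Flag K → K.card = M.r Finset.univ + 1 →
    deg (∏ F ∈ K \ {∅, Finset.univ}, x F) = 1

namespace RankFn

variable {α : Type*} [DecidableEq α] [Fintype α] (M : RankFn α)

/-- The degree of a monomial. -/
noncomputable def monoDeg (s : Multiset (Finset α)) : ℝ :=
  M.chainDeg (s.toList.map ind) {∅, Finset.univ}

theorem monoDeg_coe (L : List (Finset α)) :
    M.monoDeg (L : Multiset (Finset α)) = M.chainDeg (L.map ind) {∅, Finset.univ} :=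
  chainDeg_perm (List.Perm.map _ (Multiset.coe_eq_coe.1 (Multiset.coe_toList _))) (by simp)
    (by simp)

theorem monoDeg_cons (F : Finset α) (s : Multiset (Finset α)) :
    M.monoDeg (F ::ₘ s) = M.chainDeg (ind F :: s.toList.map ind) {∅, Finset.univ} := by
  conv_lhs => rw [← Multiset.coe_toList s, Multiset.cons_coe, monoDeg_coe]
  rfl

/-- The degree map on polynomials. -/
noncomputable def polyDeg : MvPolynomial (Finset α) ℝ →ₗ[ℝ] ℝ :=
  (MvPolynomial.basisMonomials (Finset α) ℝ).constr ℝ fun m => M.monoDeg (Finsupp.toMultiset m)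

theorem polyDeg_monomial (m : Finset α →₀ ℕ) :
    M.polyDeg (MvPolynomial.monomial m 1) = M.monoDeg (Finsupp.toMultiset m) := by
  have := (MvPolynomial.basisMonomials (Finset α) ℝ).constr_basis ℝ
    (fun m => M.monoDeg (Finsupp.toMultiset m)) m
  rwa [MvPolynomial.coe_basisMonomials] at this

theorem polyDeg_prod (s : Multiset (Finset α)) :
    M.polyDeg ((s.map MvPolynomial.X).prod) = M.monoDeg s := by
  have h : ((s.map MvPolynomial.X).prod : MvPolynomial (Finset α) ℝ)
      = MvPolynomial.monomial (Multiset.toFinsupp s) 1 := by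
    induction s using Multiset.induction_on with
    | empty => simp
    | cons a s ih =>
      rw [Multiset.map_cons, Multiset.prod_cons, ih, ← Multiset.singleton_add, map_add,
        Multiset.toFinsupp_singleton, MvPolynomial.X, MvPolynomial.monomial_mul, one_mul]
  rw [h, polyDeg_monomial, Multiset.toFinsupp_toMultiset]

/-- To check that a linear map built from the degree vanishes it suffices to check monomials. -/
theorem polyDeg_mul_eq_zero {g : MvPolynomial (Finset α) ℝ}
    (h : ∀ s : Multiset (Finset α), M.polyDeg ((s.map MvPolynomial.X).prod * g) = 0)
    (f : MvPolynomial (Finset α) ℝ) : M.polyDeg (f * g) = 0 := by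
  induction f using MvPolynomial.induction_on' with
  | monomial m a =>
    have h1 : (MvPolynomial.monomial m a : MvPolynomial (Finset α) ℝ)
        = a • ((Finsupp.toMultiset m).map MvPolynomial.X).prod := by
      rw [Finsupp.toMultiset_map, Finsupp.prod_toMultiset, MvPolynomial.monomial_eq,
        MvPolynomial.smul_eq_C_mul]
      congr 1
      rw [Finsupp.prod_mapDomain_index] <;> simp [pow_add]
    rw [h1, smul_mul_assoc, map_smul, h, smul_zero]
  | add p q hp hq => rw [add_mul, map_add, hp, hq, add_zero]

/-- The ideal of numerically trivial polynomials. -/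
noncomputable def numIdeal : Ideal (MvPolynomial (Finset α) ℝ) where
  carrier := {g | ∀ f, M.polyDeg (f * g) = 0}
  add_mem' := fun {a b} ha hb f => by rw [mul_add, map_add, ha, hb, add_zero]
  zero_mem' := fun f => by simp
  smul_mem' := fun c g hg f => by rw [smul_eq_mul, ← mul_assoc, hg]

theorem mem_numIdeal {g : MvPolynomial (Finset α) ℝ} :
    g ∈ M.numIdeal ↔ ∀ f, M.polyDeg (f * g) = 0 := Iff.rfl

/-- The degree map on the quotient. -/
noncomputable def chowDeg : (MvPolynomial (Finset α) ℝ ⧸ M.numIdeal) →ₗ[ℝ] ℝ :=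
  ((M.numIdeal.restrictScalars ℝ).liftQ M.polyDeg fun g hg => by
    simpa using (mem_numIdeal M).1 hg 1) ∘ₗ
  (Submodule.Quotient.restrictScalarsEquiv ℝ M.numIdeal).symm.toLinearMap

theorem chowDeg_mk (g : MvPolynomial (Finset α) ℝ) :
    M.chowDeg (Ideal.Quotient.mk M.numIdeal g) = M.polyDeg g := rfl

/-- Chow ring data attached to a rank function. -/
noncomputable def chowData : ChowData M (MvPolynomial (Finset α) ℝ ⧸ M.numIdeal) where
  x F := Ideal.Quotient.mk M.numIdeal (MvPolynomial.X F)
  deg := M.chowDeg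
  mul_eq_zero F G h1 h2 := by
    rw [← map_mul, Ideal.Quotient.eq_zero_iff_mem, mem_numIdeal]
    refine M.polyDeg_mul_eq_zero fun s => ?_
    have hF : F ∉ ({∅, Finset.univ} : Finset (Finset α)) := by
      simp only [Finset.mem_insert, Finset.mem_singleton, not_or]
      exact ⟨fun h => h1 (h ▸ Finset.empty_subset _), fun h => h2 (h ▸ Finset.subset_univ _)⟩
    have hG : G ∉ (insert F {∅, Finset.univ} : Finset (Finset α)) := by
      simp only [Finset.mem_insert, Finset.mem_singleton, not_or]
      exact ⟨fun h => h1 h.ge, fun h => h2 (h ▸ Finset.empty_subset _),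
        fun h => h1 (h ▸ Finset.subset_univ _)⟩
    have : ((s.map MvPolynomial.X).prod * (MvPolynomial.X F * MvPolynomial.X G) :
        MvPolynomial (Finset α) ℝ)
        = ((((F :: G :: s.toList : List (Finset α)) : Multiset (Finset α))).map
          MvPolynomial.X).prod := by
      rw [← Multiset.cons_coe, ← Multiset.cons_coe, Multiset.coe_toList, Multiset.map_cons,
        Multiset.map_cons, Multiset.prod_cons, Multiset.prod_cons]
      ring
    rw [this, polyDeg_prod, monoDeg_coe, List.map_cons, List.map_cons, chainDeg_ind hF,
      chainDeg_ind hG, chainDeg_eq_zero _ _ (by simp) (by simp)]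
    intro hf
    rcases hf.chain F (by simp) G (by simp) with h | h
    · exact h1 h
    · exact h2 h
  eq_zero F hF := by
    rw [Ideal.Quotient.eq_zero_iff_mem, mem_numIdeal]
    refine M.polyDeg_mul_eq_zero fun s => ?_
    have hF' : F ∉ ({∅, Finset.univ} : Finset (Finset α)) := by
      simp only [Finset.mem_insert, Finset.mem_singleton, not_or]
      exact ⟨fun h => hF (h ▸ M.isFlat_empty), fun h => hF (h ▸ isFlat_univ)⟩
    rw [mul_comm, ← Multiset.prod_cons, ← Multiset.map_cons, polyDeg_prod, monoDeg_cons,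
      chainDeg_ind hF', chainDeg_eq_zero _ _ (by simp) (by simp)]
    exact fun hf => hF (hf.flat F (by simp))
  sum_aff a ha := by
    have : ∑ F, a F • Ideal.Quotient.mk M.numIdeal (MvPolynomial.X F)
        = Ideal.Quotient.mk M.numIdeal (∑ F, a F • MvPolynomial.X F) := by
      rw [map_sum]
      rfl
    rw [this, Ideal.Quotient.eq_zero_iff_mem, mem_numIdeal]
    refine M.polyDeg_mul_eq_zero fun s => ?_
    rw [Finset.mul_sum, map_sum, ← sum_chainDeg_ind ha M.flag_bot_top (s.toList.map ind)]
    refine Finset.sum_congr rfl fun F _ => ?_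
    rw [mul_smul_comm, map_smul, smul_eq_mul, mul_comm _ (MvPolynomial.X F), ← Multiset.prod_cons,
      ← Multiset.map_cons, polyDeg_prod, monoDeg_cons]
  deg_flag K hK hc := by
    rw [← map_prod, chowDeg_mk]
    have h : ∀ (L : List (Finset α)) (K' : Finset (Finset α)), L.Nodup → (∀ F ∈ L, F ∉ K') →
        M.chainDeg (L.map ind) K' = M.chainDeg [] (L.toFinset ∪ K') := by
      intro L
      induction L with
      | nil => intro K' _ _; simp
      | cons F L ih =>
        intro K' hL hLK
        rw [List.nodup_cons] at hL
        rw [List.map_cons, chainDeg_ind (hLK F (by simp)), ih _ hL.2]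
        · simp
        · intro G hG
          rw [Finset.mem_insert, not_or]
          exact ⟨fun h => hL.1 (h ▸ hG), hLK G (by simp [hG])⟩
    have h2 := M.polyDeg_prod (K \ {∅, Finset.univ}).val
    rw [Finset.prod_map_val] at h2
    rw [h2]
    conv_lhs => rw [← Finset.coe_toList]
    rw [monoDeg_coe, h _ _ (Finset.nodup_toList _) fun F hF => by simp_all,
      Finset.toList_toFinset, Finset.sdiff_union_of_subset, chainDeg, if_pos ⟨hK, hc⟩]
    intro F hF
    simp only [Finset.mem_insert, Finset.mem_singleton] at hF
    rcases hF with rfl | rfl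
    · exact hK.bot
    · exact hK.top

end RankFn

/-- The defining relations of the Chow ring. -/
structure ChowRel {α : Type*} [DecidableEq α] [Fintype α] (M : RankFn α) {B : Type*}
    [CommRing B] [Algebra ℝ B] (x : Finset α → B) : Prop where
  mul_eq_zero : ∀ F G, ¬ F ⊆ G → ¬ G ⊆ F → x F * x G = 0
  eq_zero : ∀ F, ¬ M.IsFlat F → x F = 0
  sum_aff : ∀ a, IsAff a → ∑ F, a F • x F = 0

section

variable {α : Type*} [DecidableEq α] [Fintype α] {B : Type*} [CommRing B] [Algebra ℝ B]

open Classical in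
/-- The sum of the generators indexed by the sets satisfying a predicate. -/
noncomputable def upSum (x : Finset α → B) (p : Finset α → Prop) : B :=
  ∑ F, if p F then x F else 0

/-- The product of the factors `t + upSum (f ≥ s)`. -/
noncomputable def levelProd (x : Finset α → B) (t : B) (f : Finset α → ℕ) : B :=
  ∏ s ∈ Finset.range (f Finset.univ), (t + upSum x fun F => s < f F)

variable {M : RankFn α} {x : Finset α → B}

theorem upSum_mul_eq_zero (H : ChowRel M x) {p q : Finset α → Prop}
    (h : ∀ F G, p F → q G → ¬ F ⊆ G ∧ ¬ G ⊆ F) : upSum x p * upSum x q = 0 := by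
  unfold upSum
  rw [Finset.sum_mul_sum]
  refine Finset.sum_eq_zero fun F _ => Finset.sum_eq_zero fun G _ => ?_
  by_cases hF : p F
  · by_cases hG : q G
    · rw [if_pos hF, if_pos hG]
      exact H.mul_eq_zero F G (h F G hF hG).1 (h F G hF hG).2
    · rw [if_neg hG, mul_zero]
  · rw [if_neg hF, zero_mul]

theorem upSum_split (x : Finset α → B) (p q : Finset α → Prop) :
    upSum x p = upSum x (fun F => p F ∧ q F) + upSum x (fun F => p F ∧ ¬ q F) := by
  unfold upSum
  rw [← Finset.sum_add_distrib]
  refine Finset.sum_congr rfl fun F _ => ?_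
  by_cases hp : p F <;> by_cases hq : q F <;> simp [hp, hq]

theorem upSum_congr (x : Finset α → B) {p q : Finset α → Prop} (h : ∀ F, p F ↔ q F) :
    upSum x p = upSum x q := by
  rw [show p = q from funext fun F => propext (h F)]

theorem upSum_swap (H : ChowRel M x) (t : B) {p q : Finset α → Prop}
    (hp : ∀ F G, F ⊆ G → p F → p G) (hq : ∀ F G, F ⊆ G → q F → q G) :
    (t + upSum x p) * (t + upSum x q)
      = (t + upSum x (fun F => p F ∨ q F)) * (t + upSum x (fun F => p F ∧ q F)) := by
  have h1 := upSum_split x p q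
  have h2 := upSum_split x q p
  have h3 := upSum_split x (fun F => p F ∨ q F) p
  have h4 : upSum x (fun F => (p F ∨ q F) ∧ p F) = upSum x p :=
    upSum_congr x fun F => by tauto
  have h5 : upSum x (fun F => (p F ∨ q F) ∧ ¬ p F) = upSum x (fun F => q F ∧ ¬ p F) :=
    upSum_congr x fun F => by tauto
  have h6 : upSum x (fun F => q F ∧ p F) = upSum x (fun F => p F ∧ q F) :=
    upSum_congr x fun F => by tauto
  have h7 : upSum x (fun F => p F ∧ ¬ q F) * upSum x (fun F => q F ∧ ¬ p F) = 0 :=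
    upSum_mul_eq_zero H fun F G h h' =>
      ⟨fun hs => h'.2 (hp F G hs h.1), fun hs => h.2 (hq G F hs h'.1)⟩
  rw [h3, h4, h5, h2, h6, h1]
  linear_combination h7

theorem upSum_mem (H : ChowRel M x) (i : α) : upSum x (fun F => i ∈ F) = 0 := by
  rw [← H.sum_aff _ (IsAff.mem i)]
  refine Finset.sum_congr rfl fun F _ => ?_
  split_ifs <;> simp

open Classical in
theorem levelProd_mul (H : ChowRel M x) (t : B) {f g : Finset α → ℕ}
    (hf : ∀ F G, F ⊆ G → f F ≤ f G) {q : Finset α → Prop} (hq : ∀ F G, F ⊆ G → q F → q G)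
    (hqu : q Finset.univ) (hg : ∀ F, g F = f F + if q F then 1 else 0) :
    levelProd x t f * (t + upSum x q) = levelProd x t g := by
  have key : ∀ N, (∏ s ∈ Finset.range N, (t + upSum x fun F => s < f F)) * (t + upSum x q)
      = (∏ s ∈ Finset.range N, (t + upSum x fun F => s < g F)) *
        (t + upSum x fun F => N ≤ f F ∧ q F) := by
    intro N
    induction N with
    | zero => simp
    | succ N ih =>
      rw [Finset.prod_range_succ, mul_right_comm, ih, Finset.prod_range_succ, mul_assoc,
        upSum_swap H t (p := fun F => N ≤ f F ∧ q F) (q := fun F => N < f F)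
        (fun F G h h' => ⟨h'.1.trans (hf F G h), hq F G h h'.2⟩)
        (fun F G h h' => h'.trans_le (hf F G h)), ← mul_assoc]
      congr 2
      · congr 1
        refine upSum_congr x fun F => ?_
        rw [hg]
        split_ifs with h
        · simp only [h, and_true]; lia
        · simp [h]
      · refine upSum_congr x fun F => ?_
        constructor
        · rintro ⟨⟨_, h⟩, h'⟩; exact ⟨h', h⟩
        · rintro ⟨h, h'⟩; exact ⟨⟨by lia, h'⟩, h⟩
  unfold levelProd
  rw [key, hg Finset.univ, if_pos hqu, Finset.prod_range_succ]
  congr 2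
  refine upSum_congr x fun F => ?_
  have := hf F _ (Finset.subset_univ F)
  rw [hg]
  split_ifs with h
  · simp only [h, and_true]; lia
  · simp only [h, and_false]; lia

theorem levelProd_card (H : ChowRel M x) (t : B) :
    levelProd x t Finset.card = t ^ Fintype.card α := by
  have key : ∀ T : Finset α, levelProd x t (fun F => (F ∩ T).card) = t ^ T.card := by
    intro T
    induction T using Finset.induction_on with
    | empty => simp [levelProd]
    | insert i T hi ih =>
      rw [Finset.card_insert_of_notMem hi, pow_succ, ← ih]
      have h := levelProd_mul H t (f := fun F => (F ∩ T).card)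
        (g := fun F => (F ∩ insert i T).card) (q := fun F => i ∈ F)
        (fun F G h => Finset.card_le_card (Finset.inter_subset_inter_right h))
        (fun F G h h' => h h') (Finset.mem_univ i) (fun F => by
          split_ifs with h
          · rw [Finset.inter_insert_of_mem h, Finset.card_insert_of_notMem]
            simp [hi]
          · rw [Finset.inter_insert_of_notMem h, add_zero])
      rw [← h, upSum_mem H i, add_zero]
  have := key Finset.univ
  simpa using this

end

namespace RankFn

variable {α : Type*} [DecidableEq α] [Fintype α] (M : RankFn α)

/-- The rank function of the direct sum of the restriction to the complement of `S` with the free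
matroid on `S`. -/
def freeRank (S F : Finset α) : ℕ := M.r (F \ S) + (F ∩ S).card

theorem freeRank_mono (S : Finset α) {F G : Finset α} (h : F ⊆ G) :
    M.freeRank S F ≤ M.freeRank S G :=
  add_le_add (M.mono (Finset.sdiff_subset_sdiff h le_rfl))
    (Finset.card_le_card (Finset.inter_subset_inter_right h))

theorem freeRank_le_card (S F : Finset α) : M.freeRank S F ≤ F.card := by
  rw [freeRank, ← Finset.card_sdiff_add_card_inter F S]
  exact Nat.add_le_add_right (M.le_card _) _

theorem freeRank_eq_card_iff {S F : Finset α} :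
    M.freeRank S F = F.card ↔ M.r (F \ S) = (F \ S).card := by
  rw [freeRank, ← Finset.card_sdiff_add_card_inter F S]
  lia

theorem rank_eq_card_of_subset {F G : Finset α} (h : F ⊆ G) (hG : M.r G = G.card) :
    M.r F = F.card := by
  refine le_antisymm (M.le_card F) ?_
  have h1 := M.submod F (G \ F)
  rw [Finset.union_sdiff_of_subset h] at h1
  have h2 := M.le_card (G \ F)
  have h3 := Finset.card_sdiff_add_card_eq_card h
  lia

/-- Elements whose freeing increases the rank of `F`. -/
def Frees (S : Finset α) (i : α) (F : Finset α) : Prop :=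
  i ∈ F ∧ M.r ((F \ S).erase i) = M.r (F \ S)

variable {M}

theorem Frees.mono {S : Finset α} {i : α} (hi : i ∉ S) {F G : Finset α} (h : F ⊆ G)
    (hF : M.Frees S i F) : M.Frees S i G := by
  refine ⟨h hF.1, ?_⟩
  have h1 : insert i ((F \ S).erase i) = F \ S := Finset.insert_erase (by simp [hi, hF.1])
  have h2 : insert i ((G \ S).erase i) = G \ S := Finset.insert_erase (by simp [hi, h hF.1])
  have h3 := M.insert_eq_of_subset (i := i)
    (Finset.erase_subset_erase i (Finset.sdiff_subset_sdiff h (le_refl S)))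
    (by rw [h1]; exact hF.2.symm)
  rw [h2] at h3
  exact h3.symm

open Classical in
theorem freeRank_insert {S : Finset α} {i : α} (hi : i ∉ S) (F : Finset α) :
    M.freeRank (insert i S) F = M.freeRank S F + if M.Frees S i F then 1 else 0 := by
  unfold freeRank
  have h0 : F \ insert i S = (F \ S).erase i := by ext; simp; tauto
  rw [h0]
  by_cases hF : i ∈ F
  · have h1 : insert i ((F \ S).erase i) = F \ S := Finset.insert_erase (by simp [hi, hF])
    have h2 := M.insert_le i ((F \ S).erase i)
    rw [h1] at h2
    have h3 := M.mono (Finset.erase_subset i (F \ S))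
    rw [Finset.inter_insert_of_mem hF, Finset.card_insert_of_notMem (by simp [hi])]
    split_ifs with h
    · rw [h.2]; lia
    · have : M.r ((F \ S).erase i) ≠ M.r (F \ S) := fun h' => h ⟨hF, h'⟩
      lia
  · rw [Finset.inter_insert_of_notMem hF, if_neg fun h => hF h.1,
      Finset.erase_eq_of_notMem (by simp [hF]), add_zero]

/-- Dependent sets containing an independent set have a redundant element outside of it. -/
theorem exists_rank_erase_eq {X Y : Finset α} (hXY : X ⊆ Y) (hX : M.r X = X.card)
    (hY : M.r Y < Y.card) : ∃ i ∈ Y, i ∉ X ∧ M.r (Y.erase i) = M.r Y := by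
  classical
  obtain ⟨Z, hZ, hmax⟩ := Finset.exists_max_image
    (Y.powerset.filter fun Z => X ⊆ Z ∧ M.r Z = Z.card) Finset.card
    ⟨X, by simp [hXY, hX]⟩
  simp only [Finset.mem_filter, Finset.mem_powerset] at hZ hmax
  obtain ⟨hZY, hXZ, hZr⟩ := hZ
  have hcl : Y ⊆ M.cl Z := by
    intro j hj
    rw [mem_cl]
    by_contra hne
    have hjZ : j ∉ Z := fun h => hne (by rw [Finset.insert_eq_of_mem h])
    have h1 := M.insert_le j Z
    have h2 := M.mono (Finset.subset_insert j Z)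
    have h3 := hmax (insert j Z) ⟨Finset.insert_subset hj hZY,
      hXZ.trans (Finset.subset_insert _ _), by
        rw [Finset.card_insert_of_notMem hjZ]; lia⟩
    rw [Finset.card_insert_of_notMem hjZ] at h3
    lia
  have hYr : M.r Y = M.r Z := by
    have := rank_union_cl Z Y hcl
    rwa [Finset.union_eq_right.2 hZY] at this
  have hne : Z ≠ Y := by
    rintro rfl
    lia
  obtain ⟨i, hiY, hiZ⟩ := Finset.exists_of_ssubset (hZY.ssubset_of_ne hne)
  refine ⟨i, hiY, fun h => hiZ (hXZ h), le_antisymm (M.mono (Finset.erase_subset _ _)) ?_⟩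
  rw [hYr]
  exact M.mono (Finset.subset_erase.2 ⟨hZY, hiZ⟩)

theorem Flag.exists_frees {K : Finset (Finset α)} (hK : M.Flag K) {S : Finset α}
    (hS : M.freeRank S Finset.univ < Fintype.card α) :
    ∃ i ∉ S, M.Frees S i Finset.univ ∧ ∀ F ∈ K, i ∈ F → M.Frees S i F := by
  classical
  obtain ⟨B, hB, hmin⟩ := Finset.exists_min_image
    (K.filter fun F => M.freeRank S F < F.card) Finset.card
    ⟨Finset.univ, by simpa [hK.top] using hS⟩
  simp only [Finset.mem_filter] at hB hmin
  have hB0 : B ≠ ∅ := by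
    rintro rfl
    simp at hB
  obtain ⟨A, hA, hmax⟩ := Finset.exists_max_image (K.filter (· ⊂ B)) Finset.card
    ⟨∅, by simp [hK.bot, Finset.empty_ssubset, Finset.nonempty_iff_ne_empty, hB0]⟩
  simp only [Finset.mem_filter] at hA hmax
  have hAr : M.r (A \ S) = (A \ S).card := by
    rw [← freeRank_eq_card_iff]
    refine le_antisymm (M.freeRank_le_card S A) (not_lt.1 fun h => ?_)
    exact (hmin A ⟨hA.1, h⟩).not_gt (Finset.card_lt_card hA.2)
  have hBr : M.r (B \ S) < (B \ S).card := by
    refine lt_of_le_of_ne (M.le_card _) fun h => ?_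
    rw [← freeRank_eq_card_iff] at h
    exact hB.2.ne h
  obtain ⟨i, hi, hiA, hir⟩ := exists_rank_erase_eq
    (Finset.sdiff_subset_sdiff hA.2.1 (le_refl S)) hAr hBr
  rw [Finset.mem_sdiff] at hi
  have hfB : M.Frees S i B := ⟨hi.1, hir⟩
  refine ⟨i, hi.2, hfB.mono hi.2 (Finset.subset_univ _), fun F hF hiF => ?_⟩
  by_cases hBF : B ⊆ F
  · exact hfB.mono hi.2 hBF
  · have hFB : F ⊂ B := ⟨(hK.chain F hF B hB.1).resolve_right hBF, hBF⟩
    have h1 := hmax F ⟨hF, hFB⟩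
    refine absurd (Finset.mem_sdiff.2 ⟨?_, hi.2⟩) hiA
    rcases hK.chain F hF A hA.1 with h | h
    · exact h hiF
    · exact (Finset.eq_of_subset_of_card_le h h1).symm ▸ hiF

end RankFn

namespace RankFn

variable {α : Type*} [DecidableEq α] [Fintype α] {M : RankFn α}

variable (M) in
/-- Flats which can be added to a chain. -/
structure Ext (K : Finset (Finset α)) (F : Finset α) : Prop where
  flat : M.IsFlat F
  notMem : F ∉ K
  comp : ∀ G ∈ K, G ⊆ F ∨ F ⊆ G

theorem Ext.flag {K : Finset (Finset α)} {F : Finset α} (h : M.Ext K F) (hK : M.Flag K) :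
    M.Flag (insert F K) := hK.insert_flat h.flat h.comp

theorem Ext.card {K : Finset (Finset α)} {F : Finset α} (h : M.Ext K F) :
    (insert F K).card = K.card + 1 := Finset.card_insert_of_notMem h.notMem

theorem Ext.ext_insert {K : Finset (Finset α)} {F G : Finset α} (hG : M.Ext K G)
    (hne : F ≠ G) (h : F ⊆ G ∨ G ⊆ F) : M.Ext (insert F K) G := by
  refine ⟨hG.flat, ?_, fun G' hG' => ?_⟩
  · rw [Finset.mem_insert, not_or]
    exact ⟨hne.symm, hG.notMem⟩
  · rcases Finset.mem_insert.1 hG' with h1 | h1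
    · exact h1 ▸ h
    · exact hG.comp _ h1

/-- The neighbours of a compatible flat in a chain. -/
theorem Flag.exists_gap {K : Finset (Finset α)} (hK : M.Flag K) {F : Finset α}
    (hF : M.Ext K F) : ∃ A ∈ K, ∃ B ∈ K, A ⊂ F ∧ F ⊂ B ∧ ∀ G ∈ K, G ⊆ A ∨ B ⊆ G := by
  obtain ⟨A, hA, hmax⟩ := Finset.exists_max_image (K.filter (· ⊆ F)) M.r
    ⟨∅, by simp [hK.bot]⟩
  obtain ⟨B, hB, hmin⟩ := Finset.exists_min_image (K.filter (F ⊆ ·)) M.r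
    ⟨Finset.univ, by simp [hK.top]⟩
  simp only [Finset.mem_filter] at hA hB hmax hmin
  refine ⟨A, hA.1, B, hB.1, hA.2.ssubset_of_ne ?_, hB.2.ssubset_of_ne ?_, fun G hG => ?_⟩
  · rintro rfl; exact hF.notMem hA.1
  · rintro rfl; exact hF.notMem hB.1
  · rcases hF.comp G hG with h | h
    · exact Or.inl (hK.subset_of_rank_le hG hA.1 (hmax G ⟨hG, h⟩))
    · exact Or.inr (hK.subset_of_rank_le hB.1 hG (hmin G ⟨hG, h⟩))

theorem ext_of_gap {K : Finset (Finset α)} {A B F : Finset α} (hF : M.IsFlat F)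
    (hAF : A ⊂ F) (hFB : F ⊂ B) (h : ∀ G ∈ K, G ⊆ A ∨ B ⊆ G) : M.Ext K F := by
  refine ⟨hF, fun hFK => ?_, fun G hG => ?_⟩
  · rcases h F hFK with h1 | h1
    · exact hAF.2 h1
    · exact hFB.2 h1
  · rcases h G hG with h1 | h1
    · exact Or.inl (h1.trans hAF.1)
    · exact Or.inr (hFB.1.trans h1)

theorem ssubset_of_rank_lt {F G : Finset α} (h : F ⊆ G) (hr : M.r F < M.r G) : F ⊂ G :=
  h.ssubset_of_ne (by rintro rfl; exact lt_irrefl _ hr)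

/-- The gap of a chain around a missing rank. -/
theorem Flag.exists_gap_rank {K : Finset (Finset α)} (hK : M.Flag K) {p : ℕ}
    (hp : p ≤ M.r Finset.univ) (hpK : ∀ F ∈ K, M.r F ≠ p) :
    ∃ A ∈ K, ∃ B ∈ K, A ⊂ B ∧ M.r A < p ∧ p < M.r B ∧ ∀ G ∈ K, G ⊆ A ∨ B ⊆ G := by
  have h0 := hpK ∅ hK.bot
  have h1 := hpK Finset.univ hK.top
  rw [M.empty] at h0
  obtain ⟨A, hA, hmax⟩ := Finset.exists_max_image (K.filter (M.r · < p)) M.r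
    ⟨∅, by simp only [Finset.mem_filter, hK.bot, M.empty, true_and]; lia⟩
  obtain ⟨B, hB, hmin⟩ := Finset.exists_min_image (K.filter (p < M.r ·)) M.r
    ⟨Finset.univ, by simp only [Finset.mem_filter, hK.top, true_and]; lia⟩
  simp only [Finset.mem_filter] at hA hB hmax hmin
  refine ⟨A, hA.1, B, hB.1, ?_, hA.2, hB.2, fun G hG => ?_⟩
  · exact ssubset_of_rank_lt (M := M) (hK.subset_of_rank_le hA.1 hB.1 (by lia)) (by lia)
  · rcases lt_trichotomy (M.r G) p with h | h | h
    · exact Or.inl (hK.subset_of_rank_le hG hA.1 (hmax G ⟨hG, h⟩))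
    · exact absurd h (hpK G hG)
    · exact Or.inr (hK.subset_of_rank_le hB.1 hG (hmin G ⟨hG, h⟩))

theorem Flag.exists_missing {K : Finset (Finset α)} (hK : M.Flag K)
    (hc : K.card < M.r Finset.univ + 1) :
    ∃ p ≤ M.r Finset.univ, ∀ F ∈ K, M.r F ≠ p := by
  have h1 : (K.image M.r).card < (Finset.range (M.r Finset.univ + 1)).card := by
    rw [hK.card_image, Finset.card_range]; exact hc
  obtain ⟨p, hp, hpK⟩ := Finset.exists_mem_notMem_of_card_lt_card h1
  refine ⟨p, by simpa [Nat.lt_succ_iff] using hp, fun F hF h => hpK ?_⟩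
  exact Finset.mem_image.2 ⟨F, hF, h⟩

theorem Flag.exists_ext {K : Finset (Finset α)} (hK : M.Flag K)
    (hc : K.card < M.r Finset.univ + 1) : ∃ F, M.Ext K F := by
  obtain ⟨p, hp, hpK⟩ := hK.exists_missing hc
  obtain ⟨A, hA, B, hB, hAB, hAp, hpB, h⟩ := hK.exists_gap_rank hp hpK
  obtain ⟨i, hiB, hiA⟩ := Finset.exists_of_ssubset hAB
  refine ⟨_, ext_of_gap (isFlat_cl (insert i A)) (ssubset_cl_insert hiA) ?_ h⟩
  refine ssubset_of_rank_lt (M := M) ((hK.flat B hB).cl_subset (Finset.insert_subset hiB hAB.1)) ?_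
  rw [rank_cl_insert (hK.flat A hA) hiA]
  lia

/-- Two compatible flats are connected through flats comparable to their neighbours. -/
theorem Flag.ext_connected {K : Finset (Finset α)} (hK : M.Flag K)
    (hc : K.card + 2 < M.r Finset.univ + 1) {F G : Finset α} (hF : M.Ext K F)
    (hG : M.Ext K G) : ∃ H₁ H₂ H₃, M.Ext K H₁ ∧ M.Ext K H₂ ∧ M.Ext K H₃ ∧
      (F ⊆ H₁ ∨ H₁ ⊆ F) ∧ (H₁ ⊆ H₂ ∨ H₂ ⊆ H₁) ∧ (H₂ ⊆ H₃ ∨ H₃ ⊆ H₂) ∧ (H₃ ⊆ G ∨ G ⊆ H₃) := by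
  by_cases hcomp : F ⊆ G ∨ G ⊆ F
  · exact ⟨F, F, F, hF, hF, hF, by simp, by simp, by simp, hcomp⟩
  rw [not_or] at hcomp
  obtain ⟨A, hA, B, hB, hAF, hFB, hgap⟩ := hK.exists_gap hF
  have hAG : A ⊂ G := by
    refine Finset.ssubset_iff_subset_ne.2 ⟨?_, ?_⟩
    · exact (hG.comp A hA).resolve_right fun h => hcomp.2 (h.trans hAF.1)
    · rintro rfl; exact hG.notMem hA
  have hGB : G ⊂ B := by
    refine Finset.ssubset_iff_subset_ne.2 ⟨?_, ?_⟩
    · exact (hG.comp B hB).resolve_left fun h => hcomp.1 (hFB.1.trans h)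
    · rintro rfl; exact hG.notMem hB
  have hAf := hK.flat A hA
  have r1 := hAf.rank_lt hAF
  have r2 := hF.flat.rank_lt hFB
  have r3 := hAf.rank_lt hAG
  have r4 := hG.flat.rank_lt hGB
  by_cases hr : M.r A + 3 ≤ M.r B
  · obtain ⟨i, hiF, hiA⟩ := Finset.exists_of_ssubset hAF
    obtain ⟨j, hjG, hjA⟩ := Finset.exists_of_ssubset hAG
    have hJB : M.cl (insert j (insert i A)) ⊂ B := by
      refine ssubset_of_rank_lt (M := M) ((hK.flat B hB).cl_subset (Finset.insert_subset (hGB.1 hjG)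
        (Finset.insert_subset (hFB.1 hiF) (hAF.1.trans hFB.1)))) ?_
      have h1 := M.insert_le j (insert i A)
      have h2 := M.insert_le i A
      rw [rank_cl]
      lia
    have hsub1 : M.cl (insert i A) ⊆ M.cl (insert j (insert i A)) :=
      (isFlat_cl _).cl_subset ((Finset.subset_insert _ _).trans (subset_cl _))
    have hsub2 : M.cl (insert j A) ⊆ M.cl (insert j (insert i A)) :=
      (isFlat_cl _).cl_subset ((Finset.insert_subset_insert _ (Finset.subset_insert _ _)).trans
        (subset_cl _))
    have hF' : M.cl (insert i A) ⊆ F := hF.flat.cl_subset (Finset.insert_subset hiF hAF.1)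
    have hG' : M.cl (insert j A) ⊆ G := hG.flat.cl_subset (Finset.insert_subset hjG hAG.1)
    exact ⟨M.cl (insert i A), M.cl (insert j (insert i A)), M.cl (insert j A),
      ext_of_gap (isFlat_cl _) (ssubset_cl_insert hiA) (hF'.trans_ssubset hFB) hgap,
      ext_of_gap (isFlat_cl _) ((ssubset_cl_insert hiA).trans_subset hsub1) hJB hgap,
      ext_of_gap (isFlat_cl _) (ssubset_cl_insert hjA) (hG'.trans_ssubset hGB) hgap,
      Or.inr hF', Or.inl hsub1, Or.inr hsub2, Or.inl hG'⟩
  · obtain ⟨H, hH⟩ := (hF.flag hK).exists_ext (by rw [hF.card]; lia)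
    have hHK : M.Ext K H := ⟨hH.flat, fun h => hH.notMem (Finset.mem_insert_of_mem h),
      fun G' hG' => hH.comp G' (Finset.mem_insert_of_mem hG')⟩
    have hFH := hH.comp F (Finset.mem_insert_self _ _)
    refine ⟨H, H, H, hHK, hHK, hHK, hFH, by simp, by simp, ?_⟩
    rcases hHK.comp A hA with h1 | h1
    · rcases hHK.comp B hB with h2 | h2
      · exact Or.inr (hGB.1.trans h2)
      · exfalso
        have hAH : A ⊂ H := h1.ssubset_of_ne (by rintro rfl; exact hHK.notMem hA)
        have hHB : H ⊂ B := h2.ssubset_of_ne (by rintro rfl; exact hHK.notMem hB)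
        have s1 := hAf.rank_lt hAH
        have s2 := hH.flat.rank_lt hHB
        have hFHeq : F = H := by
          rcases hFH with h | h
          · exact hF.flat.eq_of_rank_le h (by lia)
          · exact (hH.flat.eq_of_rank_le h (by lia)).symm
        exact hH.notMem (hFHeq ▸ Finset.mem_insert_self _ _)
    · exact Or.inl (h1.trans hAG.1)

end RankFn

section

variable {α : Type*} [DecidableEq α] [Fintype α] {B : Type*} [CommRing B] [Algebra ℝ B]

/-- The monomial of a chain. -/
def flagProd (x : Finset α → B) (K : Finset (Finset α)) : B :=
  ∏ F ∈ K \ {∅, Finset.univ}, x F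

variable {M : RankFn α} {x : Finset α → B}

theorem flagProd_insert (x : Finset α → B) {K : Finset (Finset α)} {F : Finset α}
    (h0 : ∅ ∈ K) (h1 : Finset.univ ∈ K) (hF : F ∉ K) :
    flagProd x (insert F K) = flagProd x K * x F := by
  have hF' : F ∉ ({∅, Finset.univ} : Finset (Finset α)) := by
    simp only [Finset.mem_insert, Finset.mem_singleton, not_or]
    exact ⟨fun h => hF (h ▸ h0), fun h => hF (h ▸ h1)⟩
  rw [flagProd, Finset.insert_sdiff_of_notMem _ hF', Finset.prod_insert (by simp [hF]), mul_comm,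
    flagProd]

theorem RankFn.Ext.flagProd_insert {K : Finset (Finset α)} {F : Finset α} (hK : M.Flag K)
    (hF : M.Ext K F) (x : Finset α → B) : flagProd x (insert F K) = flagProd x K * x F :=
  _root_.flagProd_insert x hK.bot hK.top hF.notMem

theorem ChowRel.sum_mem (H : ChowRel M x) (i : α) :
    ∑ F : Finset α, (if i ∈ F then x F else 0) = 0 := by
  simpa only [ite_smul, one_smul, zero_smul] using H.sum_aff _ (IsAff.mem i)

theorem flagProd_mul_eq_zero (H : ChowRel M x) {K : Finset (Finset α)} {F : Finset α}
    (hF : F ∉ K) (h : ¬ M.Ext K F) : flagProd x K * x F = 0 := by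
  by_cases hfl : M.IsFlat F
  · have : ∃ G ∈ K, ¬ G ⊆ F ∧ ¬ F ⊆ G := by
      by_contra! hc
      exact h ⟨hfl, hF, fun G hG => by
        by_cases hGF : G ⊆ F
        · exact Or.inl hGF
        · exact Or.inr (hc G hG hGF)⟩
    obtain ⟨G, hG, h1, h2⟩ := this
    have hGK : G ∈ K \ {∅, Finset.univ} := by
      simp only [Finset.mem_sdiff, Finset.mem_insert, Finset.mem_singleton, not_or]
      exact ⟨hG, fun h => h1 (h ▸ Finset.empty_subset _), fun h => h2 (h ▸ Finset.subset_univ _)⟩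
    rw [flagProd, ← Finset.prod_erase_mul _ _ hGK, mul_assoc, H.mul_eq_zero G F h1 h2, mul_zero]
  · rw [H.eq_zero F hfl, mul_zero]

open Classical in
/-- Linear relations between the generators modulo the monomial of a chain. -/
theorem flagProd_sum_aff (H : ChowRel M x) {K : Finset (Finset α)} {a a' : Finset α → ℝ}
    (ha : IsAff fun F => a F - a' F) (hK : ∀ F ∈ K, a' F = 0) :
    flagProd x K * ∑ F, a F • x F
      = ∑ F, if M.Ext K F then a' F • (flagProd x K * x F) else 0 := by
  have h1 := H.sum_aff _ ha
  simp only [sub_smul, Finset.sum_sub_distrib] at h1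
  rw [sub_eq_zero.1 h1, Finset.mul_sum]
  refine Finset.sum_congr rfl fun F _ => ?_
  rw [mul_smul_comm]
  split_ifs with h
  · rfl
  · by_cases hF : F ∈ K
    · rw [hK F hF, zero_smul]
    · rw [flagProd_mul_eq_zero H hF h, smul_zero]

/-- A linear functional satisfying the normalization of the degree of the Lagrangian geometry. -/
structure PosData (M : RankFn α) (x : Finset α → B) (t : B) (lam : B →ₗ[ℝ] ℝ) : Prop where
  rel : ChowRel M x
  lam_t : ∀ g, lam (t ^ Fintype.card α * g) = 0
  lam_flag : ∀ (K : Finset (Finset α)) (f : Finset α → ℕ), M.Flag K →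
    K.card = M.r Finset.univ + 1 → f Finset.univ + 1 = Fintype.card α →
    lam (flagProd x K * levelProd x t f) = 1

/-- Functions with a strictly positive representative at every chain. -/
def RankFn.AmpleOn (M : RankFn α) (a : Finset α → ℝ) : Prop :=
  ∀ K, M.Flag K → ∃ a' : Finset α → ℝ, (IsAff fun F => a F - a' F) ∧ (∀ F ∈ K, a' F = 0) ∧
    ∀ F, M.Ext K F → 0 < a' F

/-- The cone of strictly positive degree one elements. -/
def ampCone (M : RankFn α) (x : Finset α → B) (t : B) : Set B :=
  {l | ∃ (T : ℝ) (a : Finset α → ℝ), 0 < T ∧ M.AmpleOn a ∧ l = T • t + ∑ F, a F • x F}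

/-- The degree one elements. -/
def degOne (x : Finset α → B) (t : B) : Submodule ℝ B :=
  Submodule.span ℝ (insert t (Set.range x))

theorem t_mem_degOne (x : Finset α → B) (t : B) : t ∈ degOne x t :=
  Submodule.subset_span (Set.mem_insert _ _)

theorem x_mem_degOne (x : Finset α → B) (t : B) (F : Finset α) : x F ∈ degOne x t :=
  Submodule.subset_span (Set.mem_insert_of_mem _ ⟨F, rfl⟩)

theorem comb_mem_degOne (x : Finset α → B) (t : B) (T : ℝ) (a : Finset α → ℝ) :
    T • t + ∑ F, a F • x F ∈ degOne x t :=
  (degOne x t).add_mem ((degOne x t).smul_mem _ (t_mem_degOne x t))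
    ((degOne x t).sum_mem fun F _ => (degOne x t).smul_mem _ (x_mem_degOne x t F))

theorem exists_comb_of_mem_degOne {x : Finset α → B} {t u : B} (hu : u ∈ degOne x t) :
    ∃ (T : ℝ) (a : Finset α → ℝ), u = T • t + ∑ F, a F • x F := by
  obtain ⟨T, z, hz, rfl⟩ := Submodule.mem_span_insert.1 hu
  obtain ⟨a, rfl⟩ := (Submodule.mem_span_range_iff_exists_fun ℝ).1 hz
  exact ⟨T, a, rfl⟩

theorem upSum_mem_degOne (x : Finset α → B) (t : B) (p : Finset α → Prop) :
    upSum x p ∈ degOne x t := by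
  classical
  refine (degOne x t).sum_mem fun F _ => ?_
  split_ifs
  · exact x_mem_degOne x t F
  · exact (degOne x t).zero_mem

/-- The states of the local system. -/
def RankFn.State (M : RankFn α) (x : Finset α → B) (t : B) (d : ℕ) (s : B) : Prop :=
  ∃ K S, M.Flag K ∧ M.freeRank S Finset.univ + 1 ≤ Fintype.card α ∧
    d + K.card + M.freeRank S Finset.univ = M.r Finset.univ + Fintype.card α ∧
    s = flagProd x K * levelProd x t (M.freeRank S)

theorem freeRank_insert_univ {S : Finset α} {i : α} (hi : i ∉ S)
    (h : M.Frees S i Finset.univ) :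
    M.freeRank (insert i S) Finset.univ = M.freeRank S Finset.univ + 1 := by
  rw [RankFn.freeRank_insert hi, if_pos h]

theorem levelProd_insert (H : ChowRel M x) (t : B) {S : Finset α} {i : α} (hi : i ∉ S)
    (h : M.Frees S i Finset.univ) :
    levelProd x t (M.freeRank S) * (t + upSum x (M.Frees S i))
      = levelProd x t (M.freeRank (insert i S)) :=
  levelProd_mul H t (fun _ _ h => M.freeRank_mono S h) (fun _ _ h h' => h'.mono hi h) h
    (fun F => by rw [RankFn.freeRank_insert hi])

theorem levelProd_of_freeRank_eq (H : ChowRel M x) (t : B) {S : Finset α}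
    (h : M.freeRank S Finset.univ = Fintype.card α) :
    levelProd x t (M.freeRank S) = t ^ Fintype.card α := by
  rw [← levelProd_card H t]
  congr 1
  funext F
  rw [RankFn.freeRank_eq_card_iff]
  refine M.rank_eq_card_of_subset (Finset.sdiff_subset_sdiff (Finset.subset_univ F) le_rfl) ?_
  rw [← RankFn.freeRank_eq_card_iff, h, Finset.card_univ]

/-- The neighbours of a state. -/
def VertexOk (M : RankFn α) (K : Finset (Finset α)) (S : Finset α) : Option (Finset α) → Prop
  | none => M.freeRank S Finset.univ + 2 ≤ Fintype.card α
  | some F => M.Ext K F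

/-- The degree one element attached to a neighbour. -/
noncomputable def vertexElt (M : RankFn α) (x : Finset α → B) (t : B) (S : Finset α) (i : α) :
    Option (Finset α) → B
  | none => t + upSum x (M.Frees S i)
  | some F => x F

open Classical in
/-- The coefficients in the expansion along the neighbours of a state. -/
noncomputable def vertexCoeff (M : RankFn α) (S : Finset α) (i : α) (T : ℝ) (a : Finset α → ℝ) :
    Option (Finset α) → ℝ
  | none => T
  | some F => a F + T * ((if i ∈ F then 1 else 0) - if M.Frees S i F then 1 else 0)

variable {t : B} {lam : B →ₗ[ℝ] ℝ}

open Classical in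
theorem state_expand (H : PosData M x t lam) {K : Finset (Finset α)}
    {S : Finset α} {i : α} (hi : i ∉ S) (hS : M.freeRank S Finset.univ + 1 ≤ Fintype.card α)
    (hiu : M.Frees S i Finset.univ) (hiK : ∀ F ∈ K, i ∈ F → M.Frees S i F)
    (T : ℝ) {a a' : Finset α → ℝ} (ha : IsAff fun F => a F - a' F) (haK : ∀ F ∈ K, a' F = 0)
    (g : B) :
    lam (flagProd x K * levelProd x t (M.freeRank S) * ((T • t + ∑ F, a F • x F) * g))
      = ∑ v : {v // VertexOk M K S v}, vertexCoeff M S i T a' v.1 *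
        lam (flagProd x K * levelProd x t (M.freeRank S) * (vertexElt M x t S i v.1 * g)) := by
  set P := flagProd x K with hP
  set Q := levelProd x t (M.freeRank S) with hQ
  let ε : Finset α → ℝ := fun F => (if i ∈ F then 1 else 0) - if M.Frees S i F then 1 else 0
  have hε : ∀ F ∈ K, ε F = 0 := by
    intro F hF
    by_cases h : i ∈ F
    · simp [ε, h, hiK F hF h]
    · have h' : ¬ M.Frees S i F := fun h' => h h'.1
      simp [ε, h, h']
  have h1 : T • t + ∑ F, a F • x F = T • (t + upSum x (M.Frees S i))
      + ∑ F, (a F + T * ε F) • x F := by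
    have h2 := H.rel.sum_mem i
    simp only [add_smul, Finset.sum_add_distrib, mul_smul, ← Finset.smul_sum, ε, sub_smul,
      Finset.sum_sub_distrib, ite_smul, one_smul, zero_smul]
    rw [h2, smul_add, zero_sub, smul_neg]
    unfold upSum
    abel
  have h3 := flagProd_sum_aff H.rel (K := K) (a := fun F => a F + T * ε F)
    (a' := fun F => a' F + T * ε F)
    (by simpa only [add_sub_add_right_eq_sub] using ha)
    (fun F hF => by rw [haK F hF, hε F hF]; ring)
  have h4 : P * Q * ((T • t + ∑ F, a F • x F) * g)
      = T • (P * Q * ((t + upSum x (M.Frees S i)) * g))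
        + ∑ F, if M.Ext K F then (a' F + T * ε F) • (P * Q * (x F * g)) else 0 := by
    rw [h1, show P * Q * ((T • (t + upSum x (M.Frees S i)) + ∑ F, (a F + T * ε F) • x F) * g)
      = P * Q * (T • (t + upSum x (M.Frees S i)) * g)
        + (P * ∑ F, (a F + T * ε F) • x F) * (Q * g) by ring, h3, Finset.sum_mul,
      smul_mul_assoc, mul_smul_comm]
    congr 1
    refine Finset.sum_congr rfl fun F _ => ?_
    rw [ite_mul, zero_mul, smul_mul_assoc]
    congr 2
    ring
  have h5 : ∀ f : Option (Finset α) → ℝ, ∑ v : {v // VertexOk M K S v}, f v.1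
      = (if VertexOk M K S none then f none else 0)
        + ∑ F, if M.Ext K F then f (some F) else 0 := by
    intro f
    rw [← Finset.sum_subtype (Finset.univ.filter (VertexOk M K S)) (by simp) f,
      Finset.sum_filter, Fintype.sum_option]
    rfl
  rw [h4, map_add, map_sum, h5 (fun v => vertexCoeff M S i T a' v *
        lam (P * Q * (vertexElt M x t S i v * g))), map_smul, smul_eq_mul]
  congr 1
  · split_ifs with h
    · rfl
    · have h6 : M.freeRank (insert i S) Finset.univ = Fintype.card α := by
        rw [freeRank_insert_univ hi hiu]
        have : ¬ (M.freeRank S Finset.univ + 2 ≤ Fintype.card α) := h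
        lia
      rw [show P * Q * ((t + upSum x (M.Frees S i)) * g)
        = (Q * (t + upSum x (M.Frees S i))) * (P * g) by ring, hQ, levelProd_insert H.rel t hi hiu,
        levelProd_of_freeRank_eq H.rel t h6, H.lam_t, mul_zero]
  · refine Finset.sum_congr rfl fun F _ => ?_
    split_ifs with h
    · rw [map_smul, smul_eq_mul]
      rfl
    · exact map_zero _

end

section

variable {α : Type*} [DecidableEq α] [Fintype α] {B : Type*} [CommRing B] [Algebra ℝ B]
  {M : RankFn α} {x : Finset α → B} {t : B} {lam : B →ₗ[ℝ] ℝ}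

theorem state_mul_x {K : Finset (Finset α)} (hK : M.Flag K) {F : Finset α} (hF : M.Ext K F)
    (x : Finset α → B) (Q : B) : flagProd x K * Q * x F = flagProd x (insert F K) * Q := by
  rw [hF.flagProd_insert hK]
  ring

theorem vertex_state (H : ChowRel M x) (t : B) {d : ℕ} {K : Finset (Finset α)} (hK : M.Flag K)
    {S : Finset α} {i : α} (hi : i ∉ S) (hiu : M.Frees S i Finset.univ)
    (hS : M.freeRank S Finset.univ + 1 ≤ Fintype.card α)
    (hd : d + 1 + K.card + M.freeRank S Finset.univ = M.r Finset.univ + Fintype.card α)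
    {v : Option (Finset α)} (hv : VertexOk M K S v) :
    M.State x t d (flagProd x K * levelProd x t (M.freeRank S) * vertexElt M x t S i v) := by
  cases v with
  | none =>
    refine ⟨K, insert i S, hK, ?_, ?_, ?_⟩
    · rw [freeRank_insert_univ hi hiu]
      exact hv
    · rw [freeRank_insert_univ hi hiu]
      lia
    · rw [mul_assoc]
      exact congrArg _ (levelProd_insert H t hi hiu)
  | some F =>
    have hF : M.Ext K F := hv
    exact ⟨insert F K, S, hF.flag hK, hS, by rw [hF.card]; lia, state_mul_x hK hF x _⟩

theorem vertex_state_pair (H : ChowRel M x) (t : B) {d : ℕ} {K : Finset (Finset α)}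
    (hK : M.Flag K) {S : Finset α} {i : α} (hi : i ∉ S) (hiu : M.Frees S i Finset.univ)
    (hS : M.freeRank S Finset.univ + 1 ≤ Fintype.card α)
    (hd : d + 2 + K.card + M.freeRank S Finset.univ = M.r Finset.univ + Fintype.card α)
    {F G : Finset α} (hF : M.Ext K F) (hG : M.Ext K G) (hne : F ≠ G) (h : F ⊆ G ∨ G ⊆ F) :
    M.State x t d (flagProd x K * levelProd x t (M.freeRank S) * (x F * x G)) := by
  have := vertex_state H t (hF.flag hK) hi hiu hS (d := d) (by rw [hF.card]; lia)
    (v := some G) (hG.ext_insert hne h)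
  rwa [← state_mul_x hK hF, mul_assoc] at this

theorem vertex_state_none (H : ChowRel M x) (t : B) {d : ℕ} {K : Finset (Finset α)}
    (hK : M.Flag K) {S : Finset α} {i : α} (hi : i ∉ S) (hiu : M.Frees S i Finset.univ)
    (hd : d + 2 + K.card + M.freeRank S Finset.univ = M.r Finset.univ + Fintype.card α)
    (hS : M.freeRank S Finset.univ + 2 ≤ Fintype.card α) {F : Finset α} (hF : M.Ext K F) :
    M.State x t d (flagProd x K * levelProd x t (M.freeRank S)
      * (x F * (t + upSum x (M.Frees S i)))) := by
  have := vertex_state H t (hF.flag hK) hi hiu (by lia) (d := d) (by rw [hF.card]; lia)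
    (v := none) hS
  rwa [← state_mul_x hK hF, mul_assoc] at this

theorem local_expansion (H : PosData M x t lam) {d : ℕ} {s : B} (hs : M.State x t (d + 1) s) :
    ∃ (K : Finset (Finset α)) (S : Finset α) (i : α), M.Flag K ∧ i ∉ S ∧
      M.Frees S i Finset.univ ∧
      M.freeRank S Finset.univ + 1 ≤ Fintype.card α ∧
      d + 1 + K.card + M.freeRank S Finset.univ = M.r Finset.univ + Fintype.card α ∧
      s = flagProd x K * levelProd x t (M.freeRank S) ∧
      ∃ (_ : Fintype {v // VertexOk M K S v}), Nonempty {v // VertexOk M K S v} ∧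
      LocalExpansion lam (degOne x t) (ampCone M x t) (M.State x t) d s
        (fun v : {v // VertexOk M K S v} => vertexElt M x t S i v.1) := by
  classical
  obtain ⟨K, S, hK, hS, hd, rfl⟩ := hs
  obtain ⟨i, hi, hiu, hiK⟩ := hK.exists_frees (S := S) (by lia)
  refine ⟨K, S, i, hK, hi, hiu, hS, hd, rfl, inferInstance, ?_, ?_⟩
  · by_cases h : M.freeRank S Finset.univ + 2 ≤ Fintype.card α
    · exact ⟨⟨none, h⟩⟩
    · obtain ⟨F, hF⟩ := hK.exists_ext (by lia)
      exact ⟨⟨some F, hF⟩⟩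
  have hexp := fun T {a a' : Finset α → ℝ} ha haK g =>
    state_expand H hi hS hiu hiK T (a := a) (a' := a') ha haK g
  constructor
  · rintro ⟨v, hv⟩
    cases v with
    | none => exact (degOne x t).add_mem (t_mem_degOne x t) (upSum_mem_degOne x t _)
    | some F => exact x_mem_degOne x t F
  · rintro ⟨v, hv⟩
    exact vertex_state H.rel t hK hi hiu hS hd hv
  · rintro l ⟨T, a, hT, ha, rfl⟩
    obtain ⟨a', haff, haK, hpos⟩ := ha K hK
    refine ⟨fun v => vertexCoeff M S i T a' v.1, ?_, fun g => hexp T haff haK g⟩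
    rintro ⟨v, hv⟩
    cases v with
    | none => exact hT
    | some F =>
      refine add_pos_of_pos_of_nonneg (hpos F hv) (mul_nonneg hT.le ?_)
      by_cases h : M.Frees S i F
      · simp [h, h.1]
      · rw [if_neg h, sub_zero]
        split_ifs <;> simp
  · intro u hu
    obtain ⟨T, a, rfl⟩ := exists_comb_of_mem_degOne hu
    exact ⟨fun v => vertexCoeff M S i T (M.normal K a) v.1,
      fun g => hexp T (M.isAff_sub_normal K a) (fun F hF => hK.normal_eq_zero a hF) g⟩
  · rintro d' rfl ⟨v, hv⟩ ⟨w, hw⟩ hne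
    cases v with
    | none =>
      cases w with
      | none => exact absurd rfl hne
      | some G =>
        right
        rw [mul_comm (vertexElt M x t S i _)]
        exact vertex_state_none H.rel t hK hi hiu hd hv hw
    | some F =>
      cases w with
      | none => exact Or.inr (vertex_state_none H.rel t hK hi hiu hd hw hv)
      | some G =>
        have hFG : F ≠ G := fun h => hne (by subst h; rfl)
        by_cases h : F ⊆ G ∨ G ⊆ F
        · exact Or.inr (vertex_state_pair H.rel t hK hi hiu hS hd hv hw hFG h)
        · rw [not_or] at h
          left
          intro g
          change lam (_ * (x F * (x G * g))) = 0
          rw [← mul_assoc (x F), H.rel.mul_eq_zero F G h.1 h.2, zero_mul, mul_zero, map_zero]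
  · rintro d' rfl v w
    by_cases h : M.freeRank S Finset.univ + 2 ≤ Fintype.card α
    · have key : ∀ F (hF : M.Ext K F),
          M.State x t (d' + 1) (flagProd x K * levelProd x t (M.freeRank S)
            * (x F * (t + upSum x (M.Frees S i)))) := fun F hF =>
        vertex_state_none H.rel t hK hi hiu (by lia) h hF
      have h1 : ∀ v : {v // VertexOk M K S v}, Relation.ReflTransGen
          (fun a b : {v // VertexOk M K S v} => M.State x t (d' + 1)
            (flagProd x K * levelProd x t (M.freeRank S)
            * (vertexElt M x t S i a.1 * vertexElt M x t S i b.1))) v ⟨none, h⟩ := by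
        rintro ⟨v, hv⟩
        cases v with
        | none => exact .refl
        | some F => exact .single (key F hv)
      have h2 : ∀ v : {v // VertexOk M K S v}, Relation.ReflTransGen
          (fun a b : {v // VertexOk M K S v} => M.State x t (d' + 1)
            (flagProd x K * levelProd x t (M.freeRank S)
            * (vertexElt M x t S i a.1 * vertexElt M x t S i b.1))) ⟨none, h⟩ v := by
        rintro ⟨v, hv⟩
        cases v with
        | none => exact .refl
        | some F =>
          refine .single ?_
          rw [mul_comm (vertexElt M x t S i _)]
          exact key F hv
      exact (h1 v).trans (h2 w)
    · obtain ⟨v, hv⟩ := v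
      obtain ⟨w, hw⟩ := w
      cases v with
      | none => exact absurd hv h
      | some F =>
        cases w with
        | none => exact absurd hw h
        | some G =>
          have step : ∀ F G (hF : M.Ext K F) (hG : M.Ext K G), (F ⊆ G ∨ G ⊆ F) →
              Relation.ReflTransGen (fun a b : {v // VertexOk M K S v} => M.State x t (d' + 1)
                (flagProd x K * levelProd x t (M.freeRank S)
                * (vertexElt M x t S i a.1 * vertexElt M x t S i b.1)))
              ⟨some F, hF⟩ ⟨some G, hG⟩ := by
            intro F G hF hG hc
            by_cases hFG : F = G
            · subst hFG; exact .refl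
            · exact .single (vertex_state_pair H.rel t hK hi hiu hS (by lia) hF hG hFG hc)
          obtain ⟨H₁, H₂, H₃, e1, e2, e3, c1, c2, c3, c4⟩ :=
            hK.ext_connected (by lia) (F := F) (G := G) hv hw
          exact (((step _ _ hv e1 c1).trans (step _ _ e1 e2 c2)).trans
            (step _ _ e2 e3 c3)).trans (step _ _ e3 hw c4)

theorem state_zero_pos (H : PosData M x t lam) {s : B} (hs : M.State x t 0 s) : 0 < lam s := by
  obtain ⟨K, S, hK, hS, hd, rfl⟩ := hs
  have := hK.card_le
  rw [H.lam_flag K _ hK (by lia) (by lia)]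
  exact one_pos

end

section

variable {A : Type*} [CommRing A] [Algebra ℝ A] {lam : A →ₗ[ℝ] ℝ}

/-- The Hodge–Riemann inequality may be checked on representatives of the neighbours. -/
theorem LocalExpansion.hodgeRiemann_of {W W' : Submodule ℝ A} {Amp : Set A}
    {St : ℕ → A → Prop} {d : ℕ} {s : A} {ι : Type*} [Fintype ι] {e : ι → A}
    (L : LocalExpansion lam W Amp St d s e)
    (h : ∀ v, ∃ u ∈ W', ∀ g, lam (s * (e v * g)) = lam (s * (u * g)))
    (hW' : HodgeRiemann lam W' s) : HodgeRiemann lam W s := by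
  have key : ∀ u ∈ W, ∃ u' ∈ W', ∀ g, lam (s * (u * g)) = lam (s * (u' * g)) := by
    intro u hu
    obtain ⟨c, hc⟩ := L.span u hu
    choose f hf hfg using h
    refine ⟨∑ v, c v • f v, W'.sum_mem fun v _ => W'.smul_mem _ (hf v), fun g => ?_⟩
    rw [hc, Finset.sum_mul, Finset.mul_sum, map_sum]
    refine Finset.sum_congr rfl fun v _ => ?_
    rw [hfg, smul_mul_assoc, mul_smul_comm, map_smul, smul_eq_mul]
  intro y hy z hz hpos
  obtain ⟨y', hy', ey⟩ := key y hy
  obtain ⟨z', hz', ez⟩ := key z hz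
  have e1 : lam (s * (y * y)) = lam (s * (y' * y')) := by rw [ey, mul_comm y', ey]
  have e2 : lam (s * (z * z)) = lam (s * (z' * z')) := by rw [ez, mul_comm z', ez]
  have e3 : lam (s * (y * z)) = lam (s * (y' * z')) := by
    rw [ey, mul_comm y', ez, mul_comm z']
  rw [e1, e2, e3]
  exact hW' y' hy' z' hz' (e2 ▸ hpos)

theorem hodgeRiemann_span_pair {s z w : A} (hz : lam (s * (z * z)) = 0) :
    HodgeRiemann lam (Submodule.span ℝ {z, w}) s := by
  intro y hy y' hy' _
  obtain ⟨a, b, rfl⟩ := Submodule.mem_span_pair.1 hy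
  obtain ⟨c, d, rfl⟩ := Submodule.mem_span_pair.1 hy'
  have e : ∀ a b c d : ℝ, lam (s * ((a • z + b • w) * (c • z + d • w)))
      = (a * d + b * c) * lam (s * (z * w)) + b * d * lam (s * (w * w)) := by
    intro a b c d
    have : s * ((a • z + b • w) * (c • z + d • w)) = (a * c) • (s * (z * z))
        + (a * d + b * c) • (s * (z * w)) + (b * d) • (s * (w * w)) := by
      simp only [Algebra.smul_def, map_mul, map_add]; ring
    rw [this, map_add, map_add, map_smul, map_smul, map_smul, hz]
    simp
  rw [e, e, e]
  nlinarith [sq_nonneg ((a * d - b * c) * lam (s * (z * w)))]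

end

namespace RankFn

variable {α : Type*} [DecidableEq α] [Fintype α] {M : RankFn α} {K : Finset (Finset α)}

theorem Ext.rank_ne (hK : M.Flag K) {F G : Finset α} (hF : M.Ext K F) (hG : G ∈ K) :
    M.r F ≠ M.r G := fun h => by
  have := (hF.flag hK).rank_injOn (by simp) (by simp [hG]) h
  exact hF.notMem (this ▸ hG)

theorem Ext.subset_of_rank_le (hK : M.Flag K) {F G : Finset α} (hF : M.Ext K F) (hG : G ∈ K)
    (h : M.r G ≤ M.r F) : G ⊆ F :=
  (hF.flag hK).subset_of_rank_le (Finset.mem_insert_of_mem hG) (Finset.mem_insert_self _ _) h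

theorem Ext.subset_of_le_rank (hK : M.Flag K) {F G : Finset α} (hF : M.Ext K F) (hG : G ∈ K)
    (h : M.r F ≤ M.r G) : F ⊆ G :=
  (hF.flag hK).subset_of_rank_le (Finset.mem_insert_self _ _) (Finset.mem_insert_of_mem hG) h

theorem Ext.rank_pos (hK : M.Flag K) {F : Finset α} (hF : M.Ext K F) : 0 < M.r F := by
  have := hF.rank_ne hK hK.bot
  rw [M.empty] at this
  lia

theorem Ext.rank_lt (hK : M.Flag K) {F : Finset α} (hF : M.Ext K F) :
    M.r F < M.r Finset.univ :=
  lt_of_le_of_ne (M.mono (Finset.subset_univ F)) (hF.rank_ne hK hK.top)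

theorem Ext.mem_of_rank (hK : M.Flag K) {F : Finset α} (hF : M.Ext K F)
    (hc : K.card = M.r Finset.univ) {p : ℕ} (hp : p ≤ M.r Finset.univ) (hpF : p ≠ M.r F) :
    ∃ G ∈ K, M.r G = p := by
  obtain ⟨G, hG, rfl⟩ := (hF.flag hK).exists_rank (by rw [hF.card, hc]) hp
  rcases Finset.mem_insert.1 hG with rfl | h
  · exact absurd rfl hpF
  · exact ⟨G, h, rfl⟩

theorem Flag.two_missing (hK : M.Flag K) (hc : K.card + 1 = M.r Finset.univ) :
    ∃ F G, M.Ext K F ∧ M.Ext K G ∧ M.r F < M.r G ∧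
      ∀ p ≤ M.r Finset.univ, p ≠ M.r F → p ≠ M.r G → ∃ H ∈ K, M.r H = p := by
  obtain ⟨F, hF⟩ := hK.exists_ext (by lia)
  obtain ⟨G, hG⟩ := (hF.flag hK).exists_ext (by rw [hF.card]; lia)
  have hGK : M.Ext K G := ⟨hG.flat, fun h => hG.notMem (Finset.mem_insert_of_mem h),
    fun H hH => hG.comp H (Finset.mem_insert_of_mem hH)⟩
  have hne := hG.rank_ne (hF.flag hK) (Finset.mem_insert_self _ _)
  have h : ∀ p ≤ M.r Finset.univ, p ≠ M.r F → p ≠ M.r G → ∃ H ∈ K, M.r H = p := by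
    intro p hp h1 h2
    obtain ⟨H, hH, rfl⟩ := hG.mem_of_rank (hF.flag hK) (by rw [hF.card, hc]) hp h2
    rcases Finset.mem_insert.1 hH with rfl | h
    · exact absurd rfl h1
    · exact ⟨H, h, rfl⟩
  rcases lt_or_gt_of_ne hne with h' | h'
  · exact ⟨G, F, hGK, hF, h', fun p hp h1 h2 => h p hp h2 h1⟩
  · exact ⟨F, G, hF, hGK, h', h⟩

end RankFn

section

variable {α : Type*} [DecidableEq α] [Fintype α] {B : Type*} [CommRing B] [Algebra ℝ B]
  {M : RankFn α} {x : Finset α → B} {t : B} {lam : B →ₗ[ℝ] ℝ}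

/-- In a gap of rank two all generators agree. -/
theorem flagProd_gap_two (H : ChowRel M x) {K : Finset (Finset α)} (hK : M.Flag K)
    {C D F G : Finset α} (hC : C ∈ K) (hD : D ∈ K) (hF : M.Ext K F) (hG : M.Ext K G)
    (hCF : M.r C + 1 = M.r F) (hFD : M.r F + 1 = M.r D) (hFG : M.r F = M.r G) :
    flagProd x K * x F = flagProd x K * x G := by
  classical
  by_cases hne : F = G
  · rw [hne]
  have hCf := hK.flat C hC
  have hCFs := hF.subset_of_rank_le hK hC (by lia)
  have hCGs := hG.subset_of_rank_le hK hC (by lia)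
  have hFDs := hF.subset_of_le_rank hK hD (by lia)
  have hGDs := hG.subset_of_le_rank hK hD (by lia)
  obtain ⟨j, hjF, hjC⟩ := Finset.exists_of_ssubset
    (RankFn.ssubset_of_rank_lt (M := M) hCFs (by lia))
  obtain ⟨j', hjG, hjC'⟩ := Finset.exists_of_ssubset
    (RankFn.ssubset_of_rank_lt (M := M) hCGs (by lia))
  have eF := hCf.eq_cl_insert hF.flat hCFs hCF.symm hjC hjF
  have eG := hCf.eq_cl_insert hG.flat hCGs (by lia) hjC' hjG
  have hgap : ∀ L ∈ K, L ⊆ C ∨ D ⊆ L := by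
    intro L hL
    by_cases h : M.r L ≤ M.r C
    · exact Or.inl (hK.subset_of_rank_le hL hC h)
    · have := hF.rank_ne hK hL
      exact Or.inr (hK.subset_of_rank_le hD hL (by lia))
  have key := flagProd_sum_aff H (K := K)
    (a := fun L => (if j ∈ L then (1 : ℝ) else 0) - if j' ∈ L then 1 else 0)
    (a' := fun L => (if j ∈ L then (1 : ℝ) else 0) - if j' ∈ L then 1 else 0)
    (by simpa using IsAff.const 0) (fun L hL => by
      rcases hgap L hL with h | h
      · have n1 : j ∉ L := fun h' => hjC (h h')
        have n2 : j' ∉ L := fun h' => hjC' (h h')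
        simp [n1, n2]
      · simp [h (hFDs hjF), h (hGDs hjG)])
  rw [H.sum_aff _ ((IsAff.mem j).sub (IsAff.mem j')), mul_zero] at key
  have h2 : ∀ L, (if M.Ext K L then ((if j ∈ L then (1 : ℝ) else 0) - if j' ∈ L then 1 else 0)
      • (flagProd x K * x L) else 0) = (if L = F then flagProd x K * x L else 0)
      - if L = G then flagProd x K * x L else 0 := by
    intro L
    by_cases hL : M.Ext K L
    · rw [if_pos hL]
      by_cases hLr : M.r L = M.r F
      · have hCL := hL.subset_of_rank_le hK hC (by lia)
        have f1 : j ∈ L ↔ L = F := ⟨fun h => by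
          rw [eF]; exact hCf.eq_cl_insert hL.flat hCL (by lia) hjC h, fun h => h ▸ hjF⟩
        have f2 : j' ∈ L ↔ L = G := ⟨fun h => by
          rw [eG]; exact hCf.eq_cl_insert hL.flat hCL (by lia) hjC' h, fun h => h ▸ hjG⟩
        simp only [f1, f2, sub_smul, ite_smul, one_smul, zero_smul]
      · have n1 : L ≠ F := fun h => hLr (by rw [h])
        have n2 : L ≠ G := fun h => hLr (by rw [h, hFG])
        rw [if_neg n1, if_neg n2, sub_zero]
        by_cases hlt : M.r L < M.r F
        · have hLC := hL.subset_of_le_rank hK hC (by lia)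
          rw [if_neg fun h => hjC (hLC h), if_neg fun h => hjC' (hLC h), sub_zero, zero_smul]
        · have := hL.rank_ne hK hD
          have hDL := hL.subset_of_rank_le hK hD (by lia)
          rw [if_pos (hDL (hFDs hjF)), if_pos (hDL (hGDs hjG)), sub_self, zero_smul]
    · have n1 : L ≠ F := fun h => hL (h ▸ hF)
      have n2 : L ≠ G := fun h => hL (h ▸ hG)
      rw [if_neg hL, if_neg n1, if_neg n2, sub_zero]
  rw [Finset.sum_congr rfl fun L _ => h2 L, Finset.sum_sub_distrib] at key
  simp only [Finset.sum_ite_eq', Finset.mem_univ, if_true] at key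
  exact (sub_eq_zero.1 key.symm)

theorem flagProd_gap_two_sq (H : ChowRel M x) {K : Finset (Finset α)} (hK : M.Flag K)
    {C D F : Finset α} (hC : C ∈ K) (hD : D ∈ K) (hF : M.Ext K F)
    (hCF : M.r C + 1 = M.r F) (hFD : M.r F + 1 = M.r D) :
    flagProd x K * (x F * x F) = 0 := by
  have hCFs := hF.subset_of_rank_le hK hC (by lia)
  have hFDs := hF.subset_of_le_rank hK hD (by lia)
  obtain ⟨j, hjD, hjF⟩ := Finset.exists_of_ssubset
    (RankFn.ssubset_of_rank_lt (M := M) hFDs (by lia))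
  have hjC : j ∉ C := fun h => hjF (hCFs h)
  have hCf := hK.flat C hC
  have hr : M.r (M.cl (insert j C)) = M.r F := by rw [RankFn.rank_cl_insert hCf hjC, hCF]
  have hG : M.Ext K (M.cl (insert j C)) := by
    refine RankFn.ext_of_gap (A := C) (B := D) (RankFn.isFlat_cl _)
      (RankFn.ssubset_cl_insert hjC) ?_ fun L hL => ?_
    · exact RankFn.ssubset_of_rank_lt (M := M) ((hK.flat D hD).cl_subset
        (Finset.insert_subset hjD (hCFs.trans hFDs))) (by lia)
    · by_cases h : M.r L ≤ M.r C
      · exact Or.inl (hK.subset_of_rank_le hL hC h)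
      · have := hF.rank_ne hK hL
        exact Or.inr (hK.subset_of_rank_le hD hL (by lia))
  have hjG := RankFn.mem_cl_insert (M := M) C j
  have hne : ¬ M.cl (insert j C) ⊆ F := fun h => hjF (h hjG)
  have hne' : ¬ F ⊆ M.cl (insert j C) := fun h =>
    hne (hF.flat.subset_of_rank_le h hr.le)
  rw [← mul_assoc, flagProd_gap_two H hK hC hD hF hG hCF hFD hr.symm, mul_assoc,
    H.mul_eq_zero _ _ hne hne', mul_zero]

end

section

variable {α : Type*} [DecidableEq α] [Fintype α] {B : Type*} [CommRing B] [Algebra ℝ B]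
  {M : RankFn α} {x : Finset α → B} {t : B} {lam : B →ₗ[ℝ] ℝ}

/-- A gap of rank three in a chain. -/
structure GapThree (M : RankFn α) (K : Finset (Finset α)) (C D : Finset α) : Prop where
  flag : M.Flag K
  left : C ∈ K
  right : D ∈ K
  rank : M.r D = M.r C + 3
  gap : ∀ G ∈ K, G ⊆ C ∨ D ⊆ G
  ext : ∀ F, M.Ext K F → C ⊆ F ∧ F ⊆ D ∧ (M.r F = M.r C + 1 ∨ M.r F = M.r C + 2)

open Classical in
/-- The class of a gap, up to sign the sum of the generators of the flats above it. -/
noncomputable def gapClass (x : Finset α → B) (K : Finset (Finset α)) (D : Finset α) : B :=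
  -∑ G ∈ K with D ⊆ G, x G

variable {K : Finset (Finset α)} {C D : Finset α}

open Classical in
theorem GapThree.mul_gapClass (h : GapThree M K C D) (H : ChowRel M x) {j : α} (hjD : j ∈ D)
    (hjC : j ∉ C) : flagProd x K * gapClass x K D
      = ∑ F with M.Ext K F ∧ j ∈ F, flagProd x K * x F := by
  have h1 := H.sum_mem j
  rw [← Finset.sum_filter] at h1
  have h2 : ∑ F with j ∈ F, x F = (∑ G ∈ K with D ⊆ G, x G)
      + ∑ F with F ∉ K ∧ j ∈ F, x F := by
    rw [← Finset.sum_filter_add_sum_filter_not _ (· ∈ K)]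
    congr 1
    · refine Finset.sum_congr ?_ fun _ _ => rfl
      ext F
      simp only [Finset.mem_filter, Finset.mem_univ, true_and]
      constructor
      · rintro ⟨h1, h2⟩
        exact ⟨h2, (h.gap F h2).resolve_left fun h3 => hjC (h3 h1)⟩
      · rintro ⟨h1, h2⟩
        exact ⟨h2 hjD, h1⟩
    · refine Finset.sum_congr ?_ fun _ _ => rfl
      ext F
      simp only [Finset.mem_filter, Finset.mem_univ, true_and]
      tauto
  have h3 : gapClass x K D = ∑ F with F ∉ K ∧ j ∈ F, x F := by
    unfold gapClass
    rw [neg_eq_iff_add_eq_zero, ← h2, ← h1]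
  rw [h3, Finset.mul_sum, ← Finset.sum_filter_add_sum_filter_not _ (M.Ext K)]
  rw [Finset.sum_eq_zero (s := Finset.filter (fun F => ¬ M.Ext K F) _), add_zero]
  · refine Finset.sum_congr ?_ fun _ _ => rfl
    ext F
    simp only [Finset.mem_filter, Finset.mem_univ, true_and]
    constructor
    · rintro ⟨h1, h2⟩; exact ⟨h2, h1.2⟩
    · rintro ⟨h1, h2⟩; exact ⟨⟨h1.notMem, h2⟩, h1⟩
  · intro F hF
    simp only [Finset.mem_filter, Finset.mem_univ, true_and] at hF
    exact flagProd_mul_eq_zero H hF.1.1 hF.2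

theorem GapThree.gapClass_mul_line (h : GapThree M K C D) (H : ChowRel M x) {L : Finset α}
    (hL : M.Ext K L) (hr : M.r L = M.r C + 2) :
    flagProd x K * (gapClass x K D * x L) = 0 := by
  classical
  obtain ⟨hCL, hLD, _⟩ := h.ext L hL
  have hrk := h.rank
  obtain ⟨j, hjD, hjL⟩ := Finset.exists_of_ssubset
    (RankFn.ssubset_of_rank_lt (M := M) hLD (by lia))
  rw [← mul_assoc, h.mul_gapClass H hjD (fun h' => hjL (hCL h')), Finset.sum_mul]
  refine Finset.sum_eq_zero fun F hF => ?_
  simp only [Finset.mem_filter, Finset.mem_univ, true_and] at hF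
  have n1 : ¬ F ⊆ L := fun h' => hjL (h' hF.2)
  rw [mul_assoc, H.mul_eq_zero F L n1 fun h' => n1 (hL.flat.subset_of_rank_le h' ?_), mul_zero]
  rcases (h.ext F hF.1).2.2 with h' | h' <;> lia

theorem GapThree.point_eq (h : GapThree M K C D) {F : Finset α} (hF : M.Ext K F)
    (hr : M.r F = M.r C + 1) {j : α} (hjF : j ∈ F) (hjC : j ∉ C) : F = M.cl (insert j C) :=
  (h.flag.flat C h.left).eq_cl_insert hF.flat (h.ext F hF).1 hr hjC hjF

open Classical in
theorem GapThree.mul_point (h : GapThree M K C D) (H : ChowRel M x) {F : Finset α}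
    (hF : M.Ext K F) (hr : M.r F = M.r C + 1) :
    ∃ j, flagProd x K * x F = flagProd x K * (gapClass x K D
      - ∑ L with M.Ext K L ∧ M.r L = M.r C + 2 ∧ j ∈ L, x L) := by
  obtain ⟨hCF, hFD, _⟩ := h.ext F hF
  obtain ⟨j, hjF, hjC⟩ := Finset.exists_of_ssubset
    (RankFn.ssubset_of_rank_lt (M := M) hCF (by lia))
  refine ⟨j, ?_⟩
  rw [mul_sub, h.mul_gapClass H (hFD hjF) hjC, Finset.mul_sum,
    ← Finset.sum_filter_add_sum_filter_not _ (fun L => M.r L = M.r C + 2), eq_sub_iff_add_eq,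
    add_comm]
  congr 1
  · refine Finset.sum_congr ?_ fun _ _ => rfl
    ext L
    simp only [Finset.mem_filter, Finset.mem_univ, true_and]
    tauto
  · rw [Finset.sum_eq_single_of_mem F]
    · simp only [Finset.mem_filter, Finset.mem_univ, true_and]
      exact ⟨⟨hF, hjF⟩, by lia⟩
    · intro G hG hne
      simp only [Finset.mem_filter, Finset.mem_univ, true_and] at hG
      refine absurd ?_ hne
      rw [h.point_eq hF hr hjF hjC]
      exact h.point_eq hG.1.1 ((h.ext G hG.1.1).2.2.resolve_right hG.2) hG.1.2 hjC

theorem GapThree.line_sq (h : GapThree M K C D) (H : ChowRel M x) {L : Finset α}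
    (hL : M.Ext K L) (hr : M.r L = M.r C + 2) :
    ∃ F, M.Ext K F ∧ F ≠ L ∧ F ⊆ L ∧
      flagProd x K * (x L * x L) = -(flagProd x K * (x F * x L)) := by
  classical
  obtain ⟨hCL, hLD, _⟩ := h.ext L hL
  have hrk := h.rank
  have hCf := h.flag.flat C h.left
  obtain ⟨j, hjL, hjC⟩ := Finset.exists_of_ssubset
    (RankFn.ssubset_of_rank_lt (M := M) hCL (by lia))
  have hFr := RankFn.rank_cl_insert hCf hjC
  have hFL : M.cl (insert j C) ⊆ L := hL.flat.cl_subset (Finset.insert_subset hjL hCL)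
  have hF : M.Ext K (M.cl (insert j C)) := RankFn.ext_of_gap (RankFn.isFlat_cl _)
    (RankFn.ssubset_cl_insert hjC)
    (RankFn.ssubset_of_rank_lt (M := M) (hFL.trans hLD) (by lia)) h.gap
  have hjF := RankFn.mem_cl_insert (M := M) C j
  have hne : M.cl (insert j C) ≠ L := fun h' => by rw [h'] at hFr; lia
  refine ⟨_, hF, hne, hFL, ?_⟩
  have h1 := h.gapClass_mul_line H hL hr
  rw [← mul_assoc, h.mul_gapClass H (hLD hjL) hjC, Finset.sum_mul] at h1
  rw [Finset.sum_eq_add_of_mem (M.cl (insert j C)) L (by simp [hF, hjF]) (by simp [hL, hjL]) hne]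
    at h1
  · linear_combination h1
  · rintro G hG ⟨hGF, hGL⟩
    simp only [Finset.mem_filter, Finset.mem_univ, true_and] at hG
    rcases (h.ext G hG.1).2.2 with h2 | h2
    · exact absurd (h.point_eq hG.1 h2 hG.2 hjC) hGF
    · rw [mul_assoc, H.mul_eq_zero G L (fun h' => hGL (hG.1.flat.eq_of_rank_le h' (by lia)))
        (fun h' => hGL (hL.flat.eq_of_rank_le h' (by lia)).symm), mul_zero]

theorem hodgeRiemann_gapThree (H : PosData M x t lam) (h : GapThree M K C D) {Q : B}
    (hpos : ∀ F L, M.Ext K F → M.Ext K L → F ≠ L → F ⊆ L →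
      0 ≤ lam (flagProd x K * Q * (x F * x L))) :
    HodgeRiemann lam (Submodule.span ℝ (insert (gapClass x K D)
      (x '' {L | M.Ext K L ∧ M.r L = M.r C + 2}))) (flagProd x K * Q) := by
  classical
  set a := gapClass x K D
  have ha : ∀ z ∈ Submodule.span ℝ (x '' {L | M.Ext K L ∧ M.r L = M.r C + 2}),
      flagProd x K * (a * z) = 0 := by
    intro z hz
    induction hz using Submodule.span_induction with
    | mem z hz =>
      obtain ⟨L, ⟨hL, hr⟩, rfl⟩ := hz
      exact h.gapClass_mul_line H.rel hL hr
    | zero => simp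
    | add y z _ _ hy hz => rw [mul_add, mul_add, hy, hz, add_zero]
    | smul c y _ hy => rw [mul_smul_comm, mul_smul_comm, hy, smul_zero]
  refine hodgeRiemann_of_nonpos_orthogonal (l := a) fun u hu hau => ?_
  obtain ⟨ζ, z, hz, rfl⟩ := Submodule.mem_span_insert.1 hu
  have e1 : flagProd x K * Q * (a * (ζ • a + z)) = ζ • (flagProd x K * Q * (a * a)) := by
    have := ha z hz
    simp only [Algebra.smul_def]
    linear_combination Q * this
  have e2 : flagProd x K * Q * ((ζ • a + z) * (ζ • a + z))
      = ζ • ζ • (flagProd x K * Q * (a * a)) + flagProd x K * Q * (z * z) := by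
    have := ha z hz
    simp only [Algebra.smul_def]
    linear_combination 2 * Q * algebraMap ℝ B ζ * this
  rw [e1] at hau
  rw [e2, map_add, map_smul, hau, smul_zero, zero_add]
  rw [show {L | M.Ext K L ∧ M.r L = M.r C + 2}
    = ((Finset.univ.filter fun L => M.Ext K L ∧ M.r L = M.r C + 2 : Finset (Finset α)) : Set _) by
      ext; simp] at hz
  obtain ⟨c, rfl⟩ := (Submodule.mem_span_image_finset_iff_exists_fun ℝ).1 hz
  rw [Finset.sum_mul_sum, Finset.mul_sum, map_sum]
  refine Finset.sum_nonpos fun L _ => ?_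
  obtain ⟨L, hLm⟩ := L
  have hL := (Finset.mem_filter.1 hLm).2
  rw [Finset.mul_sum, map_sum, Finset.sum_eq_single_of_mem _ (Finset.mem_univ _)]
  · obtain ⟨F, hF, hne, hFL, he⟩ := h.line_sq H.rel hL.1 hL.2
    have : flagProd x K * Q * (c ⟨L, hLm⟩ • x L * c ⟨L, hLm⟩ • x L)
        = -((c ⟨L, hLm⟩ * c ⟨L, hLm⟩) • (flagProd x K * Q * (x F * x L))) := by
      simp only [Algebra.smul_def, map_mul]
      linear_combination Q * algebraMap ℝ B (c ⟨L, hLm⟩) * algebraMap ℝ B (c ⟨L, hLm⟩) * he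
    rw [this, map_neg, map_smul, smul_eq_mul, neg_nonpos]
    exact mul_nonneg (mul_self_nonneg _) (hpos F L hF hL.1 hne hFL)
  · rintro ⟨L', hL'⟩ _ hne
    have hL' := (Finset.mem_filter.1 hL').2
    have hne : L' ≠ L := fun h' => hne (by subst h'; rfl)
    rw [smul_mul_smul_comm, H.rel.mul_eq_zero L L'
      (fun h' => hne (hL.1.flat.eq_of_rank_le h' (by lia)).symm)
      (fun h' => hne (hL'.1.flat.eq_of_rank_le h' (by lia))), smul_zero, mul_zero, map_zero]

theorem state_two_hodgeRiemann (H : PosData M x t lam) {s : B} (hs : M.State x t 2 s) :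
    HodgeRiemann lam (degOne x t) s := by
  classical
  obtain ⟨K, S, i, hK, hi, hiu, hS, hd, rfl, _, _, L⟩ := local_expansion H (d := 1) hs
  have hcard := hK.card_le
  by_cases hm : M.freeRank S Finset.univ + 2 ≤ Fintype.card α
  · -- the free vertex is available
    by_cases hE : ∃ F, M.Ext K F
    · obtain ⟨F, hF⟩ := hE
      have hc1 : K.card + 1 ≤ M.r Finset.univ + 1 := by
        rw [← hF.card]; exact (hF.flag hK).card_le
      have hc : K.card = M.r Finset.univ := by
        by_contra hc
        obtain ⟨G, hG⟩ := (hF.flag hK).exists_ext (by rw [hF.card]; lia)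
        lia
      have hlt := hF.rank_lt hK
      have hpos := hF.rank_pos hK
      obtain ⟨C, hC, hCr⟩ := hF.mem_of_rank hK hc (p := M.r F - 1) (by lia) (by lia)
      obtain ⟨D, hD, hDr⟩ := hF.mem_of_rank hK hc (p := M.r F + 1) (by lia) (by lia)
      refine L.hodgeRiemann_of (W' := Submodule.span ℝ {x F, t + upSum x (M.Frees S i)}) ?_
        (hodgeRiemann_span_pair ?_)
      · rintro ⟨v, hv⟩
        cases v with
        | none => exact ⟨_, Submodule.subset_span (by simp [vertexElt]), fun g => rfl⟩
        | some G =>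
          refine ⟨x F, Submodule.subset_span (by simp), fun g => ?_⟩
          have hG : M.Ext K G := hv
          have hFG : M.r F = M.r G := by
            by_contra hne
            obtain ⟨G', hG', hr⟩ := hF.mem_of_rank hK hc (p := M.r G) (hG.rank_lt hK).le
              (fun h => hne h.symm)
            exact hG.rank_ne hK hG' hr.symm
          have := flagProd_gap_two H.rel hK hC hD hF hG (by lia) (by lia) hFG
          congr 1
          change _ * (x G * g) = _
          linear_combination -levelProd x t (M.freeRank S) * g * this
      · rw [show flagProd x K * levelProd x t (M.freeRank S) * (x F * x F)
          = flagProd x K * (x F * x F) * levelProd x t (M.freeRank S) by ring,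
          flagProd_gap_two_sq H.rel hK hC hD hF (by lia) (by lia), zero_mul, map_zero]
    · refine L.hodgeRiemann_of (W' := Submodule.span ℝ {0, t + upSum x (M.Frees S i)}) ?_
        (hodgeRiemann_span_pair (by simp))
      rintro ⟨v, hv⟩
      cases v with
      | none => exact ⟨_, Submodule.subset_span (by simp [vertexElt]), fun g => rfl⟩
      | some F => exact absurd ⟨F, hv⟩ hE
  · obtain ⟨F, G, hF, hG, hFG, hother⟩ := hK.two_missing (by lia)
    have hmiss : ∀ E, M.Ext K E → M.r E = M.r F ∨ M.r E = M.r G := by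
      intro E hE
      by_contra! hc
      obtain ⟨E', hE', hr⟩ := hother _ (hE.rank_lt hK).le hc.1 hc.2
      exact hE.rank_ne hK hE' hr.symm
    have hGlt := hG.rank_lt hK
    have hFpos := hF.rank_pos hK
    obtain ⟨C, hC, hCr⟩ := hother (M.r F - 1) (by lia) (by lia) (by lia)
    obtain ⟨D, hD, hDr⟩ := hother (M.r G + 1) (by lia) (by lia) (by lia)
    by_cases hadj : M.r G = M.r F + 1
    · have hgap : GapThree M K C D := by
        refine ⟨hK, hC, hD, by lia, fun E hE => ?_, fun E hE => ?_⟩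
        · have h1 := hF.rank_ne hK hE
          have h2 := hG.rank_ne hK hE
          by_cases h : M.r E ≤ M.r C
          · exact Or.inl (hK.subset_of_rank_le hE hC h)
          · exact Or.inr (hK.subset_of_rank_le hD hE (by lia))
        · have h1 := hmiss E hE
          exact ⟨hE.subset_of_rank_le hK hC (by lia), hE.subset_of_le_rank hK hD (by lia),
            by lia⟩
      refine L.hodgeRiemann_of ?_ (hodgeRiemann_gapThree H hgap fun F' L' hF' hL' hne hsub => ?_)
      · rintro ⟨v, hv⟩
        cases v with
        | none => exact absurd hv hm
        | some E =>
          have hE : M.Ext K E := hv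
          rcases (hgap.ext E hE).2.2 with hr | hr
          · obtain ⟨j, hj⟩ := hgap.mul_point H.rel hE hr
            refine ⟨_, Submodule.sub_mem _ (Submodule.subset_span (Set.mem_insert _ _))
              (Submodule.sum_mem (t := Finset.univ.filter fun L => M.Ext K L ∧
                M.r L = M.r C + 2 ∧ j ∈ L) (f := x) _ fun L hL => ?_), fun g => ?_⟩
            · simp only [Finset.mem_filter, Finset.mem_univ, true_and] at hL
              exact Submodule.subset_span (Set.mem_insert_of_mem _ ⟨L, ⟨hL.1, hL.2.1⟩, rfl⟩)
            · congr 1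
              change _ * (x E * g) = _
              linear_combination levelProd x t (M.freeRank S) * g * hj
          · exact ⟨x E, Submodule.subset_span (Set.mem_insert_of_mem _ ⟨E, ⟨hE, hr⟩, rfl⟩),
              fun g => rfl⟩
      · exact (state_zero_pos H (vertex_state_pair H.rel t hK hi hiu hS (d := 0) (by lia)
          hF' hL' hne (Or.inl hsub))).le
    · obtain ⟨C', hC', hCr'⟩ := hother (M.r F + 1) (by lia) (by lia) (by lia)
      obtain ⟨D', hD', hDr'⟩ := hother (M.r G - 1) (by lia) (by lia) (by lia)
      refine L.hodgeRiemann_of (W' := Submodule.span ℝ {x F, x G}) ?_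
        (hodgeRiemann_span_pair ?_)
      · rintro ⟨v, hv⟩
        cases v with
        | none => exact absurd hv hm
        | some E =>
          have hE : M.Ext K E := hv
          rcases hmiss E hE with hr | hr
          · refine ⟨x F, Submodule.subset_span (by simp), fun g => ?_⟩
            have := flagProd_gap_two H.rel hK hC hC' hF hE (by lia) (by lia) hr.symm
            congr 1
            change _ * (x E * g) = _
            linear_combination -levelProd x t (M.freeRank S) * g * this
          · refine ⟨x G, Submodule.subset_span (by simp), fun g => ?_⟩
            have := flagProd_gap_two H.rel hK hD' hD hG hE (by lia) (by lia) hr.symm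
            congr 1
            change _ * (x E * g) = _
            linear_combination -levelProd x t (M.freeRank S) * g * this
      · rw [show flagProd x K * levelProd x t (M.freeRank S) * (x F * x F)
          = flagProd x K * (x F * x F) * levelProd x t (M.freeRank S) by ring,
          flagProd_gap_two_sq H.rel hK hC hC' hF (by lia) (by lia), zero_mul, map_zero]

theorem lorentzSystem.{u, v} {α : Type u} [DecidableEq α] [Fintype α] {B : Type v} [CommRing B]
    [Algebra ℝ B] {M : RankFn α} {x : Finset α → B} {t : B} {lam : B →ₗ[ℝ] ℝ}
    (H : PosData M x t lam) : LorentzSystem.{v, u} lam (degOne x t) (ampCone M x t) (M.State x t) where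
  amp_mem := by
    rintro l ⟨T, a, _, _, rfl⟩
    exact comb_mem_degOne x t T a
  pos _ := state_zero_pos H
  step d s hs := by
    obtain ⟨K, S, i, _, _, _, _, _, _, _, hne, L⟩ := local_expansion H hs
    exact ⟨_, _, hne, _, L⟩
  base _ := state_two_hodgeRiemann H

end

section

variable {A : Type*} [CommRing A] [Algebra ℝ A] {lam : A →ₗ[ℝ] ℝ}

theorem continuous_lam_eval (lam : A →ₗ[ℝ] ℝ) (P : A[X]) :
    Continuous fun c : ℝ => lam (P.eval (algebraMap ℝ A c)) := by
  have h : ∀ c : ℝ, lam (P.eval (algebraMap ℝ A c))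
      = ∑ i ∈ Finset.range (P.natDegree + 1), c ^ i * lam (P.coeff i) := by
    intro c
    rw [eval_eq_sum_range, map_sum]
    refine Finset.sum_congr rfl fun i _ => ?_
    rw [← map_pow, mul_comm, ← Algebra.smul_def, map_smul, smul_eq_mul]
  simp only [h]
  fun_prop

/-- Mixed degrees vary continuously with the factors. -/
theorem tendsto_lam_pow_mul_pow (lam : A →ₗ[ℝ] ℝ) (s a b u v : A) (k l : ℕ) :
    Filter.Tendsto (fun c : ℝ => lam (s * ((a + c • u) ^ k * (b + c • v) ^ l)))
      (nhdsWithin 0 (Set.Ioi 0)) (nhds (lam (s * (a ^ k * b ^ l)))) := by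
  have h := (continuous_lam_eval lam
    (C s * ((C a + X * C u) ^ k * (C b + X * C v) ^ l))).tendsto 0
  simp only [eval_mul, eval_pow, eval_add, eval_C, eval_X, ← Algebra.smul_def, zero_smul,
    add_zero] at h
  exact h.mono_left nhdsWithin_le_nhds

variable {W : Submodule ℝ A} {Amp : Set A} {St : ℕ → A → Prop}

theorem LorentzSystem.mixed_pos (H : LorentzSystem lam W Amp St) {a b s : A} (ha : a ∈ Amp)
    (hb : b ∈ Amp) {k l : ℕ} (hs : St (k + l) s) : 0 < lam (s * (a ^ k * b ^ l)) := by
  have h := H.prod_pos (List.replicate k a ++ List.replicate l b) (by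
    intro x hx
    rcases List.mem_append.1 hx with h | h
    · exact List.eq_of_mem_replicate h ▸ ha
    · exact List.eq_of_mem_replicate h ▸ hb) s (by simpa using hs)
  simpa using h

theorem LorentzSystem.mixed_logConcave (H : LorentzSystem lam W Amp St) {a b s : A}
    (ha : a ∈ Amp) (hb : b ∈ Amp) {k l : ℕ} (hs : St (k + l + 2) s) :
    lam (s * (a ^ (k + 2) * b ^ l)) * lam (s * (a ^ k * b ^ (l + 2)))
      ≤ lam (s * (a ^ (k + 1) * b ^ (l + 1))) ^ 2 := by
  have h := H.hodgeRiemann (List.replicate k a ++ List.replicate l b) (by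
    intro x hx
    rcases List.mem_append.1 hx with h | h
    · exact List.eq_of_mem_replicate h ▸ ha
    · exact List.eq_of_mem_replicate h ▸ hb) s (by simpa using hs) a (H.amp_mem ha) b
      (H.amp_mem hb)
  simp only [List.prod_append, List.prod_replicate] at h
  rw [show s * (a ^ k * b ^ l) * (a * a) = s * (a ^ (k + 2) * b ^ l) by ring,
    show s * (a ^ k * b ^ l) * (b * b) = s * (a ^ k * b ^ (l + 2)) by ring,
    show s * (a ^ k * b ^ l) * (a * b) = s * (a ^ (k + 1) * b ^ (l + 1)) by ring] at h
  exact h (H.mixed_pos ha hb hs)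

theorem LorentzSystem.limit_nonneg (H : LorentzSystem lam W Amp St) {a b u v s : A}
    (ha : ∀ c : ℝ, 0 < c → a + c • u ∈ Amp) (hb : ∀ c : ℝ, 0 < c → b + c • v ∈ Amp) {k l : ℕ}
    (hs : St (k + l) s) : 0 ≤ lam (s * (a ^ k * b ^ l)) :=
  ge_of_tendsto (tendsto_lam_pow_mul_pow lam s a b u v k l)
    (eventually_nhdsWithin_of_forall fun c hc => (H.mixed_pos (ha c hc) (hb c hc) hs).le)

theorem LorentzSystem.limit_logConcave (H : LorentzSystem lam W Amp St) {a b u v s : A}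
    (ha : ∀ c : ℝ, 0 < c → a + c • u ∈ Amp) (hb : ∀ c : ℝ, 0 < c → b + c • v ∈ Amp) {k l : ℕ}
    (hs : St (k + l + 2) s) :
    lam (s * (a ^ (k + 2) * b ^ l)) * lam (s * (a ^ k * b ^ (l + 2)))
      ≤ lam (s * (a ^ (k + 1) * b ^ (l + 1))) ^ 2 :=
  le_of_tendsto_of_tendsto
    ((tendsto_lam_pow_mul_pow lam s a b u v _ _).mul (tendsto_lam_pow_mul_pow lam s a b u v _ _))
    ((tendsto_lam_pow_mul_pow lam s a b u v _ _).pow 2)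
    (eventually_nhdsWithin_of_forall fun c hc => H.mixed_logConcave (ha c hc) (hb c hc) hs)

end

section

variable {α : Type*} [DecidableEq α] [Fintype α] {M : RankFn α}

theorem RankFn.Flag.exists_notMem {K : Finset (Finset α)} (hK : M.Flag K) [Nonempty α] :
    ∃ j, ∀ F ∈ K, F ≠ Finset.univ → j ∉ F := by
  obtain ⟨P, hP, hmax⟩ := Finset.exists_max_image (K.erase Finset.univ) Finset.card
    ⟨∅, by simp [hK.bot, Finset.univ_nonempty.ne_empty.symm]⟩
  rw [Finset.mem_erase] at hP
  obtain ⟨j, -, hj⟩ := Finset.exists_of_ssubset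
    (Finset.ssubset_univ_iff.2 hP.1)
  refine ⟨j, fun F hF hFu hjF => ?_⟩
  have h := hmax F (Finset.mem_erase.2 ⟨hFu, hF⟩)
  rcases hK.chain F hF P hP.2 with h1 | h1
  · exact hj (h1 hjF)
  · exact hj ((Finset.eq_of_subset_of_card_le h1 h).symm ▸ hjF)

/-- The classes nef along the top flat together with a strictly submodular function are ample. -/
theorem RankFn.ampleOn_add (M : RankFn α) [Nonempty α] {x y : ℝ} (hx : 0 ≤ x) (hy : 0 < y) :
    M.AmpleOn fun F => x * (if F = Finset.univ then -1 else 0)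
      + y * ∑ i, ∑ j, if i ∈ F ∧ j ∈ F then -1 else 0 := by
  classical
  intro K hK
  obtain ⟨j₀, hj₀⟩ := hK.exists_notMem
  let last (i j : α) : α := if ∀ F ∈ K, j ∈ F → i ∈ F then j else i
  let p (F : Finset α) : ℝ := (if F = Finset.univ then -1 else 0) + if j₀ ∈ F then 1 else 0
  let q (F : Finset α) (i j : α) : ℝ :=
    (if i ∈ F ∧ j ∈ F then -1 else 0) + if last i j ∈ F then 1 else 0
  have hp : ∀ F, 0 ≤ p F := by
    intro F
    simp only [p]
    by_cases h : F = Finset.univ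
    · simp [h]
    · rw [if_neg h]; split_ifs <;> norm_num
  have hq : ∀ F i j, 0 ≤ q F i j := by
    intro F i j
    simp only [q]
    by_cases h : i ∈ F ∧ j ∈ F
    · have : last i j ∈ F := by
        simp only [last]
        split_ifs
        exacts [h.2, h.1]
      rw [if_pos h, if_pos this]; norm_num
    · rw [if_neg h]; split_ifs <;> norm_num
  refine ⟨fun F => x * p F + y * ∑ i, ∑ j, q F i j, ?_, fun F hF => ?_, fun F hF => ?_⟩
  · have h1 : IsAff fun F => -x * (if j₀ ∈ F then 1 else 0)
        + -y * ∑ i, ∑ j, if last i j ∈ F then 1 else 0 :=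
      ((IsAff.mem j₀).mul_const (-x)).add
        ((IsAff.sum _ fun i _ => IsAff.sum _ fun j _ => IsAff.mem (last i j)).mul_const (-y))
    convert h1 using 2
    simp only [p, q, Finset.sum_add_distrib]
    ring
  · have hp0 : p F = 0 := by
      simp only [p]
      by_cases h : F = Finset.univ
      · simp [h]
      · rw [if_neg h, if_neg (hj₀ F hF h), add_zero]
    have hq0 : ∀ i j, q F i j = 0 := by
      intro i j
      by_cases h : ∀ F ∈ K, j ∈ F → i ∈ F
      · have hl : last i j = j := if_pos h
        simp only [q, hl]
        by_cases hj : j ∈ F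
        · simp [hj, h F hF hj]
        · simp [hj]
      · have hl : last i j = i := if_neg h
        simp only [q, hl]
        push Not at h
        obtain ⟨G, hG, hjG, hiG⟩ := h
        by_cases hi : i ∈ F
        · have : j ∈ F := by
            rcases hK.chain F hF G hG with h1 | h1
            · exact absurd (h1 hi) hiG
            · exact h1 hjG
          simp [hi, this]
        · simp [hi]
    simp [hp0, hq0]
  · obtain ⟨P, hP, Q, hQ, hPF, hFQ, hgap⟩ := hK.exists_gap hF
    obtain ⟨j, hjF, hjP⟩ := Finset.exists_of_ssubset hPF
    obtain ⟨i, hiQ, hiF⟩ := Finset.exists_of_ssubset hFQ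
    have hlast : last i j = j := if_pos fun G hG hjG => by
      rcases hgap G hG with h | h
      · exact absurd (h hjG) hjP
      · exact h hiQ
    have h1 : 0 < q F i j := by
      simp [q, hlast, hjF, hiF]
    have h2 : 0 < ∑ i, ∑ j, q F i j :=
      Finset.sum_pos' (fun i _ => Finset.sum_nonneg fun j _ => hq F i j)
        ⟨i, Finset.mem_univ _, Finset.sum_pos' (fun j _ => hq F i j) ⟨j, Finset.mem_univ _, h1⟩⟩
    exact add_pos_of_nonneg_of_pos (mul_nonneg hx (hp F)) (mul_pos hy h2)

variable {B : Type*} [CommRing B] [Algebra ℝ B] {x : Finset α → B} {t : B} {lam : B →ₗ[ℝ] ℝ}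

/-- A degree one class that is strictly positive together with any positive multiple of `t`. -/
noncomputable def convexClass (x : Finset α → B) : B :=
  ∑ F : Finset α, (∑ i, ∑ j, if i ∈ F ∧ j ∈ F then (-1 : ℝ) else 0) • x F

theorem mem_ampCone_of_pos (M : RankFn α) [Nonempty α] (x : Finset α → B) (t : B) {p q s : ℝ}
    (hp : 0 ≤ p) (hq : 0 < q) (hs : 0 < s) :
    p • (-x Finset.univ) + (q • convexClass x + s • t) ∈ ampCone M x t := by
  refine ⟨s, _, hs, M.ampleOn_add hp hq, ?_⟩
  simp only [add_smul, Finset.sum_add_distrib, mul_smul, ← Finset.smul_sum, convexClass, ite_smul,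
    zero_smul, Finset.sum_ite_eq', Finset.mem_univ, if_true, neg_smul, one_smul]
  abel

theorem mixed_nonneg_top (H : PosData M x t lam) [Nonempty α]
    {s : B} {k l : ℕ} (hs : M.State x t (k + l) s) :
    0 ≤ lam (s * ((-x Finset.univ) ^ k * t ^ l)) :=
  (lorentzSystem H).limit_nonneg (u := convexClass x + t) (v := convexClass x)
    (fun c hc => by simpa using mem_ampCone_of_pos M x t zero_le_one hc hc)
    (fun c hc => by
      simpa [add_comm] using mem_ampCone_of_pos M x t (le_refl (0 : ℝ)) hc zero_lt_one) hs

theorem mixed_logConcave_top (H : PosData M x t lam) [Nonempty α]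
    {s : B} {k l : ℕ} (hs : M.State x t (k + l + 2) s) :
    lam (s * ((-x Finset.univ) ^ (k + 2) * t ^ l)) * lam (s * ((-x Finset.univ) ^ k * t ^ (l + 2)))
      ≤ lam (s * ((-x Finset.univ) ^ (k + 1) * t ^ (l + 1))) ^ 2 :=
  (lorentzSystem H).limit_logConcave (u := convexClass x + t) (v := convexClass x)
    (fun c hc => by simpa using mem_ampCone_of_pos M x t zero_le_one hc hc)
    (fun c hc => by
      simpa [add_comm] using mem_ampCone_of_pos M x t (le_refl (0 : ℝ)) hc zero_lt_one) hs

end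

section

variable {α : Type*} [DecidableEq α] [Fintype α] {B : Type*} [CommRing B] [Algebra ℝ B]
variable {M : RankFn α} {x : Finset α → B}

theorem RankFn.IsFlat.rank_pos_of_mem {G : Finset α} {i : α} (hi : i ∈ G) : 0 < M.r G :=
  lt_of_lt_of_le (by rw [M.single]; exact one_pos) (M.mono (Finset.singleton_subset_iff.2 hi))

theorem upSum_mul_eq_zero_of (H : ChowRel M x) {p : Finset α → Prop} {y : B}
    (h : ∀ F, M.IsFlat F → p F → x F * y = 0) : upSum x p * y = 0 := by
  classical
  rw [upSum, Finset.sum_mul]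
  refine Finset.sum_eq_zero fun F _ => ?_
  split_ifs with hp
  · by_cases hF : M.IsFlat F
    · exact h F hF hp
    · rw [H.eq_zero F hF, zero_mul]
  · rw [zero_mul]

/-- The sum of the generators of rank larger than `s`. -/
noncomputable def RankFn.rho (M : RankFn α) (x : Finset α → B) (s : ℕ) : B :=
  upSum x fun F => s < M.r F

theorem mul_rho (H : ChowRel M x) {G : Finset α} {i : α} (hi : i ∈ G) {s : ℕ}
    (hs : s < M.r G) :
    x G * M.rho x s = x G * (upSum x (fun F => M.IsFlat F ∧ F ⊂ G ∧ s < M.r F ∧ i ∉ F)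
      - upSum x (fun F => M.IsFlat F ∧ F ⊂ G ∧ M.r F ≤ s ∧ i ∈ F)) := by
  classical
  have h0 : M.rho x s = M.rho x s - upSum x (fun F => i ∈ F) := by rw [upSum_mem H, sub_zero]
  rw [h0]
  simp only [RankFn.rho, upSum, ← Finset.sum_sub_distrib, Finset.mul_sum]
  refine Finset.sum_congr rfl fun F _ => ?_
  by_cases hF : M.IsFlat F
  swap
  · simp [hF, H.eq_zero F hF]
  by_cases h1 : F ⊂ G
  · by_cases h2 : s < M.r F <;> by_cases h3 : i ∈ F <;> simp [hF, h1, h2, h3, not_le.2, not_lt.1]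
  · by_cases h2 : G ⊆ F
    · simp [h1, hs.trans_le (M.mono h2), h2 hi]
    · have h3 : x G * x F = 0 := H.mul_eq_zero G F h2 fun h => h1 ⟨h, h2⟩
      simp only [h1, false_and, and_false, if_false, sub_zero, mul_zero]
      split_ifs <;> simp [h3]

theorem mul_prod_rho_eq_zero (H : ChowRel M x) {G : Finset α} {i : α} (hi : i ∈ G) {N : ℕ}
    (hN : M.r G ≤ N) : x G * ∏ s ∈ Finset.range N, M.rho x s = 0 := by
  suffices h : ∀ m, ∀ G i, i ∈ G → M.r G ≤ m → x G * ∏ s ∈ Finset.range m, M.rho x s = 0 from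
    h N G i hi hN
  intro m
  induction m with
  | zero =>
    intro G i hi h
    exact absurd h (not_le.2 (RankFn.IsFlat.rank_pos_of_mem hi))
  | succ m ih =>
    intro G i hi h
    rcases h.lt_or_eq with h | h
    · rw [Finset.prod_range_succ, ← mul_assoc, ih G i hi (by lia), zero_mul]
    · rw [Finset.prod_range_succ, mul_left_comm, mul_comm, mul_rho H hi (by lia), mul_sub,
        sub_mul, mul_assoc, mul_assoc, upSum_mul_eq_zero_of H, upSum_mul_eq_zero_of H, sub_self]
      · rintro F hF ⟨-, -, h1, h2⟩
        exact ih F i h2 h1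
      · rintro F hF ⟨-, h1, h2, -⟩
        have := hF.rank_lt h1
        lia

open Classical in
theorem mul_prod_rho (H : ChowRel M x) {G : Finset α} {i : α} (hi : i ∈ G) {m : ℕ}
    (hm : M.r G = m + 2) : x G * ∏ s ∈ Finset.range (m + 1), M.rho x s
      = ∑ F, if M.IsFlat F ∧ F ⊂ G ∧ M.r F = m + 1 ∧ i ∉ F then
          x G * x F * ∏ s ∈ Finset.range m, M.rho x s else 0 := by
  rw [Finset.prod_range_succ, mul_left_comm, mul_comm, mul_rho H hi (by lia), mul_sub,
    sub_mul, mul_assoc (x G) (upSum x fun F => _ ∧ _ ∧ M.r F ≤ m ∧ _), upSum_mul_eq_zero_of H,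
    mul_zero, sub_zero, upSum, Finset.mul_sum, Finset.sum_mul]
  · refine Finset.sum_congr rfl fun F _ => ?_
    by_cases h : M.IsFlat F ∧ F ⊂ G ∧ M.r F = m + 1 ∧ i ∉ F
    · rw [if_pos h, if_pos ⟨h.1, h.2.1, by lia, h.2.2.2⟩]
    · rw [if_neg h, if_neg, mul_zero, zero_mul]
      rintro ⟨h1, h2, h3, h4⟩
      have := h1.rank_lt h2
      exact h ⟨h1, h2, by lia, h4⟩
  · rintro F hF ⟨-, -, h1, h2⟩
    exact mul_prod_rho_eq_zero H h2 h1

open Classical in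
theorem flagProd_mul_top (H : ChowRel M x) {K : Finset (Finset α)} (hK : M.Flag K)
    {G : Finset α} (hmax : ∀ F ∈ K, F = Finset.univ ∨ F ⊆ G) {j : α} (hj : j ∉ G) :
    flagProd x K * -x Finset.univ
      = ∑ F, if M.Ext K F ∧ j ∈ F then flagProd x (insert F K) else 0 := by
  have h := flagProd_sum_aff H (K := K) (a := fun F => if F = Finset.univ then -1 else 0)
    (a' := fun F => (if F = Finset.univ then -1 else 0) + 1 * if j ∈ F then 1 else 0)
    (by convert (IsAff.mem j).mul_const (-1) using 2; ring) (fun F hF => by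
      rcases hmax F hF with rfl | h
      · simp
      · have h1 : j ∉ F := fun h' => hj (h h')
        have h2 : F ≠ Finset.univ := by rintro rfl; exact h1 (Finset.mem_univ j)
        simp [h1, h2])
  simp only [ite_smul, zero_smul, Finset.sum_ite_eq', Finset.mem_univ, if_true, neg_smul,
    one_smul] at h
  rw [h]
  refine Finset.sum_congr rfl fun F _ => ?_
  by_cases hF : M.Ext K F
  · have hne : F ≠ Finset.univ := by rintro rfl; exact hF.notMem hK.top
    by_cases hjF : j ∈ F
    · simp [hF, hne, hjF, hF.flagProd_insert hK]
    · simp [hF, hne, hjF]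
  · simp [hF]

theorem RankFn.Ext.ssubset_of_mem {K : Finset (Finset α)} {F G : Finset α} (hF : M.Ext K F)
    (hG : G ∈ K) {j : α} (hj : j ∉ G) (hjF : j ∈ F) : G ⊂ F :=
  ⟨(hF.comp G hG).resolve_right fun h => hj (h hjF), fun h => hj (h hjF)⟩

theorem max_insert {K : Finset (Finset α)} {F G : Finset α}
    (hmax : ∀ F ∈ K, F = Finset.univ ∨ F ⊆ G) (hGF : G ⊂ F) :
    ∀ F' ∈ insert F K, F' = Finset.univ ∨ F' ⊆ F := by
  intro F' hF'
  rcases Finset.mem_insert.1 hF' with rfl | h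
  · exact Or.inr subset_rfl
  · exact (hmax F' h).imp_right fun h => h.trans hGF.1

theorem flagProd_mul_top_pow_eq_zero (H : ChowRel M x) {k : ℕ} {K : Finset (Finset α)}
    (hK : M.Flag K) {G : Finset α} (hG : G ∈ K) (hGu : G ≠ Finset.univ)
    (hmax : ∀ F ∈ K, F = Finset.univ ∨ F ⊆ G) (hk : M.r Finset.univ ≤ k + M.r G) :
    flagProd x K * (-x Finset.univ) ^ k = 0 := by
  classical
  induction k generalizing K G with
  | zero =>
    have := (hK.flat G hG).rank_lt (Finset.ssubset_univ_iff.2 hGu)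
    lia
  | succ k ih =>
    obtain ⟨j, -, hj⟩ := Finset.exists_of_ssubset (Finset.ssubset_univ_iff.2 hGu)
    rw [pow_succ', ← mul_assoc, flagProd_mul_top H hK hmax hj, Finset.sum_mul]
    refine Finset.sum_eq_zero fun F _ => ?_
    split_ifs with h
    · have hGF := h.1.ssubset_of_mem hG hj h.2
      have := (hK.flat G hG).rank_lt hGF
      exact ih (h.1.flag hK) (Finset.mem_insert_self _ _)
        (by rintro rfl; exact h.1.notMem hK.top) (max_insert hmax hGF) (by lia)
    · rw [zero_mul]

theorem exists_flagProd_mul_top_pow (H : ChowRel M x) {k : ℕ} {K : Finset (Finset α)}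
    (hK : M.Flag K) {G : Finset α} (hG : G ∈ K)
    (hmax : ∀ F ∈ K, F = Finset.univ ∨ F ⊆ G) (hk : M.r Finset.univ = M.r G + 1 + k) :
    ∃ K', M.Flag K' ∧ K ⊆ K' ∧ (∀ F ∈ K', F ∈ K ∨ G ⊆ F) ∧ K'.card = K.card + k ∧
      flagProd x K * (-x Finset.univ) ^ k = flagProd x K' := by
  classical
  induction k generalizing K G with
  | zero => exact ⟨K, hK, subset_rfl, fun F hF => Or.inl hF, rfl, by rw [pow_zero, mul_one]⟩
  | succ k ih =>
    have hGf := hK.flat G hG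
    have hGu : G ≠ Finset.univ := by rintro rfl; lia
    obtain ⟨j, -, hj⟩ := Finset.exists_of_ssubset (Finset.ssubset_univ_iff.2 hGu)
    have hr := RankFn.rank_cl_insert hGf hj
    have hGF := RankFn.ssubset_cl_insert (M := M) hj
    have hE : M.Ext K (M.cl (insert j G)) := by
      refine ⟨RankFn.isFlat_cl _, fun h => ?_, fun F hF => ?_⟩
      · rcases hmax _ h with h | h
        · rw [h] at hr; lia
        · exact hGF.2 h
      · rcases hmax F hF with rfl | h
        · exact Or.inr (Finset.subset_univ _)
        · exact Or.inl (h.trans hGF.1)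
    obtain ⟨K', h1, h2, h3, h4, h5⟩ := ih (hE.flag hK) (Finset.mem_insert_self _ _)
      (max_insert hmax hGF) (by lia)
    refine ⟨K', h1, (Finset.subset_insert _ _).trans h2, fun F hF => ?_, by rw [h4, hE.card]; lia,
      ?_⟩
    · rcases h3 F hF with h | h
      · rcases Finset.mem_insert.1 h with rfl | h
        · exact Or.inr hGF.1
        · exact Or.inl h
      · exact Or.inr (hGF.1.trans h)
    · rw [pow_succ', ← mul_assoc, flagProd_mul_top H hK hmax hj, Finset.sum_mul,
        Finset.sum_eq_single (M.cl (insert j G)), if_pos ⟨hE, RankFn.mem_cl_insert _ _⟩, h5]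
      · intro F _ hne
        split_ifs with h
        · have hGF' := h.1.ssubset_of_mem hG hj h.2
          have h6 := hGf.rank_lt hGF'
          have h7 : M.r F ≠ M.r G + 1 := fun h' =>
            hne (hGf.eq_cl_insert h.1.flat hGF'.1 h' hj h.2)
          exact flagProd_mul_top_pow_eq_zero H (h.1.flag hK) (Finset.mem_insert_self _ _)
            (by rintro rfl; exact h.1.notMem hK.top) (max_insert hmax hGF') (by lia)
        · rw [zero_mul]
      · simp

end

theorem Finset.sum_univ_eq_sum_erase_add_insert {α β : Type*} [Fintype α] [DecidableEq α]
    [AddCommMonoid β] (j : α) (f : Finset α → β) :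
    ∑ S, f S = ∑ S ∈ (Finset.univ.erase j).powerset, (f S + f (insert j S)) := by
  rw [← Finset.powerset_univ, ← Finset.insert_erase (Finset.mem_univ j),
    Finset.sum_powerset_insert (Finset.notMem_erase j _), Finset.sum_add_distrib]
  simp

namespace RankFn

variable {α : Type*} [DecidableEq α] [Fintype α] (M : RankFn α)

/-- The absolute value of the Möbius function of the lattice of flats. -/
noncomputable def mobius (G : Finset α) : ℝ :=
  (-1) ^ M.r G * ∑ S, if M.cl S = G then (-1) ^ S.card else 0

variable {M}

theorem eq_empty_of_rank_eq_zero {S : Finset α} (h : M.r S = 0) : S = ∅ := by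
  by_contra hne
  obtain ⟨i, hi⟩ := Finset.nonempty_iff_ne_empty.2 hne
  exact (IsFlat.rank_pos_of_mem (M := M) hi).ne' h

theorem mobius_empty : M.mobius ∅ = 1 := by
  rw [mobius, M.empty, pow_zero, one_mul, Finset.sum_eq_single ∅]
  · rw [if_pos M.isFlat_empty.cl_eq]; simp
  · intro S _ hS
    rw [if_neg]
    intro h
    exact hS (Finset.subset_empty.1 (h ▸ subset_cl S))
  · simp

theorem cl_insert_eq_of_mem {S : Finset α} {j : α} (hj : j ∈ M.cl S) :
    M.cl (insert j S) = M.cl S := by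
  refine ((isFlat_cl _).cl_subset (Finset.insert_subset hj (subset_cl S))).antisymm ?_
  exact (isFlat_cl _).cl_subset ((Finset.subset_insert _ _).trans (subset_cl _))

theorem cl_insert_cl (S : Finset α) (j : α) : M.cl (insert j (M.cl S)) = M.cl (insert j S) := by
  refine Finset.Subset.antisymm ?_ ?_
  · refine (isFlat_cl _).cl_subset (Finset.insert_subset (mem_cl_insert _ _) ?_)
    exact (isFlat_cl _).cl_subset ((Finset.subset_insert _ _).trans (subset_cl _))
  · exact (isFlat_cl _).cl_subset
      ((Finset.insert_subset_insert j (subset_cl S)).trans (subset_cl _))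

open Classical in
theorem mobius_eq_sum {G : Finset α} (hG : M.IsFlat G) {j : α} (hj : j ∈ G) :
    M.mobius G = ∑ F, if M.IsFlat F ∧ F ⊂ G ∧ M.r F + 1 = M.r G ∧ j ∉ F then M.mobius F else 0 := by
  classical
  have h1 : ∀ F, (if M.IsFlat F ∧ F ⊂ G ∧ M.r F + 1 = M.r G ∧ j ∉ F then M.mobius F else 0)
      = ∑ S, if M.IsFlat F ∧ F ⊂ G ∧ M.r F + 1 = M.r G ∧ j ∉ F ∧ M.cl S = F then
          -(-1) ^ M.r G * (-1) ^ S.card else (0 : ℝ) := by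
    intro F
    by_cases h : M.IsFlat F ∧ F ⊂ G ∧ M.r F + 1 = M.r G ∧ j ∉ F
    · rw [if_pos h, mobius, Finset.mul_sum, ← h.2.2.1, pow_succ]
      refine Finset.sum_congr rfl fun S _ => ?_
      by_cases hS : M.cl S = F
      · rw [if_pos hS, if_pos ⟨h.1, h.2.1, rfl, h.2.2.2, hS⟩]; ring
      · rw [if_neg hS, if_neg (by tauto), mul_zero]
    · rw [if_neg h]
      refine (Finset.sum_eq_zero fun S _ => if_neg ?_).symm
      tauto
  have h2 : ∀ S, (∑ F, if M.IsFlat F ∧ F ⊂ G ∧ M.r F + 1 = M.r G ∧ j ∉ F ∧ M.cl S = F then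
      -(-1) ^ M.r G * (-1) ^ S.card else (0 : ℝ))
      = if M.cl S ≠ G ∧ j ∉ M.cl S ∧ M.cl (insert j S) = G then
          -(-1) ^ M.r G * (-1) ^ S.card else 0 := by
    intro S
    have hc : M.IsFlat (M.cl S) ∧ M.cl S ⊂ G ∧ M.r (M.cl S) + 1 = M.r G ∧ j ∉ M.cl S ↔
        M.cl S ≠ G ∧ j ∉ M.cl S ∧ M.cl (insert j S) = G := by
      constructor
      · rintro ⟨-, h1, h2, h3⟩
        refine ⟨h1.ne, h3, ?_⟩
        rw [← cl_insert_cl]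
        exact ((isFlat_cl S).eq_cl_insert hG h1.1 h2.symm h3 hj).symm
      · rintro ⟨h1, h2, h3⟩
        have h4 : M.cl S ⊆ G := by
          rw [← h3]
          exact (isFlat_cl _).cl_subset ((Finset.subset_insert _ _).trans (subset_cl _))
        refine ⟨isFlat_cl S, h4.ssubset_of_ne h1, ?_, h2⟩
        rw [← h3, ← cl_insert_cl, rank_cl_insert (isFlat_cl S) h2]
    rw [Finset.sum_eq_single (M.cl S)]
    · refine if_congr ?_ rfl rfl
      rw [← hc]; tauto
    · intro F _ hF
      exact if_neg fun h => hF h.2.2.2.2.symm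
    · simp
  simp only [h1]
  rw [Finset.sum_comm]
  simp only [h2]
  rw [mobius, Finset.sum_univ_eq_sum_erase_add_insert j,
    Finset.sum_univ_eq_sum_erase_add_insert j, Finset.mul_sum]
  refine Finset.sum_congr rfl fun S hS => ?_
  have hjS : j ∉ S := fun h => Finset.notMem_erase j _ (Finset.mem_powerset.1 hS h)
  have h3 : ¬ (M.cl (insert j S) ≠ G ∧ j ∉ M.cl (insert j S) ∧
      M.cl (insert j (insert j S)) = G) := fun h => h.2.1 (mem_cl_insert S j)
  rw [if_neg h3, Finset.card_insert_of_notMem hjS, pow_succ]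
  by_cases h4 : M.cl S = G
  · have h5 := cl_insert_eq_of_mem (M := M) (S := S) (h4.symm ▸ hj)
    simp [h4, h5]
  · by_cases h5 : M.cl (insert j S) = G
    · have h6 : j ∉ M.cl S := fun h => h4 ((cl_insert_eq_of_mem h).symm.trans h5)
      simp [h4, h5, h6]
    · simp [h4, h5]

end RankFn

section

variable {α : Type*} [DecidableEq α] [Fintype α] {M : RankFn α} {A : Type*} [CommRing A]
  [Algebra ℝ A]

theorem ChowData.chowRel (D : ChowData M A) : ChowRel M D.x :=
  ⟨D.mul_eq_zero, D.eq_zero, D.sum_aff⟩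

theorem ChowData.deg_flagProd_mul_prod_rho (D : ChowData M A) {m : ℕ} {K : Finset (Finset α)}
    {G : Finset α} (hK : M.Flag K) (hG : G ∈ K) (hGu : G ≠ Finset.univ) (hm : M.r G = m + 1)
    (hmin : ∀ F ∈ K, F = ∅ ∨ G ⊆ F) (hc : K.card + m = M.r Finset.univ + 1) :
    D.deg (flagProd D.x K * ∏ s ∈ Finset.range m, M.rho D.x s) = M.mobius G := by
  classical
  induction m generalizing K G with
  | zero =>
    have hG0 : G ≠ ∅ := by rintro rfl; rw [M.empty] at hm; lia
    obtain ⟨j, hj⟩ := Finset.nonempty_iff_ne_empty.2 hG0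
    rw [Finset.prod_range_zero, mul_one, flagProd, D.deg_flag K hK hc,
      RankFn.mobius_eq_sum (hK.flat G hG) hj, Finset.sum_eq_single ∅, if_pos, RankFn.mobius_empty]
    · exact ⟨M.isFlat_empty, Finset.empty_ssubset.2 ⟨j, hj⟩, by rw [M.empty, hm],
        Finset.notMem_empty j⟩
    · intro F _ hF
      refine if_neg fun h => hF (RankFn.eq_empty_of_rank_eq_zero (M := M) ?_)
      have := h.2.2.1
      lia
    · simp
  | succ m ih =>
    have hG0 : G ≠ ∅ := by rintro rfl; rw [M.empty] at hm; lia
    obtain ⟨j, hj⟩ := Finset.nonempty_iff_ne_empty.2 hG0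
    have hsplit : flagProd D.x K = flagProd D.x (K.erase G) * D.x G := by
      rw [← flagProd_insert D.x (Finset.mem_erase.2 ⟨hG0.symm, hK.bot⟩)
        (Finset.mem_erase.2 ⟨hGu.symm, hK.top⟩) (Finset.notMem_erase G K),
        Finset.insert_erase hG]
    rw [hsplit, mul_assoc, mul_prod_rho D.chowRel hj hm, Finset.mul_sum, map_sum,
      RankFn.mobius_eq_sum (hK.flat G hG) hj]
    refine Finset.sum_congr rfl fun F _ => ?_
    by_cases h : M.IsFlat F ∧ F ⊂ G ∧ M.r F = m + 1 ∧ j ∉ F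
    swap
    · rw [if_neg h, if_neg, mul_zero, map_zero]
      rintro ⟨h1, h2, h3, h4⟩
      exact h ⟨h1, h2, by lia, h4⟩
    have h' : M.IsFlat F ∧ F ⊂ G ∧ M.r F + 1 = M.r G ∧ j ∉ F := ⟨h.1, h.2.1, by lia, h.2.2.2⟩
    rw [if_pos h, if_pos h']
    have hE : M.Ext K F := by
      refine ⟨h.1, fun hF => ?_, fun F' hF' => ?_⟩
      · rcases hmin F hF with h' | h'
        · have := h.2.2.1
          rw [h', M.empty] at this
          lia
        · exact h.2.1.2 h'
      · rcases hmin F' hF' with rfl | h'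
        · exact Or.inl (Finset.empty_subset _)
        · exact Or.inr (h.2.1.1.trans h')
    rw [← ih (hE.flag hK) (Finset.mem_insert_self F K)
      (by rintro rfl; exact hE.notMem hK.top) h.2.2.1 (fun F' hF' => ?_)
      (by rw [hE.card]; lia), hE.flagProd_insert hK, hsplit]
    · congr 1; ring
    · rcases Finset.mem_insert.1 hF' with rfl | hF'
      · exact Or.inr subset_rfl
      · exact (hmin F' hF').imp_right h.2.1.1.trans

theorem flagProd_bot_top {B : Type*} [CommRing B] (x : Finset α → B) :
    flagProd x {∅, Finset.univ} = 1 := by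
  simp [flagProd]

open Classical in
theorem ChowData.deg_top_pow_mul_prod_rho (D : ChowData M A) {N k : ℕ}
    (h : M.r Finset.univ = N + 1 + k) (j : α) :
    D.deg ((-D.x Finset.univ) ^ k * ∏ s ∈ Finset.range N, M.rho D.x s)
      = ∑ F, if M.IsFlat F ∧ M.r F = N ∧ j ∉ F then M.mobius F else 0 := by
  classical
  have H := D.chowRel
  have hne : (∅ : Finset α) ≠ Finset.univ := by
    intro h'
    rw [← h', M.empty] at h
    lia
  have hflag (F : Finset α) (hF : M.IsFlat F) : M.Flag (insert F {∅, Finset.univ}) :=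
    M.flag_bot_top.insert_flat hF fun G hG => by
      simp only [Finset.mem_insert, Finset.mem_singleton] at hG
      rcases hG with rfl | rfl
      · exact Or.inl (Finset.empty_subset _)
      · exact Or.inr (Finset.subset_univ _)
  have hmax (F : Finset α) : ∀ F' ∈ insert F ({∅, Finset.univ} : Finset (Finset α)),
      F' = Finset.univ ∨ F' ⊆ F := by
    intro F' hF'
    simp only [Finset.mem_insert, Finset.mem_singleton] at hF'
    rcases hF' with rfl | rfl | rfl
    · exact Or.inr subset_rfl
    · exact Or.inr (Finset.empty_subset _)
    · exact Or.inl rfl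
  cases N with
  | zero =>
    obtain ⟨K', h1, -, -, h4, h5⟩ := exists_flagProd_mul_top_pow H (hflag ∅ M.isFlat_empty)
      (Finset.mem_insert_self _ _) (hmax ∅) (k := k) (by rw [M.empty]; lia)
    rw [Finset.insert_eq_of_mem (by simp)] at h4 h5
    rw [flagProd_bot_top, one_mul] at h5
    rw [Finset.card_pair hne] at h4
    rw [Finset.prod_range_zero, mul_one, h5, flagProd, D.deg_flag K' h1 (by lia),
      Finset.sum_eq_single ∅, if_pos, RankFn.mobius_empty]
    · exact ⟨M.isFlat_empty, M.empty, Finset.notMem_empty j⟩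
    · exact fun F _ hF => if_neg fun h => hF (RankFn.eq_empty_of_rank_eq_zero h.2.1)
    · simp
  | succ m =>
    have e1 : M.rho D.x m = upSum D.x (fun F => m < M.r F ∧ j ∉ F)
        - upSum D.x (fun F => M.r F ≤ m ∧ j ∈ F) := by
      rw [← sub_zero (M.rho D.x m), ← upSum_mem H j]
      simp only [RankFn.rho, upSum, ← Finset.sum_sub_distrib]
      refine Finset.sum_congr rfl fun F _ => ?_
      by_cases h1 : m < M.r F <;> by_cases h2 : j ∈ F <;> simp [h1, h2, not_le.2, not_lt.1]
    rw [Finset.prod_range_succ, mul_left_comm, mul_comm, e1, mul_assoc, sub_mul,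
      upSum_mul_eq_zero_of H (p := fun F => M.r F ≤ m ∧ j ∈ F), sub_zero, upSum, Finset.sum_mul,
      Finset.mul_sum, map_sum]
    swap
    · rintro F hF ⟨h1, h2⟩
      exact mul_prod_rho_eq_zero H h2 h1
    refine Finset.sum_congr rfl fun F _ => ?_
    by_cases hF : M.IsFlat F
    swap
    · simp [hF, H.eq_zero F hF]
    by_cases hc : m < M.r F ∧ j ∉ F
    swap
    · rw [if_neg hc, if_neg, zero_mul, mul_zero, map_zero]
      rintro ⟨-, h1, h2⟩
      exact hc ⟨by lia, h2⟩
    have hFu : F ≠ Finset.univ := by rintro rfl; exact hc.2 (Finset.mem_univ j)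
    have hF0 : F ≠ ∅ := by rintro rfl; rw [M.empty] at hc; lia
    have hFn : F ∉ ({∅, Finset.univ} : Finset (Finset α)) := by simp [hFu, hF0]
    have e2 : flagProd D.x (insert F {∅, Finset.univ}) = D.x F := by
      rw [flagProd_insert D.x (by simp) (by simp) hFn, flagProd_bot_top, one_mul]
    rw [if_pos hc, mul_comm (D.x F), ← mul_assoc, mul_right_comm, mul_comm _ (D.x F), ← e2]
    by_cases hr : M.r F = m + 1
    · obtain ⟨K', h1, h2, h3, h4, h5⟩ := exists_flagProd_mul_top_pow H (hflag F hF)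
        (Finset.mem_insert_self _ _) (hmax F) (k := k) (by lia)
      rw [Finset.card_insert_of_notMem hFn, Finset.card_pair hne] at h4
      rw [h5, if_pos ⟨hF, hr, hc.2⟩]
      refine D.deg_flagProd_mul_prod_rho h1 (h2 (Finset.mem_insert_self _ _)) hFu hr
        (fun F' hF' => ?_) (by lia)
      rcases h3 F' hF' with h | h
      · simp only [Finset.mem_insert, Finset.mem_singleton] at h
        rcases h with rfl | rfl | rfl
        · exact Or.inr subset_rfl
        · exact Or.inl rfl
        · exact Or.inr (Finset.subset_univ _)
      · exact Or.inr h
    · rw [flagProd_mul_top_pow_eq_zero H (hflag F hF) (Finset.mem_insert_self _ _) hFu (hmax F)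
        (by lia), zero_mul, map_zero, if_neg fun h => hr h.2.1]

end

section

variable {α : Type*} [DecidableEq α] [Fintype α] {M : RankFn α} {A : Type*} [CommRing A]
  [Algebra ℝ A]

theorem upSum_C (x : Finset α → A) (p : Finset α → Prop) :
    upSum (fun F => C (x F)) p = C (upSum x p) := by
  classical
  rw [upSum, upSum, map_sum]
  exact Finset.sum_congr rfl fun F _ => by split_ifs <;> simp

theorem flagProd_C (x : Finset α → A) (K : Finset (Finset α)) :
    flagProd (fun F => C (x F)) K = C (flagProd x K) := by
  rw [flagProd, flagProd, map_prod]

theorem levelProd_C (x : Finset α → A) (f : Finset α → ℕ) :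
    levelProd (fun F => C (x F)) X f
      = ∏ s ∈ Finset.range (f Finset.univ), (X + C (upSum x fun F => s < f F)) := by
  simp only [levelProd, upSum_C]

theorem ChowRel.C {x : Finset α → A} (H : ChowRel M x) : ChowRel M fun F => C (x F) where
  mul_eq_zero F G h h' := by rw [← C_mul, H.mul_eq_zero F G h h', C_0]
  eq_zero F h := by rw [H.eq_zero F h, C_0]
  sum_aff a ha := by
    simp only [smul_C]
    rw [← map_sum, H.sum_aff a ha, C_0]

theorem ChowData.posData [Nonempty α] (D : ChowData M A) :
    PosData M (fun F => Polynomial.C (D.x F)) X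
      (D.deg ∘ₗ (lcoeff A (Fintype.card α - 1)).restrictScalars ℝ) where
  rel := D.chowRel.C
  lam_t g := by
    have := Fintype.card_pos (α := α)
    simp only [LinearMap.comp_apply, LinearMap.restrictScalars_apply, lcoeff_apply]
    rw [coeff_X_pow_mul', if_neg (by lia), map_zero]
  lam_flag K f hK hc hf := by
    simp only [LinearMap.comp_apply, LinearMap.restrictScalars_apply, lcoeff_apply]
    rw [flagProd_C, levelProd_C, coeff_C_mul, ← hf, Nat.add_sub_cancel]
    by_cases hA : Nontrivial A
    · have h := (monic_prod_of_monic (Finset.range (f Finset.univ))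
        (fun s => X + Polynomial.C (upSum D.x fun F => s < f F)) fun s _ => monic_X_add_C _)
      have h1 : (∏ s ∈ Finset.range (f Finset.univ),
          (X + Polynomial.C (upSum D.x fun F => s < f F))).natDegree = f Finset.univ := by
        rw [natDegree_prod_of_monic _ _ fun s _ => monic_X_add_C _]
        simp
      have h2 := h.coeff_natDegree
      rw [h1] at h2
      rw [h2, mul_one]
      exact D.deg_flag K hK hc
    · have : Subsingleton A := not_nontrivial_iff_subsingleton.1 hA
      have h := D.deg_flag K hK hc
      rw [← h]
      congr 1
      exact Subsingleton.elim _ _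

/-- The product of the factors `X + ρ` up to level `N`. -/
noncomputable def RankFn.rhoProd (M : RankFn α) (x : Finset α → A) (N : ℕ) : A[X] :=
  ∏ s ∈ Finset.range N, (X + C (M.rho x s))

/-- The mixed degrees. -/
noncomputable def ChowData.mixed (D : ChowData M A) (k : ℕ) : ℝ :=
  D.deg ((-D.x Finset.univ) ^ k * (M.rhoProd D.x (M.r Finset.univ)).coeff (k + 1))

theorem ChowData.lam_mixed (D : ChowData M A) {k l : ℕ} (h : k + l + 2 = Fintype.card α) :
    (D.deg ∘ₗ (lcoeff A (Fintype.card α - 1)).restrictScalars ℝ)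
      (levelProd (fun F => C (D.x F)) X M.r * ((-C (D.x Finset.univ)) ^ k * X ^ l))
      = D.mixed k := by
  simp only [LinearMap.comp_apply, LinearMap.restrictScalars_apply, lcoeff_apply]
  rw [levelProd_C, ← h, show k + l + 2 - 1 = k + 1 + l by lia, ← mul_assoc, coeff_mul_X_pow,
    ← C_neg, ← C_pow, coeff_mul_C, mul_comm]
  rfl

theorem RankFn.state_top (M : RankFn α) {B : Type*} [CommRing B] [Algebra ℝ B]
    (x : Finset α → B) (t : B) [Nonempty α]
    (h : M.r Finset.univ + 1 ≤ Fintype.card α) {d : ℕ} (hd : d + 2 = Fintype.card α) :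
    M.State x t d (levelProd x t M.r) := by
  have hf : M.freeRank ∅ = M.r := by
    funext F
    simp [RankFn.freeRank]
  refine ⟨{∅, Finset.univ}, ∅, M.flag_bot_top, by rwa [hf], ?_, ?_⟩
  · rw [hf, Finset.card_pair Finset.univ_nonempty.ne_empty.symm]
    lia
  · rw [hf, flagProd_bot_top, one_mul]

theorem ChowData.mixed_of_free (D : ChowData M A) (h : M.r Finset.univ = Fintype.card α) {k : ℕ}
    (hk : k + 1 ≠ Fintype.card α) : D.mixed k = 0 := by
  have h1 : M.r = Finset.card := by
    funext F
    exact M.rank_eq_card_of_subset (Finset.subset_univ F) (by rw [h, Finset.card_univ])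
  have h2 : M.rhoProd D.x (M.r Finset.univ) = X ^ Fintype.card α := by
    rw [← levelProd_card D.chowRel.C X, levelProd_C, ← h1]
    rfl
  rw [mixed, h2, coeff_X_pow, if_neg hk, mul_zero, map_zero]

theorem ChowData.deg_top_pow (D : ChowData M A) (j : α) {k : ℕ} (hk : M.r Finset.univ = k + 1) :
    D.deg ((-D.x Finset.univ) ^ k) = 1 := by
  classical
  have h := D.deg_top_pow_mul_prod_rho (N := 0) (k := k) (by lia) j
  rw [Finset.prod_range_zero, mul_one, Finset.sum_eq_single ∅, if_pos, RankFn.mobius_empty] at h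
  · exact h
  · exact ⟨M.isFlat_empty, M.empty, Finset.notMem_empty j⟩
  · exact fun F _ hF => if_neg fun h => hF (RankFn.eq_empty_of_rank_eq_zero h.2.1)
  · simp

theorem ChowData.mixed_nonneg [Nonempty α] (D : ChowData M A) {k : ℕ}
    (hk : k < M.r Finset.univ) : 0 ≤ D.mixed k := by
  have hle := M.le_card Finset.univ
  rw [Finset.card_univ] at hle
  rcases hle.lt_or_eq with h | h
  · obtain ⟨l, hl⟩ := Nat.exists_eq_add_of_le (show k + 2 ≤ Fintype.card α by lia)
    rw [← D.lam_mixed (l := l) (by lia)]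
    exact mixed_nonneg_top D.posData (M.state_top _ _ h (by lia))
  · by_cases hk' : k + 1 = Fintype.card α
    · have h1 : M.r = Finset.card := by
        funext F
        exact M.rank_eq_card_of_subset (Finset.subset_univ F) (by rw [h, Finset.card_univ])
      have h2 : M.rhoProd D.x (M.r Finset.univ) = X ^ Fintype.card α := by
        rw [← levelProd_card D.chowRel.C X, levelProd_C, ← h1]
        rfl
      rw [mixed, h2, coeff_X_pow, if_pos hk', mul_one,
        D.deg_top_pow (Classical.arbitrary α) (by lia)]
      exact zero_le_one
    · exact (D.mixed_of_free h hk').ge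

theorem ChowData.mixed_logConcave [Nonempty α] (D : ChowData M A) {k : ℕ}
    (hk : k + 2 < M.r Finset.univ) : D.mixed (k + 2) * D.mixed k ≤ D.mixed (k + 1) ^ 2 := by
  have hle := M.le_card Finset.univ
  rw [Finset.card_univ] at hle
  rcases hle.lt_or_eq with h | h
  · obtain ⟨l, hl⟩ := Nat.exists_eq_add_of_le (show k + 4 ≤ Fintype.card α by lia)
    rw [← D.lam_mixed (k := k) (l := l + 2) (by lia),
      ← D.lam_mixed (k := k + 1) (l := l + 1) (by lia),
      ← D.lam_mixed (k := k + 2) (l := l) (by lia)]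
    exact mixed_logConcave_top D.posData (M.state_top _ _ h (by lia))
  · rw [D.mixed_of_free h (k := k) (by lia), mul_zero]
    positivity

/-- Truncated mixed degrees. -/
noncomputable def ChowData.partialMixed (D : ChowData M A) (k c : ℕ) : ℝ :=
  if k < M.r Finset.univ then
    D.deg ((-D.x Finset.univ) ^ k * (M.rhoProd D.x (M.r Finset.univ - 1 - k + c)).coeff c)
  else 0

theorem top_pow_eq_zero {x : Finset α → A} (H : ChowRel M x) (hr : 0 < M.r Finset.univ) :
    (-x Finset.univ) ^ M.r Finset.univ = 0 := by
  have h := flagProd_mul_top_pow_eq_zero H M.flag_bot_top (G := ∅) (k := M.r Finset.univ)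
    (by simp) (by
      intro h
      rw [← h, M.empty] at hr
      exact lt_irrefl 0 hr)
    (fun F hF => by
      rcases Finset.mem_insert.1 hF with rfl | h
      · exact Or.inr subset_rfl
      · exact Or.inl (Finset.mem_singleton.1 h)) (by lia)
  rwa [flagProd_bot_top, one_mul] at h

theorem top_pow_mul_rho {x : Finset α → A} (H : ChowRel M x) {k s : ℕ}
    (hs : M.r Finset.univ ≤ k + s + 1) (hs' : s < M.r Finset.univ) :
    (-x Finset.univ) ^ k * M.rho x s = -(-x Finset.univ) ^ (k + 1) := by
  have hu : ∀ F : Finset α, F ≠ ∅ → F ≠ Finset.univ → s < M.r F → M.IsFlat F →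
      x F * (-x Finset.univ) ^ k = 0 := by
    intro F h0 h1 h2 hF
    have h3 : F ∉ ({∅, Finset.univ} : Finset (Finset α)) := by simp [h0, h1]
    have h4 := flagProd_mul_top_pow_eq_zero H (K := insert F {∅, Finset.univ}) (G := F) (k := k)
      (M.flag_bot_top.insert_flat hF fun G hG => by
        rcases Finset.mem_insert.1 hG with rfl | hG
        · exact Or.inl (Finset.empty_subset _)
        · rw [Finset.mem_singleton.1 hG]; exact Or.inr (Finset.subset_univ _))
      (Finset.mem_insert_self _ _) h1 (fun F' hF' => by
        simp only [Finset.mem_insert, Finset.mem_singleton] at hF'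
        rcases hF' with rfl | rfl | rfl
        · exact Or.inr subset_rfl
        · exact Or.inr (Finset.empty_subset _)
        · exact Or.inl rfl) (by lia)
    rwa [flagProd_insert x (by simp) (by simp) h3, flagProd_bot_top, one_mul] at h4
  have h1 : M.rho x s = x Finset.univ + upSum x (fun F => s < M.r F ∧ F ≠ Finset.univ) := by
    rw [RankFn.rho, upSum_split x _ fun F => F = Finset.univ]
    congr 1
    rw [upSum, Finset.sum_eq_single Finset.univ]
    · rw [if_pos ⟨hs', rfl⟩]
    · exact fun F _ hF => if_neg fun h => hF h.2
    · simp
  rw [h1, mul_comm, add_mul, upSum_mul_eq_zero_of H fun F hF h => hu F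
    (by rintro rfl; rw [M.empty] at h; lia) h.2 h.1 hF]
  ring

theorem ChowData.partialMixed_succ (D : ChowData M A) {k c : ℕ} (hc : c ≤ k) :
    D.partialMixed k (c + 1) = D.partialMixed k c - D.partialMixed (k + 1) (c + 1) := by
  by_cases hk : k < M.r Finset.univ
  swap
  · simp [partialMixed, hk, show ¬ k + 1 < M.r Finset.univ by lia]
  set N := M.r Finset.univ - 1 - k + c with hN
  have h1 : M.rhoProd D.x (N + 1) = M.rhoProd D.x N * (X + C (M.rho D.x N)) :=
    Finset.prod_range_succ _ _
  have h2 := top_pow_mul_rho D.chowRel (k := k) (s := N) (by lia) (by lia)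
  have h3 : D.partialMixed (k + 1) (c + 1)
      = D.deg ((-D.x Finset.univ) ^ (k + 1) * (M.rhoProd D.x N).coeff (c + 1)) := by
    by_cases hk' : k + 1 < M.r Finset.univ
    · rw [partialMixed, if_pos hk']
      congr 4
      lia
    · have : k + 1 = M.r Finset.univ := by lia
      rw [partialMixed, if_neg hk', this, top_pow_eq_zero D.chowRel (by lia), zero_mul, map_zero]
  rw [h3, partialMixed, partialMixed, if_pos hk, if_pos hk, ← hN, ← add_assoc, ← hN, h1, mul_add,
    coeff_add, coeff_mul_X, coeff_mul_C, ← map_sub]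
  congr 1
  linear_combination (M.rhoProd D.x N).coeff (c + 1) * h2

theorem ChowData.mixed_eq_partialMixed (D : ChowData M A) {k : ℕ} (hk : k < M.r Finset.univ) :
    D.mixed k = D.partialMixed k (k + 1) := by
  rw [mixed, partialMixed, if_pos hk]
  congr 4
  lia

open Classical in
theorem ChowData.partialMixed_zero (D : ChowData M A) {N k : ℕ}
    (h : M.r Finset.univ = N + 1 + k) (j : α) : D.partialMixed k 0
      = ∑ F, if M.IsFlat F ∧ M.r F = N ∧ j ∉ F then M.mobius F else 0 := by
  rw [partialMixed, if_pos (by lia), ← D.deg_top_pow_mul_prod_rho h j,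
    show M.r Finset.univ - 1 - k + 0 = N by lia, RankFn.rhoProd, coeff_zero_prod]
  simp

end

/-- Iterated alternating partial sums. -/
theorem eq_sum_choose_of_rec {G : ℕ → ℕ → ℝ} {R : ℕ}
    (hrec : ∀ k c, c ≤ k → G k (c + 1) = G k c - G (k + 1) (c + 1))
    (h0 : ∀ k c, R ≤ k → G k c = 0) {N k c : ℕ} (hc : c ≤ k) (hN : R ≤ k + N) :
    G k (c + 1) = ∑ i ∈ Finset.range N, (-1) ^ i * (c + i).choose i * G (k + i) 0 := by
  induction c generalizing N k with
  | zero =>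
    induction N generalizing k with
    | zero => simp [h0 k _ hN]
    | succ N ih =>
      rw [hrec k 0 hc, ih (Nat.zero_le _) (by lia), Finset.sum_range_succ', sub_eq_neg_add,
        ← Finset.sum_neg_distrib]
      congr 1
      · refine Finset.sum_congr rfl fun i _ => ?_
        rw [show k + 1 + i = k + (i + 1) by lia]
        simp [pow_succ]
      · simp
  | succ c ihc =>
    induction N generalizing k with
    | zero => simp [h0 k _ hN]
    | succ N ih =>
      rw [hrec k (c + 1) hc, ihc (by lia) hN, ih (by lia) (by lia), Finset.sum_range_succ',
        Finset.sum_range_succ' _ N, add_sub_right_comm, ← Finset.sum_sub_distrib]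
      congr 1
      · refine Finset.sum_congr rfl fun i _ => ?_
        rw [show k + 1 + i = k + (i + 1) by lia, show c + 1 + (i + 1) = (c + 1 + i) + 1 by lia,
          Nat.choose_succ_succ (c + 1 + i) i, show c + (i + 1) = c + 1 + i by lia]
        push_cast
        ring
      · simp

section

variable {α : Type*} [DecidableEq α] [Fintype α] {M : RankFn α} {A : Type*} [CommRing A]
  [Algebra ℝ A]

theorem ChowData.neg_one_pow_mul_partialMixed_zero (D : ChowData M A) {N k : ℕ}
    (h : M.r Finset.univ = N + 1 + k) (j : α) : (-1) ^ N * D.partialMixed k 0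
      = ∑ S, if M.r S = N ∧ j ∉ M.cl S then (-1) ^ S.card else 0 := by
  classical
  have h1 : ∀ F, (-1) ^ N * (if M.IsFlat F ∧ M.r F = N ∧ j ∉ F then M.mobius F else 0)
      = ∑ S, if M.cl S = F ∧ M.r S = N ∧ j ∉ M.cl S then (-1) ^ S.card else (0 : ℝ) := by
    intro F
    by_cases hF : M.IsFlat F ∧ M.r F = N ∧ j ∉ F
    · rw [if_pos hF, RankFn.mobius, hF.2.1, ← mul_assoc, ← mul_pow, neg_one_mul, neg_neg, one_pow,
        one_mul]
      refine Finset.sum_congr rfl fun S _ => if_congr ?_ rfl rfl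
      constructor
      · rintro rfl
        exact ⟨rfl, by rw [← RankFn.rank_cl, hF.2.1], hF.2.2⟩
      · exact fun h => h.1
    · rw [if_neg hF, mul_zero]
      refine (Finset.sum_eq_zero fun S _ => if_neg ?_).symm
      rintro ⟨rfl, h1, h2⟩
      exact hF ⟨RankFn.isFlat_cl S, by rw [RankFn.rank_cl, h1], h2⟩
  rw [D.partialMixed_zero h j, Finset.mul_sum]
  simp only [h1]
  rw [Finset.sum_comm]
  refine Finset.sum_congr rfl fun S _ => ?_
  rw [Finset.sum_eq_single (M.cl S)]
  · simp
  · intro F _ hF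
    exact if_neg fun h => hF h.1.symm
  · simp

variable (M) in
theorem RankFn.sum_card_mul_X_pow (j : α) :
    ∑ S, (-1 : ℝ[X]) ^ S.card * X ^ (M.r Finset.univ - M.r S) = (X - 1) *
      ∑ S, if j ∉ M.cl S then (-1 : ℝ[X]) ^ S.card * X ^ (M.r Finset.univ - 1 - M.r S) else 0 := by
  rw [Finset.sum_univ_eq_sum_erase_add_insert j, Finset.sum_univ_eq_sum_erase_add_insert j,
    Finset.mul_sum]
  refine Finset.sum_congr rfl fun S hS => ?_
  have hjS : j ∉ S := fun h => Finset.notMem_erase j _ (Finset.mem_powerset.1 hS h)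
  rw [if_neg (not_not.2 (RankFn.mem_cl_insert S j)), add_zero, Finset.card_insert_of_notMem hjS,
    pow_succ]
  by_cases hc : j ∈ M.cl S
  · rw [if_neg (not_not.2 hc), RankFn.mem_cl.1 hc]
    ring
  · have h1 : M.r (insert j S) = M.r S + 1 := by
      have := M.insert_le j S
      have := M.mono (Finset.subset_insert j S)
      have := mt RankFn.mem_cl.2 hc
      lia
    have h2 := M.mono (Finset.subset_univ (insert j S))
    rw [if_pos hc, h1, show M.r Finset.univ - M.r S = M.r Finset.univ - 1 - M.r S + 1 by lia,
      Nat.sub_sub, add_comm 1 (M.r S), pow_succ]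
    ring

theorem ChowData.sum_card_mul_X_pow (D : ChowData M A) [Nonempty α] :
    ∑ S, (-1 : ℝ[X]) ^ S.card * X ^ (M.r Finset.univ - M.r S) =
      (X - 1) * ∑ k ∈ Finset.range (M.r Finset.univ),
        C ((-1) ^ (M.r Finset.univ - 1 - k) * D.partialMixed k 0) * X ^ k := by
  obtain ⟨j⟩ := ‹Nonempty α›
  rw [M.sum_card_mul_X_pow j]
  congr 1
  have h1 : ∀ k ∈ Finset.range (M.r Finset.univ),
      C ((-1) ^ (M.r Finset.univ - 1 - k) * D.partialMixed k 0) * X ^ k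
      = ∑ S, if M.r S = M.r Finset.univ - 1 - k ∧ j ∉ M.cl S then
          (-1 : ℝ[X]) ^ S.card * X ^ k else 0 := by
    intro k hk
    rw [Finset.mem_range] at hk
    rw [D.neg_one_pow_mul_partialMixed_zero (by lia) j, map_sum, Finset.sum_mul]
    refine Finset.sum_congr rfl fun S _ => ?_
    split_ifs <;> simp
  rw [Finset.sum_congr rfl h1, Finset.sum_comm]
  refine Finset.sum_congr rfl fun S _ => ?_
  by_cases hc : j ∈ M.cl S
  · simp [hc]
  · have h2 : M.r S < M.r Finset.univ := by
      have := M.mono (Finset.subset_univ (insert j S))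
      have := M.mono (Finset.subset_insert j S)
      have := mt RankFn.mem_cl.2 hc
      lia
    rw [if_pos hc, Finset.sum_eq_single (M.r Finset.univ - 1 - M.r S), if_pos ⟨by lia, hc⟩]
    · intro k hk hne
      rw [Finset.mem_range] at hk
      exact if_neg fun h => hne (by lia)
    · intro h
      exact absurd (Finset.mem_range.2 (by lia)) h

theorem ChowData.mixed_eq_sum (D : ChowData M A) {i : ℕ} (hi : i < M.r Finset.univ) :
    D.mixed i = ∑ k ∈ Finset.range (M.r Finset.univ),
      (-1) ^ (i + k) * (k.choose i : ℝ) * D.partialMixed k 0 := by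
  have h0 (k c : ℕ) (hk : M.r Finset.univ ≤ k) : D.partialMixed k c = 0 := by
    rw [partialMixed, if_neg (not_lt.2 hk)]
  obtain ⟨N, hN⟩ := Nat.exists_eq_add_of_le hi.le
  have h1 : ∑ k ∈ Finset.range i, (-1) ^ (i + k) * (k.choose i : ℝ) * D.partialMixed k 0 = 0 :=
    Finset.sum_eq_zero fun k hk => by
      rw [Nat.choose_eq_zero_of_lt (Finset.mem_range.1 hk)]
      simp
  rw [D.mixed_eq_partialMixed hi, eq_sum_choose_of_rec (G := D.partialMixed)
    (fun k c hc => D.partialMixed_succ hc) h0 le_rfl hN.le, hN, Finset.sum_range_add, h1, zero_add]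
  refine Finset.sum_congr rfl fun l _ => ?_
  rw [Nat.choose_symm_add, ← add_assoc, pow_add, ← two_mul, pow_mul, neg_one_sq, one_pow, one_mul]

theorem ChowData.charPoly_comp_X_add_one (D : ChowData M A) [Nonempty α] :
    (∑ S : Finset α, (-1 : ℝ[X]) ^ S.card * X ^ (M.r Finset.univ - M.r S)).comp (X + 1) =
      X * ∑ i ∈ Finset.range (M.r Finset.univ),
        C ((-1) ^ (M.r Finset.univ - 1 - i) * D.mixed i) * X ^ i := by
  rw [D.sum_card_mul_X_pow]
  simp only [mul_comp, sub_comp, X_comp, one_comp, Polynomial.sum_comp, C_comp, pow_comp,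
    add_sub_cancel_right]
  congr 1
  ext i
  simp only [finsetSum_coeff, coeff_C_mul, coeff_X_pow, coeff_X_add_one_pow]
  by_cases hi : i < M.r Finset.univ
  · rw [Finset.sum_eq_single_of_mem (f := fun x => _ * D.mixed x * _) i (Finset.mem_range.2 hi)
      (fun k _ hk => by simp [hk.symm]), if_pos rfl, mul_one, D.mixed_eq_sum hi, Finset.mul_sum]
    refine Finset.sum_congr rfl fun k hk => ?_
    rw [Finset.mem_range] at hk
    by_cases hik : i ≤ k
    · obtain ⟨l, rfl⟩ := Nat.exists_eq_add_of_le hik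
      rw [show M.r Finset.univ - 1 - i = M.r Finset.univ - 1 - (i + l) + l by lia, pow_add _ _ l,
        ← add_assoc, pow_add _ (i + i) l, ← two_mul, pow_mul _ 2, neg_one_sq, one_pow]
      have : (-1 : ℝ) ^ l * (-1) ^ l = 1 := by rw [← mul_pow]; simp
      linear_combination (-(-1 : ℝ) ^ (M.r Finset.univ - 1 - (i + l)) * D.partialMixed (i + l) 0 *
        ((i + l).choose i : ℝ)) * this
    · rw [Nat.choose_eq_zero_of_lt (not_le.1 hik)]
      simp
  · rw [Finset.sum_eq_zero, Finset.sum_eq_zero]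
    · intro k hk
      rw [Finset.mem_range] at hk
      rw [if_neg (by lia), mul_zero]
    · intro k hk
      rw [Finset.mem_range] at hk
      rw [Nat.choose_eq_zero_of_lt (by lia), Nat.cast_zero, mul_zero]

end

theorem coe_matroidRank {α : Type*} [Finite α] (M : Matroid α) (X : Set α) :
    (matroidRank M X : ℕ∞) = M.eRk X := by
  obtain ⟨I, hI⟩ := M.exists_isBasis' X
  have h : IsGreatest {m | ∃ I ⊆ X, M.Indep I ∧ I.ncard = m} I.ncard := by
    refine ⟨⟨I, hI.subset, hI.indep, rfl⟩, ?_⟩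
    rintro _ ⟨J, hJX, hJ, rfl⟩
    have := hJ.encard_le_eRk_of_subset hJX
    rw [← hI.encard_eq_eRk, ← J.toFinite.cast_ncard_eq, ← I.toFinite.cast_ncard_eq] at this
    exact_mod_cast this
  rw [matroidRank, h.csSup_eq, I.toFinite.cast_ncard_eq, hI.encard_eq_eRk]

theorem matroidRank_mono {α : Type*} [Finite α] (M : Matroid α) {X Y : Set α} (h : X ⊆ Y) :
    matroidRank M X ≤ matroidRank M Y := by
  have := M.eRk_mono h
  simpa only [← coe_matroidRank, Nat.cast_le] using this

theorem matroidRank_submod {α : Type*} [Finite α] (M : Matroid α) (X Y : Set α) :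
    matroidRank M (X ∪ Y) + matroidRank M (X ∩ Y) ≤ matroidRank M X + matroidRank M Y := by
  have := M.eRk_inter_add_eRk_union_le X Y
  rw [add_comm]
  simpa only [← coe_matroidRank, ← Nat.cast_add, Nat.cast_le] using this

theorem matroidRank_empty {α : Type*} [Finite α] (M : Matroid α) : matroidRank M ∅ = 0 := by
  simpa using coe_matroidRank M ∅

theorem matroidRank_singleton_le {α : Type*} [Finite α] (M : Matroid α) (i : α) :
    matroidRank M {i} ≤ 1 := by
  have := M.eRk_le_encard {i}
  rw [← coe_matroidRank, Set.encard_singleton] at this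
  exact_mod_cast this

/-- The rank function of a loopless matroid. -/
noncomputable def RankFn.ofMatroid {α : Type*} [DecidableEq α] [Finite α] (M : Matroid α)
    (h : ∀ i, matroidRank M {i} ≠ 0) : RankFn α where
  r S := matroidRank M ↑S
  empty := by rw [Finset.coe_empty, matroidRank_empty]
  mono hAB := matroidRank_mono M (Finset.coe_subset.2 hAB)
  single i := by
    rw [Finset.coe_singleton]
    have := matroidRank_singleton_le M i
    have := h i
    lia
  submod A B := by
    rw [Finset.coe_union, Finset.coe_inter]
    exact matroidRank_submod M A B

theorem matroidCharPoly_eq_zero {α : Type*} [Fintype α] (M : Matroid α) (r : ℕ) {i : α}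
    (hi : matroidRank M {i} = 0) : matroidCharPoly M r = 0 := by
  classical
  rw [matroidCharPoly, Finset.sum_univ_eq_sum_erase_add_insert i]
  refine Finset.sum_eq_zero fun S hS => ?_
  have hiS : i ∉ S := fun h => Finset.notMem_erase i _ (Finset.mem_powerset.1 hS h)
  have h1 : matroidRank M ↑(insert i S) = matroidRank M ↑S := by
    refine le_antisymm ?_ (matroidRank_mono M (Finset.coe_subset.2 (Finset.subset_insert i S)))
    have := matroidRank_submod M {i} ↑S
    rw [Finset.coe_insert, Set.insert_eq]
    lia
  rw [h1, Finset.card_insert_of_notMem hiS, pow_succ]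
  ring

theorem coeff_sum_C_mul_X_pow_sub {R : Type*} [Semiring R] (f : ℕ → R) {n k : ℕ} (hk : k ≤ n) :
    (∑ k ∈ Finset.range (n + 1), C (f k) * X ^ (n - k)).coeff (n - k) = f k := by
  simp only [finsetSum_coeff, coeff_C_mul, coeff_X_pow]
  rw [Finset.sum_eq_single_of_mem k (Finset.mem_range.2 (by lia)), if_pos rfl, mul_one]
  intro l hl hne
  rw [Finset.mem_range] at hl
  rw [if_neg (by lia), mul_zero]

/-- **Log-concavity of the h-vector of the broken circuit complex.**
If `M` is a matroid of rank `r + 1` on a finite ground set and `h` is the h-vector of its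
broken circuit complex, defined by `χ_M(q+1) = Σ_{k=0}^{r+1} (−1)^k h_k q^{r+1−k}`, then
`h_k ≥ 0` for all `0 ≤ k ≤ r+1` and `h_{k-1} h_{k+1} ≤ h_k ^ 2` for all `0 < k < r+1`. -/
theorem hvector_brokenCircuit_logConcave {α : Type*} [Fintype α] (M : Matroid α)
    (hE : M.E = Set.univ) (r : ℕ) (hrank : matroidRank M Set.univ = r + 1)
    (h : ℕ → ℤ)
    (hh : (matroidCharPoly M r).comp (X + 1) =
      ∑ k ∈ Finset.range (r + 2), C ((-1) ^ k * h k) * X ^ (r + 1 - k)) :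
    (∀ k ≤ r + 1, 0 ≤ h k) ∧
    (∀ k : ℕ, 0 < k → k < r + 1 → h (k - 1) * h (k + 1) ≤ h k ^ 2) := by

  classical
  have hcoeff (k : ℕ) (hk : k ≤ r + 1) :
      ((matroidCharPoly M r).comp (X + 1)).coeff (r + 1 - k) = (-1) ^ k * h k := by
    rw [hh, coeff_sum_C_mul_X_pow_sub _ hk]
  by_cases hloop : ∃ i, matroidRank M {i} = 0
  · obtain ⟨i, hi⟩ := hloop
    have h0 (k : ℕ) (hk : k ≤ r + 1) : h k = 0 := by
      have := hcoeff k hk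
      rw [matroidCharPoly_eq_zero M r hi] at this
      simpa using this
    refine ⟨fun k hk => (h0 k hk).ge, fun k _ hk => ?_⟩
    rw [h0 (k + 1) hk, h0 k hk.le]
    simp
  push Not at hloop
  let N := RankFn.ofMatroid M hloop
  have hN : N.r Finset.univ = r + 1 := by
    rw [← hrank, ← Finset.coe_univ]
    rfl
  have hne : Nonempty α := by
    by_contra hα
    rw [not_nonempty_iff] at hα
    rw [Set.univ_eq_empty_iff.2 hα, matroidRank_empty] at hrank
    lia
  let D := N.chowData
  have hchar : ((matroidCharPoly M r).comp (X + 1)).map (Int.castRingHom ℝ) =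
      X * ∑ i ∈ Finset.range (r + 1), C ((-1) ^ (r - i) * D.mixed i) * X ^ i := by
    have := D.charPoly_comp_X_add_one
    rw [hN, Nat.add_sub_cancel] at this
    rw [← this, Polynomial.map_comp, matroidCharPoly, Polynomial.map_sum]
    congr 1
    · refine Finset.sum_congr rfl fun S _ => ?_
      simp only [Polynomial.map_mul, Polynomial.map_pow, Polynomial.map_neg, Polynomial.map_one,
        Polynomial.map_X]
      rfl
    · simp
  have hreal (k : ℕ) (hk : k ≤ r + 1) :
      (X * ∑ i ∈ Finset.range (r + 1), C ((-1) ^ (r - i) * D.mixed i) * X ^ i).coeff (r + 1 - k)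
        = (-1) ^ k * (h k : ℝ) := by
    rw [← hchar, coeff_map, hcoeff k hk]
    simp
  have hlast : h (r + 1) = 0 := by
    have := hreal (r + 1) le_rfl
    simpa using this
  have hmixed (k : ℕ) (hk : k ≤ r) : (h k : ℝ) = D.mixed (r - k) := by
    have := hreal k (by lia)
    rw [Nat.sub_add_comm hk, coeff_X_mul] at this
    simp only [finsetSum_coeff, coeff_C_mul, coeff_X_pow] at this
    rw [Finset.sum_eq_single_of_mem (r - k) (Finset.mem_range.2 (by lia))
      (fun l _ hl => by rw [if_neg hl.symm, mul_zero]), if_pos rfl, mul_one,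
      Nat.sub_sub_self hk] at this
    exact (mul_left_cancel₀ (by simp) this).symm
  refine ⟨fun k hk => ?_, fun k hk0 hk => ?_⟩
  · rcases hk.eq_or_lt with rfl | hk
    · exact hlast.ge
    · have : (0 : ℝ) ≤ h k := by
        rw [hmixed k (by lia)]
        exact D.mixed_nonneg (by lia)
      exact_mod_cast this
  · rcases (Nat.succ_le_of_lt hk).eq_or_lt with h1 | h1
    · rw [← Nat.succ_eq_add_one, h1, hlast, mul_zero]
      positivity
    · have := D.mixed_logConcave (k := r - (k + 1)) (by lia)
      rw [show r - (k + 1) + 2 = r - (k - 1) by lia, show r - (k + 1) + 1 = r - k by lia,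
        ← hmixed _ (by lia), ← hmixed _ (by lia), ← hmixed _ (by lia)] at this
      exact_mod_cast this
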